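/- arXiv:1211.4845 — 3 statements merged into one kernel-verified Lean document; each statement's English description precedes it below -/
import Mathlib

section
/- With the notations of the context, define for u, v, z ∈ ℝ, σ ∈ ℝ and τ ∈ ℝ: ℒ(u,v;σ,τ) = C·λ^{1/3}·∫₀^∞ b̃_{τ,u}(x)·b̃_{−τ,v}(x) dx + C·∫₀^∞ 𝒜_{τ,u}(x)·𝒜_{−τ,v}(x) dx + C·∫₀^∞∫₀^∞ R_σ(x,y)·𝒜_{τ,u}(x)·𝒜_{−τ,v}(y) dx dy, and p̂₁(z;σ,τ) = 𝒜̃_{τ,z}(0) + ∫₀^∞ R_σ(x,0)·𝒜̃_{τ,z}(x) dx, p̂₂(z;σ,τ) = 𝒜_{τ,z}(0) + ∫₀^∞ R_σ(x,0)·𝒜_{τ,z}(x) dx. Then for all u, v, τ and all σ: ∂ℒ(u,v;σ,τ)/∂σ = −C^{−2}·(λ^{1/3}·p̂₁(u;σ,τ)·p̂₁(v;σ,−τ) + λ^{−1/2}·p̂₂(u;σ,τ)·p̂₂(v;σ,−τ)). -/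
open Real MeasureTheory Set

noncomputable section

/-- `C = (1 + λ^{-1/2})^{1/3}`. -/
def Cc (lam : ℝ) : ℝ := (1 + lam ^ (-(1 : ℝ) / 2)) ^ ((1 : ℝ) / 3)

/-- `Σ = λ^{-1/2} (1 + λ^{-1/2})^{-2/3} σ`. -/
def Sig (lam σ : ℝ) : ℝ := lam ^ (-(1 : ℝ) / 2) * (1 + lam ^ (-(1 : ℝ) / 2)) ^ (-(2 : ℝ) / 3) * σ

/-- `b_{τ,z}(x) = exp(-τ y + τ³/3) Ai(y)`, `y = z + C x + Σ + τ²`. -/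
def bb (Ai : ℝ → ℝ) (lam σ τ z x : ℝ) : ℝ :=
  Real.exp (-τ * (z + Cc lam * x + Sig lam σ + τ ^ 2) + τ ^ 3 / 3) *
    Ai (z + Cc lam * x + Sig lam σ + τ ^ 2)

/-- `b̃_{τ,z}(x) = exp(-√λ τ ỹ + λ τ³/3) Ai(λ^{1/6} ỹ)`, `ỹ = -z + C x + √λ (Σ + τ²)`. -/
def bt (Ai : ℝ → ℝ) (lam σ τ z x : ℝ) : ℝ :=
  Real.exp (-Real.sqrt lam * τ * (-z + Cc lam * x + Real.sqrt lam * (Sig lam σ + τ ^ 2))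
      + lam * τ ^ 3 / 3) *
    Ai (lam ^ ((1 : ℝ) / 6) * (-z + Cc lam * x + Real.sqrt lam * (Sig lam σ + τ ^ 2)))

/-- `𝒜_{τ,z}(x) = b_{τ,z}(x) - λ^{1/6} ∫₀^∞ Ai(x+y+σ) b̃_{τ,z}(y) dy`. -/
def AA (Ai : ℝ → ℝ) (lam σ τ z x : ℝ) : ℝ :=
  bb Ai lam σ τ z x - lam ^ ((1 : ℝ) / 6) * ∫ y in Ioi (0 : ℝ), Ai (x + y + σ) * bt Ai lam σ τ z y

/-- `𝒜̃_{τ,z}(x) = b̃_{τ,z}(x) - λ^{-1/6} ∫₀^∞ Ai(x+y+σ) b_{τ,z}(y) dy`. -/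
def AAt (Ai : ℝ → ℝ) (lam σ τ z x : ℝ) : ℝ :=
  bt Ai lam σ τ z x - lam ^ (-(1 : ℝ) / 6) * ∫ y in Ioi (0 : ℝ), Ai (x + y + σ) * bb Ai lam σ τ z y

/-- The shifted Airy kernel `K_{Ai,σ}(x,y) = ∫₀^∞ Ai(x+t+σ) Ai(y+t+σ) dt`. -/
def KAi (Ai : ℝ → ℝ) (σ x y : ℝ) : ℝ :=
  ∫ t in Ioi (0 : ℝ), Ai (x + t + σ) * Ai (y + t + σ)

/-- The Tracy–Widom function `Q_σ(x) = Ai(x+σ) + ∫₀^∞ R_σ(x,y) Ai(y+σ) dy`. -/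
def Qf (Ai : ℝ → ℝ) (R : ℝ → ℝ → ℝ → ℝ) (σ x : ℝ) : ℝ :=
  Ai (x + σ) + ∫ y in Ioi (0 : ℝ), R σ x y * Ai (y + σ)

/-- `p̂₁(z;σ,τ) = 𝒜̃_{τ,z}(0) + ∫₀^∞ R_σ(x,0) 𝒜̃_{τ,z}(x) dx`. -/
def p1hat (Ai : ℝ → ℝ) (lam : ℝ) (R : ℝ → ℝ → ℝ → ℝ) (z σ τ : ℝ) : ℝ :=
  AAt Ai lam σ τ z 0 + ∫ x in Ioi (0 : ℝ), R σ x 0 * AAt Ai lam σ τ z x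

/-- `p̂₂(z;σ,τ) = 𝒜_{τ,z}(0) + ∫₀^∞ R_σ(x,0) 𝒜_{τ,z}(x) dx`. -/
def p2hat (Ai : ℝ → ℝ) (lam : ℝ) (R : ℝ → ℝ → ℝ → ℝ) (z σ τ : ℝ) : ℝ :=
  AA Ai lam σ τ z 0 + ∫ x in Ioi (0 : ℝ), R σ x 0 * AA Ai lam σ τ z x

/-- The single-time Ferrari–Vető tacnode kernel in three-term form. -/
def Ltac (Ai : ℝ → ℝ) (lam : ℝ) (R : ℝ → ℝ → ℝ → ℝ) (u v σ τ : ℝ) : ℝ :=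
  Cc lam * lam ^ ((1 : ℝ) / 3) * (∫ x in Ioi (0 : ℝ), bt Ai lam σ τ u x * bt Ai lam σ (-τ) v x)
  + Cc lam * (∫ x in Ioi (0 : ℝ), AA Ai lam σ τ u x * AA Ai lam σ (-τ) v x)
  + Cc lam * ∫ x in Ioi (0 : ℝ), ∫ y in Ioi (0 : ℝ),
      R σ x y * AA Ai lam σ τ u x * AA Ai lam σ (-τ) v y

/-- A continuous function of `w` that is `O(e^{-w})` on every right half-line. -/
def ExpDecaying (h : ℝ → ℝ) : Prop :=
  Continuous h ∧ ∀ n : ℝ, ∃ M, 0 ≤ M ∧ ∀ w, -n ≤ w → |h w| ≤ M * Real.exp (-w)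

/-- A continuous family `h s w` that is `O(e^{-w})` on every right half-line, locally uniformly
in the parameter `s`. -/
def LocExpDecaying (h : ℝ → ℝ → ℝ) : Prop :=
  Continuous (fun p : ℝ × ℝ => h p.1 p.2) ∧
    ∀ n : ℝ, ∃ M, 0 ≤ M ∧ ∀ s w, |s| ≤ n → -n ≤ w → |h s w| ≤ M * Real.exp (-w)

/-- A continuous family of kernels `k s x w` that is `O(e^{-x-w})` for `w ≥ 0` and `x` in a right
half-line, locally uniformly in the parameter `s`. -/
def LocExpKernel (k : ℝ → ℝ → ℝ → ℝ) : Prop :=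
  Continuous (fun p : ℝ × ℝ × ℝ => k p.1 p.2.1 p.2.2) ∧
    ∀ n : ℝ, ∃ M, 0 ≤ M ∧ ∀ s x w, |s| ≤ n → -n ≤ x → 0 ≤ w →
      |k s x w| ≤ M * Real.exp (-x - w)

/-- The integral operator on the half-line with kernel `k`. -/
def halfLineOp (k : ℝ → ℝ → ℝ → ℝ) (h : ℝ → ℝ → ℝ) (s x : ℝ) : ℝ :=
  ∫ w in Ioi (0 : ℝ), k s x w * h s w

theorem LocExpDecaying.slice {h : ℝ → ℝ → ℝ} (hh : LocExpDecaying h) (s : ℝ) :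
    ExpDecaying (h s) := by
  refine ⟨hh.1.comp (by fun_prop : Continuous fun w : ℝ => (s, w)), fun n => ?_⟩
  obtain ⟨M, hM, hb⟩ := hh.2 (max n |s|)
  exact ⟨M, hM, fun w hw => hb s w (le_max_right _ _) (by linarith [le_max_left n |s|])⟩

theorem ExpDecaying.const_family {φ : ℝ → ℝ} (hφ : ExpDecaying φ) :
    LocExpDecaying (fun _ w => φ w) := by
  refine ⟨hφ.1.comp continuous_snd, fun n => ?_⟩
  obtain ⟨M, hM, hb⟩ := hφ.2 n
  exact ⟨M, hM, fun s w _ hw => hb w hw⟩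

theorem LocExpDecaying.shift {h : ℝ → ℝ → ℝ} (hh : LocExpDecaying h) (c : ℝ) :
    LocExpDecaying (fun s w => h s (w + c * s)) := by
  refine ⟨hh.1.comp (by fun_prop : Continuous fun p : ℝ × ℝ => (p.1, p.2 + c * p.1)),
    fun n => ?_⟩
  obtain ⟨M, hM, hb⟩ := hh.2 (n + |c| * |n|)
  refine ⟨M * Real.exp (|c| * |n|), by positivity, fun s w hs hw => ?_⟩
  have h1 : |c * s| ≤ |c| * |n| := by
    rw [abs_mul]
    exact mul_le_mul_of_nonneg_left (hs.trans (le_abs_self n)) (abs_nonneg c)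
  have h2 := abs_le.1 h1
  have h3 : 0 ≤ |c| * |n| := by positivity
  refine (hb s _ (by linarith) (by linarith)).trans ?_
  rw [mul_assoc, ← Real.exp_add]
  gcongr
  linarith

theorem LocExpDecaying.add {f g : ℝ → ℝ → ℝ} (hf : LocExpDecaying f) (hg : LocExpDecaying g) :
    LocExpDecaying (fun s w => f s w + g s w) := by
  refine ⟨hf.1.add hg.1, fun n => ?_⟩
  obtain ⟨M, hM, hb⟩ := hf.2 n
  obtain ⟨N, hN, hc⟩ := hg.2 n
  refine ⟨M + N, by positivity, fun s w hs hw => ?_⟩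
  linarith [abs_add_le (f s w) (g s w), hb s w hs hw, hc s w hs hw]

theorem LocExpDecaying.const_mul {f : ℝ → ℝ → ℝ} (hf : LocExpDecaying f) (c : ℝ) :
    LocExpDecaying (fun s w => c * f s w) := by
  refine ⟨hf.1.const_mul c, fun n => ?_⟩
  obtain ⟨M, hM, hb⟩ := hf.2 n
  refine ⟨|c| * M, by positivity, fun s w hs hw => ?_⟩
  rw [abs_mul, mul_assoc]
  exact mul_le_mul_of_nonneg_left (hb s w hs hw) (abs_nonneg c)

theorem LocExpDecaying.sub {f g : ℝ → ℝ → ℝ} (hf : LocExpDecaying f) (hg : LocExpDecaying g) :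
    LocExpDecaying (fun s w => f s w - g s w) := by
  simpa [sub_eq_add_neg] using hf.add (hg.const_mul (-1))

theorem ExpDecaying.hankel {A : ℝ → ℝ} (hA : ExpDecaying A) (c : ℝ) :
    LocExpKernel (fun s x w => A (x + w + c * s)) := by
  refine ⟨hA.1.comp (by fun_prop), fun n => ?_⟩
  obtain ⟨M, hM, hb⟩ := (hA.const_family.shift c).2 |n|
  refine ⟨M, hM, fun s x w hs hx hw => ?_⟩
  have := hb s (x + w) (hs.trans (le_abs_self n)) (by linarith [le_abs_self n])
  rwa [neg_add'] at this

theorem LocExpKernel.halfLineOp {k : ℝ → ℝ → ℝ → ℝ} {h : ℝ → ℝ → ℝ} (hk : LocExpKernel k)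
    (hh : LocExpDecaying h) : LocExpDecaying (halfLineOp k h) := by
  have key : ∀ n : ℝ, ∃ M, 0 ≤ M ∧ ∀ s x w, |s| ≤ n → -n ≤ x → 0 ≤ w →
      |k s x w * h s w| ≤ M * Real.exp (-x) * Real.exp (-w) := by
    intro n
    obtain ⟨M, hM, hb⟩ := hk.2 |n|
    obtain ⟨N, hN, hc⟩ := hh.2 |n|
    refine ⟨M * N, by positivity, fun s x w hs hx hw => ?_⟩
    have h1 := hb s x w (hs.trans (le_abs_self n)) (by linarith [le_abs_self n]) hw
    have h2 := hc s w (hs.trans (le_abs_self n)) (by linarith [abs_nonneg n])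
    have h3 : N * Real.exp (-w) ≤ N * 1 := by
      gcongr
      exact Real.exp_le_one_iff.2 (by linarith)
    rw [abs_mul]
    calc |k s x w| * |h s w| ≤ (M * Real.exp (-x - w)) * (N * 1) :=
          mul_le_mul h1 (h2.trans h3) (abs_nonneg _) (by positivity)
      _ = M * N * Real.exp (-x) * Real.exp (-w) := by
          rw [sub_eq_add_neg, Real.exp_add]; ring
  have hcont : Continuous (fun q : (ℝ × ℝ) × ℝ => k q.1.1 q.1.2 q.2 * h q.1.1 q.2) :=
    (hk.1.comp (by fun_prop : Continuous fun q : (ℝ × ℝ) × ℝ => (q.1.1, q.1.2, q.2))).mul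
      (hh.1.comp (by fun_prop : Continuous fun q : (ℝ × ℝ) × ℝ => (q.1.1, q.2)))
  refine ⟨?_, fun n => ?_⟩
  · rw [continuous_iff_continuousAt]
    intro p
    obtain ⟨M, hM, hb⟩ := key (|p.1| + |p.2| + 1)
    refine continuousAt_of_dominated
      (bound := fun w => M * Real.exp (|p.1| + |p.2| + 1) * Real.exp (-w)) ?_ ?_ ?_ ?_
    · exact Filter.Eventually.of_forall fun q =>
        (hcont.comp (by fun_prop : Continuous fun w : ℝ => (q, w))).aestronglyMeasurable
    · have : ∀ᶠ q : ℝ × ℝ in nhds p, |q.1| < |p.1| + |p.2| + 1 ∧ |q.2| < |p.1| + |p.2| + 1 := by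
        refine ((continuous_fst.abs.tendsto p).eventually_lt_const ?_).and
          ((continuous_snd.abs.tendsto p).eventually_lt_const ?_)
        · linarith [abs_nonneg p.2]
        · linarith [abs_nonneg p.1]
      filter_upwards [this] with q hq
      refine (ae_restrict_iff' measurableSet_Ioi).2 (Filter.Eventually.of_forall fun w hw => ?_)
      have h2 := abs_lt.1 hq.2
      refine (hb q.1 q.2 w hq.1.le h2.1.le (le_of_lt hw)).trans ?_
      gcongr
      linarith
    · exact (integrableOn_exp_neg_Ioi 0).const_mul _
    · exact Filter.Eventually.of_forall fun w =>
        (hcont.comp (by fun_prop : Continuous fun q : ℝ × ℝ => (q, w))).continuousAt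
  · obtain ⟨M, hM, hb⟩ := key n
    refine ⟨M, hM, fun s x hs hx => ?_⟩
    have : ‖∫ w in Ioi (0 : ℝ), k s x w * h s w‖ ≤
        ∫ w in Ioi (0 : ℝ), M * Real.exp (-x) * Real.exp (-w) := by
      refine norm_integral_le_of_norm_le ((integrableOn_exp_neg_Ioi 0).const_mul _) ?_
      exact (ae_restrict_iff' measurableSet_Ioi).2
        (Filter.Eventually.of_forall fun w hw => hb s x w hs hx (le_of_lt hw))
    rwa [integral_const_mul, integral_exp_neg_Ioi_zero, mul_one, Real.norm_eq_abs] at this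

theorem integrableOn_mul_of_exp_bound {u h : ℝ → ℝ} {a : ℝ} (hu : Continuous u)
    (hub : ∃ M, ∀ x, a < x → |u x| ≤ M * Real.exp (-x)) (hh : ExpDecaying h) :
    IntegrableOn (fun x => u x * h x) (Ioi a) := by
  obtain ⟨M, hM⟩ := hub
  obtain ⟨N, hN, hb⟩ := hh.2 (-a)
  refine Integrable.mono' (g := fun x => M * N * Real.exp (-a) * Real.exp (-x))
    ((integrableOn_exp_neg_Ioi a).const_mul _) (hu.mul hh.1).aestronglyMeasurable ?_
  refine (ae_restrict_iff' measurableSet_Ioi).2 (Filter.Eventually.of_forall fun x hx => ?_)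
  have hx' : a < x := hx
  have h1 := hM x hx'
  have h2 := hb x (by linarith)
  have h3 : N * Real.exp (-x) ≤ N * Real.exp (-a) := by gcongr
  rw [Real.norm_eq_abs, abs_mul]
  calc |u x| * |h x| ≤ (M * Real.exp (-x)) * (N * Real.exp (-a)) :=
        mul_le_mul h1 (h2.trans h3) (abs_nonneg _) ((abs_nonneg _).trans h1)
    _ = _ := by ring

theorem ExpDecaying.exp_bound {h : ℝ → ℝ} (hh : ExpDecaying h) (a : ℝ) :
    ∃ M, ∀ x, a < x → |h x| ≤ M * Real.exp (-x) := by
  obtain ⟨N, -, hb⟩ := hh.2 (-a)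
  exact ⟨N, fun x hx => hb x (by linarith)⟩

theorem integral_mul_integral_swap {a b : ℝ} {k : ℝ → ℝ → ℝ} {u h : ℝ → ℝ}
    (hk : Continuous (fun p : ℝ × ℝ => k p.1 p.2))
    (hkb : ∃ M, ∀ x w, a < x → b < w → |k x w| ≤ M)
    (hu : Continuous u) (hub : ∃ M, ∀ x, a < x → |u x| ≤ M * Real.exp (-x))
    (hh : ExpDecaying h) :
    ∫ x in Ioi a, u x * ∫ w in Ioi b, k x w * h w
      = ∫ w in Ioi b, (∫ x in Ioi a, u x * k x w) * h w := by
  obtain ⟨M, hM⟩ := hkb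
  obtain ⟨U, hU⟩ := hub
  obtain ⟨N, hN⟩ := hh.exp_bound b
  have hInt : Integrable (Function.uncurry fun x w => u x * k x w * h w)
      ((volume.restrict (Ioi a)).prod (volume.restrict (Ioi b))) := by
    refine Integrable.mono'
      (g := fun z : ℝ × ℝ => (U * M * Real.exp (-z.1)) * (N * Real.exp (-z.2)))
      (((integrableOn_exp_neg_Ioi a).const_mul _).mul_prod
        ((integrableOn_exp_neg_Ioi b).const_mul _)) ?_ ?_
    · exact (((hu.comp continuous_fst).mul hk).mul (hh.1.comp continuous_snd)).aestronglyMeasurable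
    · rw [Measure.prod_restrict]
      refine (ae_restrict_iff' (measurableSet_Ioi.prod measurableSet_Ioi)).2
        (Filter.Eventually.of_forall fun z hz => ?_)
      have h1 := hU z.1 hz.1
      have h2 := hM z.1 z.2 hz.1 hz.2
      have h3 := hN z.2 hz.2
      simp only [Function.uncurry, Real.norm_eq_abs, abs_mul]
      calc |u z.1| * |k z.1 z.2| * |h z.2|
          ≤ (U * Real.exp (-z.1) * M) * (N * Real.exp (-z.2)) := by
            refine mul_le_mul (mul_le_mul h1 h2 (abs_nonneg _) ((abs_nonneg _).trans h1)) h3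
              (abs_nonneg _) (mul_nonneg ((abs_nonneg _).trans h1) ((abs_nonneg _).trans h2))
        _ = _ := by ring
  have e : ∀ x, u x * ∫ w in Ioi b, k x w * h w = ∫ w in Ioi b, u x * k x w * h w := fun x => by
    rw [← integral_const_mul]
    simp only [mul_assoc]
  simp only [e, ← integral_mul_const]
  exact integral_integral_swap hInt

theorem integral_Ioi_eq_integral_Ioi_zero (F : ℝ → ℝ) (c : ℝ) :
    ∫ w in Ioi c, F w = ∫ w in Ioi (0 : ℝ), F (w + c) := by
  rw [← (measurePreserving_add_right volume c).setIntegral_preimage_emb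
    (measurableEmbedding_addRight c) F (Ioi c)]
  simp

theorem half_line_pairing {A G₁ G₂ H₁ H₂ φ ψ : ℝ → ℝ} (hA : ExpDecaying A)
    (hG₁ : ExpDecaying G₁) (hG₂ : ExpDecaying G₂) (hH₁ : ExpDecaying H₁) (hH₂ : ExpDecaying H₂)
    {a b : ℝ} (hφ : ∀ y, G₁ y + ∫ w in Ioi b, A (y + w) * G₂ w = φ y)
    (hψ : ∀ y, H₂ y + ∫ w in Ioi a, A (y + w) * H₁ w = ψ y) :
    (∫ x in Ioi a, H₁ x * φ x) - (∫ x in Ioi b, ψ x * G₂ x)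
      = (∫ x in Ioi a, H₁ x * G₁ x) - ∫ x in Ioi b, H₂ x * G₂ x := by
  have hAb : ∃ M, ∀ x w, a < x → b < w → |A (x + w)| ≤ M := by
    obtain ⟨M, hM, hb⟩ := hA.2 (-(a + b))
    refine ⟨M * Real.exp (-(a + b)), fun x w hx hw => (hb _ (by linarith)).trans ?_⟩
    gcongr
  have hAc : Continuous fun p : ℝ × ℝ => A (p.1 + p.2) := hA.1.comp (by fun_prop)
  have hswap := integral_mul_integral_swap (k := fun x w => A (x + w)) hAc hAb hH₁.1
    (hH₁.exp_bound a) hG₂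
  have hop : ∀ {G : ℝ → ℝ} (c : ℝ), ExpDecaying G →
      ExpDecaying fun y => ∫ w in Ioi c, A (y + w) * G w := by
    intro G c hG
    have hcalc : (fun y => ∫ w in Ioi c, A (y + w) * G w)
        = halfLineOp (fun s x w => A (x + w + 1 * s)) (fun s w => G (w + 1 * s)) c := by
      funext y
      rw [integral_Ioi_eq_integral_Ioi_zero]
      simp [halfLineOp, add_assoc]
    rw [hcalc]
    exact ((hA.hankel 1).halfLineOp (hG.const_family.shift 1)).slice c
  have e₁ : ∫ x in Ioi a, H₁ x * φ x
      = (∫ x in Ioi a, H₁ x * G₁ x) + ∫ x in Ioi a, H₁ x * ∫ w in Ioi b, A (x + w) * G₂ w := by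
    rw [← integral_add (integrableOn_mul_of_exp_bound hH₁.1 (hH₁.exp_bound a) hG₁)
      (integrableOn_mul_of_exp_bound hH₁.1 (hH₁.exp_bound a) (hop b hG₂))]
    simp only [← hφ, mul_add]
  have e₂ : ∫ x in Ioi b, ψ x * G₂ x
      = (∫ x in Ioi b, H₂ x * G₂ x)
        + ∫ w in Ioi b, (∫ x in Ioi a, H₁ x * A (x + w)) * G₂ w := by
    rw [← integral_add (integrableOn_mul_of_exp_bound hH₂.1 (hH₂.exp_bound b) hG₂)]
    · refine integral_congr_ae (Filter.Eventually.of_forall fun y => ?_)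
      simp only [← hψ, add_mul, add_comm y, mul_comm (H₁ _)]
    · have h := integrableOn_mul_of_exp_bound (hop a hH₁).1 ((hop a hH₁).exp_bound b) hG₂
      exact Integrable.congr h (Filter.Eventually.of_forall fun y => by
        simp only [add_comm y, mul_comm (A _)])
  rw [e₁, e₂, hswap]
  ring

theorem hasDerivAt_of_eq_add_mul {F H : ℝ → ℝ} {σ : ℝ} (h : ∀ s, F s = F σ + (s - σ) * H s)
    (hH : ContinuousAt H σ) : HasDerivAt F (H σ) σ := by
  rw [hasDerivAt_iff_tendsto_slope]
  refine (hH.tendsto.mono_left nhdsWithin_le_nhds).congr' ?_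
  filter_upwards [self_mem_nhdsWithin] with s hs
  have : s - σ ≠ 0 := sub_ne_zero.2 hs
  rw [slope_def_field, h s]
  field_simp
  ring

/-- The average over the segment from `c * σ` to `c * s` of `G σ * H s`. -/
def segmentAverage (c : ℝ) (G H : ℝ → ℝ → ℝ) (σ s : ℝ) : ℝ :=
  ∫ θ in (0 : ℝ)..1, G σ (c * σ + θ * (c * (s - σ))) * H s (c * σ + θ * (c * (s - σ)))

theorem continuous_segmentAverage (c : ℝ) {G H : ℝ → ℝ → ℝ} (hG : LocExpDecaying G)
    (hH : LocExpDecaying H) (σ : ℝ) : Continuous (segmentAverage c G H σ) := by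
  refine intervalIntegral.continuous_parametric_intervalIntegral_of_continuous'
    (f := fun s θ => G σ (c * σ + θ * (c * (s - σ))) * H s (c * σ + θ * (c * (s - σ)))) ?_ 0 1
  exact ((hG.slice σ).1.comp (by fun_prop)).mul
    (hH.1.comp (by fun_prop :
      Continuous fun p : ℝ × ℝ => (p.1, c * σ + p.2 * (c * (p.1 - σ)))))

theorem segmentAverage_self (c : ℝ) (G H : ℝ → ℝ → ℝ) (σ : ℝ) :
    segmentAverage c G H σ σ = G σ (c * σ) * H σ (c * σ) := by
  simp [segmentAverage]

theorem integral_Ioi_sub_Ioi_eq_segmentAverage (c : ℝ) {G H : ℝ → ℝ → ℝ}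
    (hG : LocExpDecaying G) (hH : LocExpDecaying H) (σ s : ℝ) :
    (∫ x in Ioi (c * s), H s x * G σ x) - (∫ x in Ioi (c * σ), H s x * G σ x)
      = -(s - σ) * (c * segmentAverage c G H σ s) := by
  have hi : ∀ a, IntegrableOn (fun x => H s x * G σ x) (Ioi a) := fun a =>
    integrableOn_mul_of_exp_bound (hH.slice s).1 ((hH.slice s).exp_bound a) (hG.slice σ)
  have h := intervalIntegral.smul_integral_comp_add_mul (a := 0) (b := 1)
    (fun x => H s x * G σ x) (c * (s - σ)) (c * σ)
  rw [intervalIntegral.integral_Ioi_sub_Ioi' (hi _) (hi _), intervalIntegral.integral_symm]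
  have e : c * σ + c * (s - σ) * 1 = c * s := by ring
  rw [mul_zero, add_zero, e] at h
  rw [← h, segmentAverage, smul_eq_mul]
  simp only [mul_comm (c * (s - σ)), mul_comm (H s _)]
  ring

/-- The derivative of `⟨φ, (1 + 𝐀)⁻¹ ψ⟩` on `L²(c₁ s, ∞) ⊕ L²(c₂ s, ∞)`, with `𝐀` the off-diagonal
Hankel operator with symbol `A`, consists of boundary terms only. -/
theorem hasDerivAt_hankel_pairing {A φ₁ φ₂ ψ₁ ψ₂ : ℝ → ℝ} {G₁ G₂ H₁ H₂ : ℝ → ℝ → ℝ} {c₁ c₂ : ℝ}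
    (hA : ExpDecaying A)
    (hG₁ : LocExpDecaying G₁) (hG₂ : LocExpDecaying G₂)
    (hH₁ : LocExpDecaying H₁) (hH₂ : LocExpDecaying H₂)
    (hφ₁ : ∀ s y, G₁ s y + ∫ w in Ioi (c₂ * s), A (y + w) * G₂ s w = φ₁ y)
    (hφ₂ : ∀ s y, G₂ s y + ∫ w in Ioi (c₁ * s), A (y + w) * G₁ s w = φ₂ y)
    (hψ₁ : ∀ s y, H₁ s y + ∫ w in Ioi (c₂ * s), A (y + w) * H₂ s w = ψ₁ y)
    (hψ₂ : ∀ s y, H₂ s y + ∫ w in Ioi (c₁ * s), A (y + w) * H₁ s w = ψ₂ y) (σ : ℝ) :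
    HasDerivAt
      (fun s => (∫ x in Ioi (c₁ * s), H₁ s x * φ₁ x) + ∫ x in Ioi (c₂ * s), H₂ s x * φ₂ x)
      (-(c₁ * (G₁ σ (c₁ * σ) * H₁ σ (c₁ * σ)) + c₂ * (G₂ σ (c₂ * σ) * H₂ σ (c₂ * σ)))) σ := by
  have key : ∀ s,
      ((∫ x in Ioi (c₁ * s), H₁ s x * φ₁ x) + ∫ x in Ioi (c₂ * s), H₂ s x * φ₂ x)
        = ((∫ x in Ioi (c₁ * σ), ψ₁ x * G₁ σ x) + ∫ x in Ioi (c₂ * σ), ψ₂ x * G₂ σ x)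
          + (s - σ) * -(c₁ * segmentAverage c₁ G₁ H₁ σ s + c₂ * segmentAverage c₂ G₂ H₂ σ s) := by
    intro s
    have h₁ := half_line_pairing hA (hG₁.slice σ) (hG₂.slice σ) (hH₁.slice s) (hH₂.slice s)
      (hφ₁ σ) (hψ₂ s)
    have h₂ := half_line_pairing hA (hG₂.slice σ) (hG₁.slice σ) (hH₂.slice s) (hH₁.slice s)
      (hφ₂ σ) (hψ₁ s)
    have h₃ := integral_Ioi_sub_Ioi_eq_segmentAverage c₁ hG₁ hH₁ σ s
    have h₄ := integral_Ioi_sub_Ioi_eq_segmentAverage c₂ hG₂ hH₂ σ s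
    linear_combination h₁ + h₂ + h₃ + h₄
  have hcont : Continuous fun s =>
      -(c₁ * segmentAverage c₁ G₁ H₁ σ s + c₂ * segmentAverage c₂ G₂ H₂ σ s) :=
    (((continuous_segmentAverage c₁ hG₁ hH₁ σ).const_mul c₁).add
      ((continuous_segmentAverage c₂ hG₂ hH₂ σ).const_mul c₂)).neg
  have hd := hasDerivAt_of_eq_add_mul
    (F := fun s => (∫ x in Ioi (c₁ * s), H₁ s x * φ₁ x) + ∫ x in Ioi (c₂ * s), H₂ s x * φ₂ x)
    (fun s => by rw [key s, key σ]; ring) hcont.continuousAt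
  simpa only [segmentAverage_self] using hd

/-- The shifted Hankel kernel `A (x + w + s)`. -/
def hankelKernel (A : ℝ → ℝ) (s x w : ℝ) : ℝ := A (x + w + s)

theorem ExpDecaying.hankelKernel {A : ℝ → ℝ} (hA : ExpDecaying A) :
    LocExpKernel (hankelKernel A) := by
  change LocExpKernel fun s x w => A (x + w + s)
  simpa only [one_mul] using hA.hankel 1

theorem LocExpKernel.exp_bound {k : ℝ → ℝ → ℝ → ℝ} (hk : LocExpKernel k) (s x : ℝ) :
    ∃ M, ∀ w, 0 < w → |k s x w| ≤ M * Real.exp (-w) := by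
  obtain ⟨M, hM, hb⟩ := hk.2 (max |s| |x|)
  refine ⟨M * Real.exp (-x), fun w hw => ?_⟩
  have := hb s x w (le_max_left _ _)
    (by linarith [le_max_right |s| |x|, neg_abs_le x]) hw.le
  rwa [sub_eq_add_neg, Real.exp_add, ← mul_assoc] at this

theorem LocExpKernel.bound {k : ℝ → ℝ → ℝ → ℝ} (hk : LocExpKernel k) (s : ℝ) :
    ∃ M, ∀ x w, 0 < x → 0 < w → |k s x w| ≤ M := by
  obtain ⟨M, hM, hb⟩ := hk.2 |s|
  refine ⟨M, fun x w hx hw => (hb s x w le_rfl (by linarith [abs_nonneg s]) hw.le).trans ?_⟩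
  exact mul_le_of_le_one_right hM (Real.exp_le_one_iff.2 (by linarith))

theorem LocExpKernel.continuous_right {k : ℝ → ℝ → ℝ → ℝ} (hk : LocExpKernel k) (s x : ℝ) :
    Continuous (k s x) :=
  hk.1.comp (by fun_prop : Continuous fun w : ℝ => (s, x, w))

theorem LocExpKernel.continuous_slice {k : ℝ → ℝ → ℝ → ℝ} (hk : LocExpKernel k) (s : ℝ) :
    Continuous (fun p : ℝ × ℝ => k s p.1 p.2) :=
  hk.1.comp (by fun_prop : Continuous fun p : ℝ × ℝ => (s, p.1, p.2))

theorem LocExpKernel.integrableOn_mul {k : ℝ → ℝ → ℝ → ℝ} {h : ℝ → ℝ → ℝ} (hk : LocExpKernel k)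
    (hh : LocExpDecaying h) (s x : ℝ) : IntegrableOn (fun w => k s x w * h s w) (Ioi 0) :=
  integrableOn_mul_of_exp_bound (hk.continuous_right s x) (hk.exp_bound s x) (hh.slice s)

theorem halfLineOp_sub {k : ℝ → ℝ → ℝ → ℝ} {f g : ℝ → ℝ → ℝ} (hk : LocExpKernel k)
    (hf : LocExpDecaying f) (hg : LocExpDecaying g) (s x : ℝ) :
    halfLineOp k (fun s w => f s w - g s w) s x = halfLineOp k f s x - halfLineOp k g s x := by
  simp only [halfLineOp, mul_sub]
  exact integral_sub (hk.integrableOn_mul hf s x) (hk.integrableOn_mul hg s x)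

theorem halfLineOp_add {k : ℝ → ℝ → ℝ → ℝ} {f g : ℝ → ℝ → ℝ} (hk : LocExpKernel k)
    (hf : LocExpDecaying f) (hg : LocExpDecaying g) (s x : ℝ) :
    halfLineOp k (fun s w => f s w + g s w) s x = halfLineOp k f s x + halfLineOp k g s x := by
  simp only [halfLineOp, mul_add]
  exact integral_add (hk.integrableOn_mul hf s x) (hk.integrableOn_mul hg s x)

theorem halfLineOp_congr {k : ℝ → ℝ → ℝ → ℝ} {f g : ℝ → ℝ → ℝ} {s : ℝ}
    (h : ∀ w, 0 ≤ w → f s w = g s w) (x : ℝ) : halfLineOp k f s x = halfLineOp k g s x :=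
  setIntegral_congr_fun measurableSet_Ioi fun w hw => by simp only [h w (le_of_lt hw)]

theorem halfLineOp_comp {k₁ k₂ : ℝ → ℝ → ℝ → ℝ} {h : ℝ → ℝ → ℝ} (hk₁ : LocExpKernel k₁)
    (hk₂ : LocExpKernel k₂) (hh : LocExpDecaying h) (s x : ℝ) :
    halfLineOp k₁ (halfLineOp k₂ h) s x
      = ∫ t in Ioi (0 : ℝ), (∫ w in Ioi (0 : ℝ), k₁ s x w * k₂ s w t) * h s t :=
  integral_mul_integral_swap (hk₂.continuous_slice s) (hk₂.bound s) (hk₁.continuous_right s x)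
    (hk₁.exp_bound s x) (hh.slice s)

theorem hankelKernel_halfLineOp_comp {A : ℝ → ℝ} (hA : ExpDecaying A) {h : ℝ → ℝ → ℝ}
    (hh : LocExpDecaying h) (s x : ℝ) :
    halfLineOp (hankelKernel A) (halfLineOp (hankelKernel A) h) s x
      = ∫ t in Ioi (0 : ℝ), KAi A s x t * h s t := by
  rw [halfLineOp_comp hA.hankelKernel hA.hankelKernel hh]
  simp only [hankelKernel, KAi, add_comm _ (_ : ℝ)]

theorem expDecaying_KAi {A : ℝ → ℝ} (hA : ExpDecaying A) (s x : ℝ) :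
    ExpDecaying (KAi A s x) := by
  have h : LocExpDecaying fun _ w => A (w + 1 * (x + s)) := by
    have h' := ((hA.const_family.shift 1).slice (x + s)).const_family
    exact h'
  have e : KAi A s x = halfLineOp (hankelKernel A) (fun _ w => A (w + 1 * (x + s))) s := by
    funext t
    refine integral_congr_ae (Filter.Eventually.of_forall fun w => ?_)
    simp only [hankelKernel, one_mul]
    rw [mul_comm, show w + (x + s) = x + w + s by ring]
  rw [e]
  exact (hA.hankelKernel.halfLineOp h).slice s

section Resolvent

variable {A : ℝ → ℝ} {r : ℝ → ℝ → ℝ → ℝ}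

/-- `r` is a resolvent of the squared Hankel operator: `(1 - A²)(1 + r) = 1`. -/
def IsHankelResolvent (A : ℝ → ℝ) (r : ℝ → ℝ → ℝ → ℝ) : Prop :=
  ∀ s x y, 0 ≤ x → 0 ≤ y →
    r s x y = KAi A s x y + ∫ t in Ioi (0 : ℝ), KAi A s x t * r s t y

/-- `r` commutes with the Hankel operator. -/
def CommutesWithHankel (A : ℝ → ℝ) (r : ℝ → ℝ → ℝ → ℝ) : Prop :=
  ∀ s x y, 0 ≤ x → 0 ≤ y →
    (∫ t in Ioi (0 : ℝ), A (x + t + s) * r s t y) = ∫ t in Ioi (0 : ℝ), r s x t * A (t + y + s)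

theorem IsHankelResolvent.apply (hres : IsHankelResolvent A r) (hA : ExpDecaying A)
    (hr : LocExpKernel r) {h : ℝ → ℝ → ℝ} (hh : LocExpDecaying h) {s x : ℝ} (hx : 0 ≤ x) :
    halfLineOp r h s x
      = halfLineOp (hankelKernel A) (halfLineOp (hankelKernel A) h) s x
        + halfLineOp (hankelKernel A) (halfLineOp (hankelKernel A) (halfLineOp r h)) s x := by
  have hK := expDecaying_KAi hA s x
  rw [hankelKernel_halfLineOp_comp hA hh,
    hankelKernel_halfLineOp_comp hA (hr.halfLineOp hh), ← sub_eq_iff_eq_add']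
  have hswap := integral_mul_integral_swap (hr.continuous_slice s) (hr.bound s) hK.1
    (hK.exp_bound 0) (hh.slice s)
  refine Eq.trans ?_ hswap.symm
  have hsub := integral_sub (hr.integrableOn_mul hh s x)
    (integrableOn_mul_of_exp_bound hK.1 (hK.exp_bound 0) (hh.slice s))
  refine hsub.symm.trans (setIntegral_congr_fun measurableSet_Ioi fun y hy => ?_)
  simp only [hres s x y hx (le_of_lt hy)]
  ring

theorem CommutesWithHankel.apply (hcomm : CommutesWithHankel A r) (hA : ExpDecaying A)
    (hr : LocExpKernel r) {h : ℝ → ℝ → ℝ} (hh : LocExpDecaying h) {s x : ℝ} (hx : 0 ≤ x) :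
    halfLineOp (hankelKernel A) (halfLineOp r h) s x
      = halfLineOp r (halfLineOp (hankelKernel A) h) s x := by
  rw [halfLineOp_comp hA.hankelKernel hr hh, halfLineOp_comp hr hA.hankelKernel hh]
  refine setIntegral_congr_fun measurableSet_Ioi fun y hy => ?_
  simp only [hankelKernel, hcomm s x y hx (le_of_lt hy)]

/-- `f₂ - A f₁`. -/
def hankelReduced (A : ℝ → ℝ) (f₁ f₂ : ℝ → ℝ → ℝ) (s x : ℝ) : ℝ :=
  f₂ s x - halfLineOp (hankelKernel A) f₁ s x

/-- `(1 + r)(f₂ - A f₁)`. -/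
def resolvedComponent (A : ℝ → ℝ) (r : ℝ → ℝ → ℝ → ℝ) (f₁ f₂ : ℝ → ℝ → ℝ) (s x : ℝ) : ℝ :=
  hankelReduced A f₁ f₂ s x + halfLineOp r (hankelReduced A f₁ f₂) s x

/-- The first component of `(1 + 𝐀)⁻¹ (f₁, f₂)`, extended to the whole line. -/
def extendedComponent (A : ℝ → ℝ) (r : ℝ → ℝ → ℝ → ℝ) (f₁ f₂ : ℝ → ℝ → ℝ) (s x : ℝ) : ℝ :=
  f₁ s x - halfLineOp (hankelKernel A) (resolvedComponent A r f₁ f₂) s x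

variable {f₁ f₂ : ℝ → ℝ → ℝ}

theorem locExpDecaying_hankelReduced (hA : ExpDecaying A) (hf₁ : LocExpDecaying f₁)
    (hf₂ : LocExpDecaying f₂) : LocExpDecaying (hankelReduced A f₁ f₂) :=
  hf₂.sub (hA.hankelKernel.halfLineOp hf₁)

theorem locExpDecaying_resolvedComponent (hA : ExpDecaying A) (hr : LocExpKernel r)
    (hf₁ : LocExpDecaying f₁) (hf₂ : LocExpDecaying f₂) :
    LocExpDecaying (resolvedComponent A r f₁ f₂) :=
  (locExpDecaying_hankelReduced hA hf₁ hf₂).add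
    (hr.halfLineOp (locExpDecaying_hankelReduced hA hf₁ hf₂))

theorem locExpDecaying_extendedComponent (hA : ExpDecaying A) (hr : LocExpKernel r)
    (hf₁ : LocExpDecaying f₁) (hf₂ : LocExpDecaying f₂) :
    LocExpDecaying (extendedComponent A r f₁ f₂) :=
  hf₁.sub (hA.hankelKernel.halfLineOp (locExpDecaying_resolvedComponent hA hr hf₁ hf₂))

theorem extendedComponent_eq (hA : ExpDecaying A) (hr : LocExpKernel r)
    (hf₁ : LocExpDecaying f₁) (hf₂ : LocExpDecaying f₂) (s x : ℝ) :
    extendedComponent A r f₁ f₂ s x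
      = f₁ s x - halfLineOp (hankelKernel A) (hankelReduced A f₁ f₂) s x
        - halfLineOp (hankelKernel A) (halfLineOp r (hankelReduced A f₁ f₂)) s x := by
  have h := halfLineOp_add hA.hankelKernel (locExpDecaying_hankelReduced hA hf₁ hf₂)
    (hr.halfLineOp (locExpDecaying_hankelReduced hA hf₁ hf₂)) s x
  rw [sub_sub, ← h]
  rfl

theorem resolvedComponent_eq_sub (hres : IsHankelResolvent A r) (hA : ExpDecaying A)
    (hr : LocExpKernel r) (hf₁ : LocExpDecaying f₁) (hf₂ : LocExpDecaying f₂) {s x : ℝ}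
    (hx : 0 ≤ x) :
    resolvedComponent A r f₁ f₂ s x
      = f₂ s x - halfLineOp (hankelKernel A) (extendedComponent A r f₁ f₂) s x := by
  have hB := locExpDecaying_hankelReduced hA hf₁ hf₂
  have hK := hA.hankelKernel
  have e : halfLineOp (hankelKernel A) (extendedComponent A r f₁ f₂) s x
      = halfLineOp (hankelKernel A) f₁ s x
        - halfLineOp (hankelKernel A)
            (halfLineOp (hankelKernel A) (hankelReduced A f₁ f₂)) s x
        - halfLineOp (hankelKernel A)
            (halfLineOp (hankelKernel A) (halfLineOp r (hankelReduced A f₁ f₂))) s x := by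
    rw [← halfLineOp_sub hK hf₁ (hK.halfLineOp hB),
      ← halfLineOp_sub hK (hf₁.sub (hK.halfLineOp hB)) (hK.halfLineOp (hr.halfLineOp hB))]
    exact halfLineOp_congr (fun w _ => extendedComponent_eq hA hr hf₁ hf₂ s w) x
  rw [e, resolvedComponent, hres.apply hA hr hB hx, hankelReduced]
  ring

theorem extendedComponent_eq_resolvedComponent_swap (hres : IsHankelResolvent A r)
    (hcomm : CommutesWithHankel A r) (hA : ExpDecaying A) (hr : LocExpKernel r)
    (hf₁ : LocExpDecaying f₁) (hf₂ : LocExpDecaying f₂) {s x : ℝ} (hx : 0 ≤ x) :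
    extendedComponent A r f₁ f₂ s x = resolvedComponent A r f₂ f₁ s x := by
  have hB := locExpDecaying_hankelReduced hA hf₁ hf₂
  have hK := hA.hankelKernel
  have e₁ : halfLineOp (hankelKernel A) (hankelReduced A f₁ f₂) s x
      = halfLineOp (hankelKernel A) f₂ s x
        - halfLineOp (hankelKernel A) (halfLineOp (hankelKernel A) f₁) s x :=
    halfLineOp_sub hK hf₂ (hK.halfLineOp hf₁) s x
  have e₂ : halfLineOp r (halfLineOp (hankelKernel A) (hankelReduced A f₁ f₂)) s x
      = halfLineOp r (halfLineOp (hankelKernel A) f₂) s x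
        - halfLineOp r (halfLineOp (hankelKernel A) (halfLineOp (hankelKernel A) f₁)) s x := by
    rw [← halfLineOp_sub hr (hK.halfLineOp hf₂) (hK.halfLineOp (hK.halfLineOp hf₁))]
    exact halfLineOp_congr
      (fun w _ => halfLineOp_sub hK hf₂ (hK.halfLineOp hf₁) s w) x
  have e₃ : halfLineOp r (halfLineOp (hankelKernel A) (halfLineOp (hankelKernel A) f₁)) s x
      = halfLineOp (hankelKernel A) (halfLineOp (hankelKernel A) (halfLineOp r f₁)) s x := by
    rw [← hcomm.apply hA hr (hK.halfLineOp hf₁) hx]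
    exact halfLineOp_congr (fun w hw => (hcomm.apply hA hr hf₁ hw).symm) x
  have e₄ := hres.apply hA hr hf₁ (s := s) hx
  have e₅ : halfLineOp r (hankelReduced A f₂ f₁) s x
      = halfLineOp r f₁ s x - halfLineOp r (halfLineOp (hankelKernel A) f₂) s x :=
    halfLineOp_sub hr hf₁ (hK.halfLineOp hf₂) s x
  rw [extendedComponent_eq hA hr hf₁ hf₂, hcomm.apply hA hr hB hx, e₁, e₂, e₃,
    resolvedComponent, e₅, hankelReduced]
  linear_combination -e₄

/-- The three-term expression of `⟨h, (1 + 𝐀)⁻¹ f⟩`. -/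
theorem integral_extended_add_integral_resolved (hA : ExpDecaying A) (hr : LocExpKernel r)
    (hf₁ : LocExpDecaying f₁) (hf₂ : LocExpDecaying f₂) {h₁ h₂ : ℝ → ℝ → ℝ}
    (hh₁ : LocExpDecaying h₁) (hh₂ : LocExpDecaying h₂) (s : ℝ) :
    (∫ x in Ioi (0 : ℝ), extendedComponent A r f₁ f₂ s x * h₁ s x)
        + ∫ x in Ioi (0 : ℝ), resolvedComponent A r f₁ f₂ s x * h₂ s x
      = (∫ x in Ioi (0 : ℝ), h₁ s x * f₁ s x)
        + (∫ x in Ioi (0 : ℝ), hankelReduced A h₁ h₂ s x * hankelReduced A f₁ f₂ s x)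
        + ∫ x in Ioi (0 : ℝ), hankelReduced A h₁ h₂ s x
            * halfLineOp r (hankelReduced A f₁ f₂) s x := by
  have hK := hA.hankelKernel
  have hB := locExpDecaying_hankelReduced hA hf₁ hf₂
  have hBh := locExpDecaying_hankelReduced hA hh₁ hh₂
  have hG := locExpDecaying_resolvedComponent hA hr hf₁ hf₂
  have hInt : ∀ {f g : ℝ → ℝ → ℝ}, LocExpDecaying f → LocExpDecaying g →
      IntegrableOn (fun x => f s x * g s x) (Ioi 0) := fun hf hg =>
    integrableOn_mul_of_exp_bound (hf.slice s).1 ((hf.slice s).exp_bound 0) (hg.slice s)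
  have e₁ : ∫ x in Ioi (0 : ℝ), extendedComponent A r f₁ f₂ s x * h₁ s x
      = (∫ x in Ioi (0 : ℝ), h₁ s x * f₁ s x)
        - ∫ x in Ioi (0 : ℝ), h₁ s x
            * halfLineOp (hankelKernel A) (resolvedComponent A r f₁ f₂) s x := by
    rw [← integral_sub (hInt hh₁ hf₁) (hInt hh₁ (hK.halfLineOp hG))]
    refine integral_congr_ae (Filter.Eventually.of_forall fun x => ?_)
    simp only [extendedComponent]
    ring
  have e₂ : ∫ x in Ioi (0 : ℝ), resolvedComponent A r f₁ f₂ s x * h₂ s x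
      = (∫ x in Ioi (0 : ℝ), hankelReduced A h₁ h₂ s x * resolvedComponent A r f₁ f₂ s x)
        + ∫ x in Ioi (0 : ℝ), halfLineOp (hankelKernel A) h₁ s x
            * resolvedComponent A r f₁ f₂ s x := by
    rw [← integral_add (hInt hBh hG) (hInt (hK.halfLineOp hh₁) hG)]
    refine integral_congr_ae (Filter.Eventually.of_forall fun x => ?_)
    simp only [hankelReduced]
    ring
  have e₃ : ∫ x in Ioi (0 : ℝ), hankelReduced A h₁ h₂ s x * resolvedComponent A r f₁ f₂ s x
      = (∫ x in Ioi (0 : ℝ), hankelReduced A h₁ h₂ s x * hankelReduced A f₁ f₂ s x)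
        + ∫ x in Ioi (0 : ℝ), hankelReduced A h₁ h₂ s x
            * halfLineOp r (hankelReduced A f₁ f₂) s x := by
    rw [← integral_add (hInt hBh hB) (hInt hBh (hr.halfLineOp hB))]
    simp only [resolvedComponent, mul_add]
  have e₄ : ∫ x in Ioi (0 : ℝ), h₁ s x
        * halfLineOp (hankelKernel A) (resolvedComponent A r f₁ f₂) s x
      = ∫ x in Ioi (0 : ℝ), halfLineOp (hankelKernel A) h₁ s x
          * resolvedComponent A r f₁ f₂ s x := by
    refine (integral_mul_integral_swap (hK.continuous_slice s) (hK.bound s) (hh₁.slice s).1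
      ((hh₁.slice s).exp_bound 0) (hG.slice s)).trans ?_
    refine integral_congr_ae (Filter.Eventually.of_forall fun x => ?_)
    simp only [halfLineOp, hankelKernel, add_comm x, mul_comm (h₁ s _)]
  rw [e₁, e₂, e₃, e₄]
  ring

/-- The derivative of the three-term expression for data transported along the half-lines
`(c₁ s, ∞)` and `(c₂ s, ∞)`. -/
theorem hasDerivAt_three_term (hres : IsHankelResolvent A r) (hA : ExpDecaying A)
    (hr : LocExpKernel r) {c₁ c₂ : ℝ} (hc : c₁ + c₂ = 1) {φ₁ φ₂ ψ₁ ψ₂ : ℝ → ℝ}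
    (hφ₁ : ExpDecaying φ₁) (hφ₂ : ExpDecaying φ₂) (hψ₁ : ExpDecaying ψ₁) (hψ₂ : ExpDecaying ψ₂)
    {f₁ f₂ h₁ h₂ : ℝ → ℝ → ℝ} (hf₁ : f₁ = fun s x => φ₁ (x + c₁ * s))
    (hf₂ : f₂ = fun s x => φ₂ (x + c₂ * s)) (hh₁ : h₁ = fun s x => ψ₁ (x + c₁ * s))
    (hh₂ : h₂ = fun s x => ψ₂ (x + c₂ * s)) (σ : ℝ) :
    HasDerivAt
      (fun s => (∫ x in Ioi (0 : ℝ), h₁ s x * f₁ s x)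
        + (∫ x in Ioi (0 : ℝ), hankelReduced A h₁ h₂ s x * hankelReduced A f₁ f₂ s x)
        + ∫ x in Ioi (0 : ℝ), hankelReduced A h₁ h₂ s x
            * halfLineOp r (hankelReduced A f₁ f₂) s x)
      (-(c₁ * (extendedComponent A r h₁ h₂ σ 0 * extendedComponent A r f₁ f₂ σ 0)
        + c₂ * (resolvedComponent A r h₁ h₂ σ 0 * resolvedComponent A r f₁ f₂ σ 0))) σ := by
  have key : ∀ {φ₁ φ₂ : ℝ → ℝ} {f₁ f₂ : ℝ → ℝ → ℝ}, ExpDecaying φ₁ → ExpDecaying φ₂ →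
      f₁ = (fun s x => φ₁ (x + c₁ * s)) → f₂ = (fun s x => φ₂ (x + c₂ * s)) →
      LocExpDecaying f₁ ∧ LocExpDecaying f₂ ∧
      ∃ G₁ G₂ : ℝ → ℝ → ℝ, LocExpDecaying G₁ ∧ LocExpDecaying G₂ ∧
        (∀ s y, G₁ s y + ∫ w in Ioi (c₂ * s), A (y + w) * G₂ s w = φ₁ y) ∧
        (∀ s y, G₂ s y + ∫ w in Ioi (c₁ * s), A (y + w) * G₁ s w = φ₂ y) ∧
        (∀ s x, 0 ≤ x → G₁ s (x + c₁ * s) = extendedComponent A r f₁ f₂ s x) ∧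
        (∀ s x, 0 ≤ x → G₂ s (x + c₂ * s) = resolvedComponent A r f₁ f₂ s x) := by
    intro φ₁ φ₂ f₁ f₂ hφ₁ hφ₂ hf₁ hf₂
    have hF₁ : LocExpDecaying f₁ := hf₁ ▸ hφ₁.const_family.shift c₁
    have hF₂ : LocExpDecaying f₂ := hf₂ ▸ hφ₂.const_family.shift c₂
    have hE := locExpDecaying_extendedComponent hA hr hF₁ hF₂
    refine ⟨hF₁, hF₂, fun s y => extendedComponent A r f₁ f₂ s (y + -c₁ * s),
      fun s y => φ₂ y
        - halfLineOp (hankelKernel A) (extendedComponent A r f₁ f₂) s (y + -c₂ * s),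
      hE.shift _, hφ₂.const_family.sub ((hA.hankelKernel.halfLineOp hE).shift _), ?_, ?_, ?_, ?_⟩
    · intro s y
      have e : ∫ w in Ioi (c₂ * s), A (y + w) * (φ₂ w
            - halfLineOp (hankelKernel A) (extendedComponent A r f₁ f₂) s (w + -c₂ * s))
          = halfLineOp (hankelKernel A) (resolvedComponent A r f₁ f₂) s (y + -c₁ * s) := by
        rw [integral_Ioi_eq_integral_Ioi_zero]
        refine setIntegral_congr_fun measurableSet_Ioi fun w hw => ?_
        simp only [hankelKernel]
        rw [resolvedComponent_eq_sub hres hA hr hF₁ hF₂ (le_of_lt hw), hf₂]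
        congr 2
        · linear_combination s * hc
        · rw [neg_mul, add_neg_cancel_right]
      simp only [e]
      rw [extendedComponent, sub_add_cancel, hf₁]
      simp
    · intro s y
      have e : ∫ w in Ioi (c₁ * s), A (y + w) * extendedComponent A r f₁ f₂ s (w + -c₁ * s)
          = halfLineOp (hankelKernel A) (extendedComponent A r f₁ f₂) s (y + -c₂ * s) := by
        rw [integral_Ioi_eq_integral_Ioi_zero]
        refine setIntegral_congr_fun measurableSet_Ioi fun w hw => ?_
        simp only [hankelKernel]
        congr 2
        · linear_combination s * hc
        · ring
      simp only [e, sub_add_cancel]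
    · intro s x _
      simp
    · intro s x hx
      rw [resolvedComponent_eq_sub hres hA hr hF₁ hF₂ hx, hf₂]
      simp
  obtain ⟨hF₁, hF₂, G₁, G₂, hG₁, hG₂, eG₁, eG₂, vG₁, vG₂⟩ := key hφ₁ hφ₂ hf₁ hf₂
  obtain ⟨hP₁, hP₂, H₁, H₂, hH₁, hH₂, eH₁, eH₂, vH₁, vH₂⟩ := key hψ₁ hψ₂ hh₁ hh₂
  have hd := hasDerivAt_hankel_pairing hA hH₁ hH₂ hG₁ hG₂ eH₁ eH₂ eG₁ eG₂ σ
  have b₁ := vG₁ σ 0 le_rfl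
  have b₂ := vG₂ σ 0 le_rfl
  have b₃ := vH₁ σ 0 le_rfl
  have b₄ := vH₂ σ 0 le_rfl
  rw [zero_add] at b₁ b₂ b₃ b₄
  rw [b₁, b₂, b₃, b₄] at hd
  refine hd.congr_of_eventuallyEq (Filter.Eventually.of_forall fun s => ?_)
  simp only
  rw [← integral_extended_add_integral_resolved hA hr hF₁ hF₂ hP₁ hP₂ s,
    integral_Ioi_eq_integral_Ioi_zero _ (c₁ * s), integral_Ioi_eq_integral_Ioi_zero _ (c₂ * s)]
  congr 1
  · refine setIntegral_congr_fun measurableSet_Ioi fun x hx => ?_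
    simp only [vG₁ s x (le_of_lt hx), hh₁]
  · refine setIntegral_congr_fun measurableSet_Ioi fun x hx => ?_
    simp only [vG₂ s x (le_of_lt hx), hh₂]

end Resolvent

theorem ExpDecaying.const_mul {φ : ℝ → ℝ} (hφ : ExpDecaying φ) (c : ℝ) :
    ExpDecaying (fun w => c * φ w) :=
  (hφ.const_family.const_mul c).slice 0

theorem superexponential_bound {A : ℝ → ℝ} (hA : Continuous A)
    (hdecay : ∀ a > (0 : ℝ), ∃ Ca > (0 : ℝ), ∀ x ≥ (0 : ℝ),
      |A x| + |deriv A x| ≤ Ca * Real.exp (-a * x)) (a n : ℝ) :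
    ∃ M, 0 ≤ M ∧ ∀ y, -n ≤ y → |A y| ≤ M * Real.exp (-a * y) := by
  obtain ⟨K, hK, hb⟩ := hdecay (|a| + 1) (by positivity)
  obtain ⟨N, hN⟩ := (isCompact_Icc (a := -n) (b := (0 : ℝ))).exists_bound_of_continuousOn
    (f := fun y => A y * Real.exp (a * y)) (by fun_prop)
  refine ⟨max K N, le_max_of_le_left hK.le, fun y hy => ?_⟩
  rcases le_total 0 y with h | h
  · calc |A y| ≤ |A y| + |deriv A y| := le_add_of_nonneg_right (abs_nonneg _)
      _ ≤ K * Real.exp (-(|a| + 1) * y) := hb y h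
      _ ≤ max K N * Real.exp (-a * y) := by
        gcongr
        · exact le_max_left _ _
        · linarith [le_abs_self a]
  · have h1 := hN y ⟨hy, h⟩
    rw [Real.norm_eq_abs, abs_mul, abs_of_pos (Real.exp_pos _)] at h1
    have h2 : |A y| = |A y| * Real.exp (a * y) * Real.exp (-a * y) := by
      rw [mul_assoc, ← Real.exp_add]
      simp
    rw [h2]
    gcongr
    exact h1.trans (le_max_right _ _)

theorem expDecaying_exp_mul_comp {A : ℝ → ℝ} (hA : Continuous A)
    (hdecay : ∀ a > (0 : ℝ), ∃ Ca > (0 : ℝ), ∀ x ≥ (0 : ℝ),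
      |A x| + |deriv A x| ≤ Ca * Real.exp (-a * x)) {q : ℝ} (hq : 0 < q) (c d p : ℝ) :
    ExpDecaying (fun t => Real.exp (c * t + d) * A (p + q * t)) := by
  refine ⟨by fun_prop, fun n => ?_⟩
  obtain ⟨M, hM, hb⟩ := superexponential_bound hA hdecay ((c + 1) / q) (q * n - p)
  refine ⟨M * Real.exp (d - (c + 1) / q * p), by positivity, fun t ht => ?_⟩
  have h := hb (p + q * t) (by nlinarith)
  rw [abs_mul, abs_of_pos (Real.exp_pos _)]
  calc Real.exp (c * t + d) * |A (p + q * t)|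
      ≤ Real.exp (c * t + d) * (M * Real.exp (-((c + 1) / q) * (p + q * t))) := by gcongr
    _ = M * (Real.exp (c * t + d) * Real.exp (-((c + 1) / q) * (p + q * t))) := by ring
    _ = M * Real.exp (d - (c + 1) / q * p) * Real.exp (-t) := by
      rw [mul_assoc, ← Real.exp_add, ← Real.exp_add]
      congr 2
      field_simp
      ring

theorem expDecaying_of_superexponential {A : ℝ → ℝ} (hA : Continuous A)
    (hdecay : ∀ a > (0 : ℝ), ∃ Ca > (0 : ℝ), ∀ x ≥ (0 : ℝ),
      |A x| + |deriv A x| ≤ Ca * Real.exp (-a * x)) : ExpDecaying A := by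
  simpa using expDecaying_exp_mul_comp hA hdecay one_pos 0 0 0

theorem locExpKernel_clamp {R : ℝ → ℝ → ℝ → ℝ}
    (hR : ContinuousOn (fun q : ℝ × ℝ × ℝ => R q.2.2 q.1 q.2.1) (Ici 0 ×ˢ Ici 0 ×ˢ univ))
    (hRbd : ∀ J : Set ℝ, IsCompact J → ∃ M, 0 ≤ M ∧ ∀ s ∈ J, ∀ x ≥ (0 : ℝ), ∀ y ≥ (0 : ℝ),
      |R s x y| ≤ M * Real.exp (-x - y)) :
    LocExpKernel (fun s x y => R s (max x 0) (max y 0)) := by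
  refine ⟨?_, fun n => ?_⟩
  · exact hR.comp_continuous
      (by fun_prop : Continuous fun p : ℝ × ℝ × ℝ => (max p.2.1 0, max p.2.2 0, p.1))
      fun p => ⟨le_max_right p.2.1 0, le_max_right p.2.2 0, mem_univ _⟩
  · obtain ⟨M, hM, hb⟩ := hRbd (Icc (-n) n) isCompact_Icc
    refine ⟨M, hM, fun s x y hs _ _ => ?_⟩
    refine (hb s (abs_le.1 hs) _ (le_max_right _ _) _ (le_max_right _ _)).trans ?_
    gcongr
    · exact le_max_left _ _
    · exact le_max_left _ _

theorem Cc_pos_and_powers {lam : ℝ} (hlam : 0 < lam) :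
    0 < Cc lam ∧ Cc lam ^ 3 = 1 + lam ^ (-(1 : ℝ) / 2) ∧
      ∀ σ, Sig lam σ = lam ^ (-(1 : ℝ) / 2) * (Cc lam ^ 2)⁻¹ * σ := by
  have h : 0 < 1 + lam ^ (-(1 : ℝ) / 2) := by positivity
  refine ⟨Real.rpow_pos_of_pos h _, ?_, fun σ => ?_⟩
  · rw [Cc, ← Real.rpow_natCast, ← Real.rpow_mul h.le]
    norm_num
  · rw [Sig, Cc, ← Real.rpow_natCast, ← Real.rpow_mul h.le, ← Real.rpow_neg h.le]
    norm_num

theorem rpow_sixth_identities {lam : ℝ} (hlam : 0 < lam) :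
    lam ^ ((1 : ℝ) / 6) * lam ^ ((1 : ℝ) / 6) = lam ^ ((1 : ℝ) / 3) ∧
      lam ^ ((1 : ℝ) / 6) * lam ^ (-(1 : ℝ) / 6) = 1 ∧
      √lam * lam ^ (-(1 : ℝ) / 2) = 1 := by
  refine ⟨?_, ?_, ?_⟩
  · rw [← Real.rpow_add hlam]
    norm_num
  · rw [← Real.rpow_add hlam]
    norm_num
  · rw [Real.sqrt_eq_rpow, ← Real.rpow_add hlam]
    norm_num

/-- **Rank-2 formula for the `σ`-derivative of the single-time Ferrari–Vető tacnode
kernel**: `∂ℒ/∂σ = -C⁻²(λ^{1/3} p̂₁(u;σ,τ) p̂₁(v;σ,-τ) + λ^{-1/2} p̂₂(u;σ,τ) p̂₂(v;σ,-τ))`. -/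
theorem tacnode_kernel_sigma_derivative_rank_two
    (Ai : ℝ → ℝ) (hAi : ContDiff ℝ 1 Ai)
    (hAidecay : ∀ a > (0 : ℝ), ∃ Ca > (0 : ℝ), ∀ x ≥ (0 : ℝ),
      |Ai x| + |deriv Ai x| ≤ Ca * Real.exp (-a * x))
    (lam : ℝ) (hlam : 0 < lam)
    (R : ℝ → ℝ → ℝ → ℝ)
    (hRsym : ∀ σ x y, 0 ≤ x → 0 ≤ y → R σ x y = R σ y x)
    (hRC1 : ContDiffOn ℝ 1 (fun q : ℝ × ℝ × ℝ => R q.2.2 q.1 q.2.1)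
      (Ici 0 ×ˢ Ici 0 ×ˢ univ))
    (hRres : ∀ σ x y, 0 ≤ x → 0 ≤ y →
      R σ x y = KAi Ai σ x y + ∫ t in Ioi (0 : ℝ), KAi Ai σ x t * R σ t y)
    (hRcomm : ∀ σ x y, 0 ≤ x → 0 ≤ y →
      (∫ t in Ioi (0 : ℝ), Ai (x + t + σ) * R σ t y)
        = ∫ t in Ioi (0 : ℝ), R σ x t * Ai (t + y + σ))
    (hTWxy : ∀ σ x y, 0 ≤ x → 0 ≤ y →
      HasDerivAt (fun t => R σ (x + t) (y + t))
        (R σ x 0 * R σ 0 y - Qf Ai R σ x * Qf Ai R σ y) 0)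
    (hTWσ : ∀ σ x y, 0 ≤ x → 0 ≤ y →
      HasDerivAt (fun σ' => R σ' x y) (-(Qf Ai R σ x * Qf Ai R σ y)) σ)
    (hRbd : ∀ J : Set ℝ, IsCompact J → ∃ CJ > (0 : ℝ), ∀ σ ∈ J, ∀ x ≥ (0 : ℝ), ∀ y ≥ (0 : ℝ),
      |R σ x y| ≤ CJ * Real.exp (-x - y)
      ∧ |deriv (fun x' => R σ x' y) x| ≤ CJ * Real.exp (-x - y)
      ∧ |deriv (fun y' => R σ x y') y| ≤ CJ * Real.exp (-x - y)
      ∧ |deriv (fun σ' => R σ' x y) σ| ≤ CJ * Real.exp (-x - y)) :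
    ∀ u v τ σ : ℝ,
      HasDerivAt (fun σ' => Ltac Ai lam R u v σ' τ)
        (-((Cc lam) ^ 2)⁻¹ *
          (lam ^ ((1 : ℝ) / 3) * p1hat Ai lam R u σ τ * p1hat Ai lam R v σ (-τ)
          + lam ^ (-(1 : ℝ) / 2) * p2hat Ai lam R u σ τ * p2hat Ai lam R v σ (-τ))) σ := by
  intro u v τ σ
  obtain ⟨hC, hC3, hSig⟩ := Cc_pos_and_powers hlam
  obtain ⟨hκ2, hκinv, hsqrt⟩ := rpow_sixth_identities hlam
  set κ := lam ^ ((1 : ℝ) / 6) with hκ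
  have hκ0 : 0 < κ := Real.rpow_pos_of_pos hlam _
  set C := Cc lam with hCdef
  set c₁ := (C ^ 3)⁻¹ with hc₁
  set c₂ := lam ^ (-(1 : ℝ) / 2) * (C ^ 3)⁻¹ with hc₂
  have hc : c₁ + c₂ = 1 := by
    have : (C ^ 3) ≠ 0 := by positivity
    rw [hc₁, hc₂]
    field_simp
    linarith
  have hA := expDecaying_of_superexponential hAi.continuous hAidecay
  have hr := locExpKernel_clamp hRC1.continuousOn fun J hJ => by
    obtain ⟨M, hM, hb⟩ := hRbd J hJ
    exact ⟨M, hM.le, fun s hs x hx y hy => (hb s hs x hx y hy).1⟩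
  set r : ℝ → ℝ → ℝ → ℝ := fun s x y => R s (max x 0) (max y 0) with hrdef
  have hrR : ∀ {s x y : ℝ}, 0 ≤ x → 0 ≤ y → r s x y = R s x y := fun hx hy => by
    simp only [hrdef, max_eq_left hx, max_eq_left hy]
  have hres : IsHankelResolvent Ai r := fun s x y hx hy => by
    rw [hrR hx hy, hRres s x y hx hy]
    congr 1
    exact setIntegral_congr_fun measurableSet_Ioi fun t ht => by
      simp only [hrR (le_of_lt ht) hy]
  have hcomm : CommutesWithHankel Ai r := fun s x y hx hy => by
    refine Eq.trans ?_ ((hRcomm s x y hx hy).trans ?_)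
    · exact setIntegral_congr_fun measurableSet_Ioi fun t ht => by
        simp only [hrR (le_of_lt ht) hy]
    · exact setIntegral_congr_fun measurableSet_Ioi fun t ht => by
        simp only [hrR hx (le_of_lt ht)]
  have hbt : ∀ T z, ∃ φ, ExpDecaying φ ∧
      (fun s x => κ * bt Ai lam s T z x) = fun s x => φ (x + c₁ * s) := by
    intro T z
    refine ⟨_, (expDecaying_exp_mul_comp hAi.continuous hAidecay (q := κ * C) (by positivity)
      (-√lam * T * C) (-√lam * T * (-z + √lam * T ^ 2) + lam * T ^ 3 / 3)
      (κ * (-z + √lam * T ^ 2))).const_mul κ, ?_⟩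
    funext s x
    have e : √lam * Sig lam s = C * (c₁ * s) := by
      have hC' : C * (C ^ 3)⁻¹ = (C ^ 2)⁻¹ := by field_simp
      rw [hSig, hc₁]
      linear_combination (C ^ 2)⁻¹ * s * hsqrt - s * hC'
    simp only [bt, ← hκ, ← hCdef]
    congr 3
    · linear_combination (-√lam * T) * e
    · linear_combination κ * e
  have hbb : ∀ T z, ∃ φ, ExpDecaying φ ∧
      (fun s x => bb Ai lam s T z x) = fun s x => φ (x + c₂ * s) := by
    intro T z
    refine ⟨_, expDecaying_exp_mul_comp hAi.continuous hAidecay (q := C) hC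
      (-T * C) (-T * (z + T ^ 2) + T ^ 3 / 3) (z + T ^ 2), ?_⟩
    funext s x
    have e : Sig lam s = C * (c₂ * s) := by
      rw [hSig, hc₂]
      field_simp
    simp only [bb, ← hCdef]
    congr 2
    · linear_combination (-T) * e
    · linear_combination e
  have hAA : ∀ s T z x, AA Ai lam s T z x
      = hankelReduced Ai (fun s x => κ * bt Ai lam s T z x) (fun s x => bb Ai lam s T z x) s x := by
    intro s T z x
    simp only [AA, hankelReduced, halfLineOp, hankelKernel, ← hκ, mul_left_comm _ κ,
      integral_const_mul]
  have hAAt : ∀ s T z x, κ * AAt Ai lam s T z x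
      = hankelReduced Ai (fun s x => bb Ai lam s T z x) (fun s x => κ * bt Ai lam s T z x) s x := by
    intro s T z x
    simp only [AAt, hankelReduced, halfLineOp, hankelKernel, mul_sub, ← mul_assoc, hκinv, one_mul]
  have hp2 : ∀ T z, p2hat Ai lam R z σ T
      = resolvedComponent Ai r (fun s x => κ * bt Ai lam s T z x)
          (fun s x => bb Ai lam s T z x) σ 0 := by
    intro T z
    rw [p2hat, resolvedComponent, hAA]
    congr 1
    refine setIntegral_congr_fun measurableSet_Ioi fun x hx => ?_
    simp only [hAA, hrR le_rfl (le_of_lt hx), hRsym σ x 0 (le_of_lt hx) le_rfl]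
  have hp1 : ∀ T z, κ * p1hat Ai lam R z σ T
      = extendedComponent Ai r (fun s x => κ * bt Ai lam s T z x)
          (fun s x => bb Ai lam s T z x) σ 0 := by
    intro T z
    obtain ⟨φ, hφ, e⟩ := hbt T z
    obtain ⟨χ, hχ, e'⟩ := hbb T z
    rw [extendedComponent_eq_resolvedComponent_swap hres hcomm hA hr
      (e ▸ hφ.const_family.shift c₁) (e' ▸ hχ.const_family.shift c₂) le_rfl, p1hat,
      resolvedComponent, mul_add, hAAt, ← integral_const_mul]
    congr 1
    refine setIntegral_congr_fun measurableSet_Ioi fun x hx => ?_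
    simp only [mul_left_comm κ, hAAt, hrR le_rfl (le_of_lt hx),
      hRsym σ x 0 (le_of_lt hx) le_rfl]
  obtain ⟨φ₁, hφ₁, eφ₁⟩ := hbt (-τ) v
  obtain ⟨φ₂, hφ₂, eφ₂⟩ := hbb (-τ) v
  obtain ⟨ψ₁, hψ₁, eψ₁⟩ := hbt τ u
  obtain ⟨ψ₂, hψ₂, eψ₂⟩ := hbb τ u
  have hd := (hasDerivAt_three_term hres hA hr hc hφ₁ hφ₂ hψ₁ hψ₂ eφ₁ eφ₂ eψ₁ eψ₂ σ).const_mul C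
  rw [← hp1, ← hp1, ← hp2, ← hp2] at hd
  refine (hd.congr_of_eventuallyEq (Filter.Eventually.of_forall fun s => ?_)).congr_deriv ?_
  · have e₁ : ∫ x in Ioi (0 : ℝ), κ * bt Ai lam s τ u x * (κ * bt Ai lam s (-τ) v x)
        = lam ^ ((1 : ℝ) / 3) * ∫ x in Ioi (0 : ℝ), bt Ai lam s τ u x * bt Ai lam s (-τ) v x := by
      rw [← integral_const_mul, ← hκ2]
      refine integral_congr_ae (Filter.Eventually.of_forall fun x => ?_)
      ring
    have e₂ : ∫ x in Ioi (0 : ℝ), ∫ y in Ioi (0 : ℝ),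
          R s x y * AA Ai lam s τ u x * AA Ai lam s (-τ) v y
        = ∫ x in Ioi (0 : ℝ), AA Ai lam s τ u x * halfLineOp r
            (hankelReduced Ai (fun s x => κ * bt Ai lam s (-τ) v x)
              (fun s x => bb Ai lam s (-τ) v x)) s x := by
      refine setIntegral_congr_fun measurableSet_Ioi fun x hx => ?_
      simp only [halfLineOp]
      rw [← integral_const_mul]
      refine setIntegral_congr_fun measurableSet_Ioi fun y hy => ?_
      simp only [hrR (le_of_lt hx) (le_of_lt hy), ← hAA]
      ring
    simp only [← hAA]
    rw [e₁, Ltac, e₂]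
    ring
  · rw [← hκ2, hc₁, hc₂]
    field_simp

end
end

section
/- With the notations of the context, define for u, v ∈ ℝ, σ ∈ ℝ and τ₁, τ₂ ∈ ℝ the multi-time extended tacnode kernel ℒ(u,v;σ,τ₁,τ₂) = −𝟙_{τ₁<τ₂}·(4π(τ₂−τ₁))^{−1/2}·exp(−(v−u)²/(4(τ₂−τ₁))) + C·λ^{1/3}·∫₀^∞ b̃_{τ₁,u}(x)·b̃_{−τ₂,v}(x) dx + C·∫₀^∞ 𝒜_{τ₁,u}(x)·𝒜_{−τ₂,v}(x) dx + C·∫₀^∞∫₀^∞ R_σ(x,y)·𝒜_{τ₁,u}(x)·𝒜_{−τ₂,v}(y) dx dy, and p̂₁(z;σ,τ) = 𝒜̃_{τ,z}(0) + ∫₀^∞ R_σ(x,0)·𝒜̃_{τ,z}(x) dx, p̂₂(z;σ,τ) = 𝒜_{τ,z}(0) + ∫₀^∞ R_σ(x,0)·𝒜_{τ,z}(x) dx. Then for all u, v, τ₁, τ₂ and all σ: ∂ℒ(u,v;σ,τ₁,τ₂)/∂σ = −C^{−2}·(λ^{1/3}·p̂₁(u;σ,τ₁)·p̂₁(v;σ,−τ₂)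 + λ^{−1/2}·p̂₂(u;σ,τ₁)·p̂₂(v;σ,−τ₂)). -/
open Real MeasureTheory Set

noncomputable section

/-- The multi-time extended Ferrari–Vető tacnode kernel. -/
def LtacExt (Ai : ℝ → ℝ) (lam : ℝ) (R : ℝ → ℝ → ℝ → ℝ) (u v σ τ₁ τ₂ : ℝ) : ℝ :=
  -(if τ₁ < τ₂ then (1 : ℝ) else 0) * (4 * π * (τ₂ - τ₁)) ^ (-(1 : ℝ) / 2) *
      Real.exp (-(v - u) ^ 2 / (4 * (τ₂ - τ₁)))
  + Cc lam * lam ^ ((1 : ℝ) / 3) * (∫ x in Ioi (0 : ℝ), bt Ai lam σ τ₁ u x * bt Ai lam σ (-τ₂) v x)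
  + Cc lam * (∫ x in Ioi (0 : ℝ), AA Ai lam σ τ₁ u x * AA Ai lam σ (-τ₂) v x)
  + Cc lam * ∫ x in Ioi (0 : ℝ), ∫ y in Ioi (0 : ℝ),
      R σ x y * AA Ai lam σ τ₁ u x * AA Ai lam σ (-τ₂) v y

local notation "ν" => Measure.restrict (volume : Measure ℝ) (Ioi (0 : ℝ))

/-- A function on the half-line which is measurable and bounded by a multiple of `e^{-x}`. -/
def ExpDecay (f : ℝ → ℝ) : Prop :=
  AEStronglyMeasurable f ν ∧ ∃ M, ∀ x > 0, |f x| ≤ M * exp (-x)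

/-- A kernel on the quadrant which is measurable and bounded by a multiple of `e^{-x-y}`. -/
def ExpDecayKernel (k : ℝ → ℝ → ℝ) : Prop :=
  AEStronglyMeasurable (fun p : ℝ × ℝ => k p.1 p.2) (Measure.prod ν ν) ∧
    ∃ M, ∀ x > 0, ∀ y > 0, |k x y| ≤ M * exp (-x - y)

lemma ae_pos : ∀ᵐ x ∂ν, 0 < x := ae_restrict_mem measurableSet_Ioi

lemma prod_half : Measure.prod ν ν =
    (volume : Measure (ℝ × ℝ)).restrict (Ioi (0 : ℝ) ×ˢ Ioi (0 : ℝ)) := by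
  rw [Measure.prod_restrict, Measure.volume_eq_prod]

lemma ae_prod_pos : ∀ᵐ p : ℝ × ℝ ∂(Measure.prod ν ν), 0 < p.1 ∧ 0 < p.2 := by
  rw [prod_half]
  filter_upwards [ae_restrict_mem (measurableSet_Ioi.prod measurableSet_Ioi)] with p hp
  exact hp

lemma integrable_exp_neg : Integrable (fun x : ℝ => exp (-x)) ν := by
  have := integrableOn_exp_neg_Ioi 0
  exact this

lemma integrable_exp_neg_prod :
    Integrable (fun p : ℝ × ℝ => exp (-p.1 - p.2)) (Measure.prod ν ν) := by
  refine (integrable_exp_neg.mul_prod integrable_exp_neg).congr (ae_of_all _ fun p => ?_)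
  simp only [← exp_add]; ring_nf

lemma nonneg_of_exp_bound {f : ℝ → ℝ} {M : ℝ} (h : ∀ x > 0, |f x| ≤ M * exp (-x)) : 0 ≤ M := by
  have := (abs_nonneg _).trans (h 1 one_pos)
  exact nonneg_of_mul_nonneg_left this (exp_pos _)

lemma nonneg_of_exp_bound₂ {k : ℝ → ℝ → ℝ} {M : ℝ}
    (h : ∀ x > 0, ∀ y > 0, |k x y| ≤ M * exp (-x - y)) : 0 ≤ M := by
  have := (abs_nonneg _).trans (h 1 one_pos 1 one_pos)
  exact nonneg_of_mul_nonneg_left this (exp_pos _)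

/-- If `|a| ≤ M e^{-x}` and `|b| ≤ N e^{-x}` for some `x > 0`, then `|a b| ≤ M N e^{-x}`. -/
lemma abs_mul_le_exp {a b M N x : ℝ} (hx : 0 < x) (ha : |a| ≤ M * exp (-x))
    (hb : |b| ≤ N * exp (-x)) : |a * b| ≤ M * N * exp (-x) := by
  have h1 : exp (-x) ≤ 1 := by simpa using hx.le
  have hN : 0 ≤ N := nonneg_of_mul_nonneg_left ((abs_nonneg _).trans hb) (exp_pos _)
  have hb' : |b| ≤ N := hb.trans (mul_le_of_le_one_right hN h1)
  rw [abs_mul]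
  calc |a| * |b| ≤ (M * exp (-x)) * N :=
        mul_le_mul ha hb' (abs_nonneg _) ((abs_nonneg _).trans ha)
    _ = M * N * exp (-x) := by ring

lemma abs_mul_mul_le_exp {k a b K M N x y : ℝ} (hx : 0 < x) (hy : 0 < y)
    (hk : |k| ≤ K * exp (-x - y)) (ha : |a| ≤ M * exp (-x))
    (hb : |b| ≤ N * exp (-y)) : |k * a * b| ≤ K * M * N * exp (-x - y) := by
  have hM : 0 ≤ M := nonneg_of_mul_nonneg_left ((abs_nonneg _).trans ha) (exp_pos _)
  have hN : 0 ≤ N := nonneg_of_mul_nonneg_left ((abs_nonneg _).trans hb) (exp_pos _)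
  have ha' : |a| ≤ M := ha.trans (mul_le_of_le_one_right hM (by simpa using hx.le))
  have hb' : |b| ≤ N := hb.trans (mul_le_of_le_one_right hN (by simpa using hy.le))
  rw [abs_mul, abs_mul]
  calc |k| * |a| * |b| ≤ (K * exp (-x - y)) * M * N := by
        have := (abs_nonneg _).trans hk
        gcongr
    _ = K * M * N * exp (-x - y) := by ring

namespace ExpDecay

variable {f g : ℝ → ℝ}

lemma mk' (hf : Continuous f) {M : ℝ} (h : ∀ x > 0, |f x| ≤ M * exp (-x)) : ExpDecay f :=
  ⟨hf.aestronglyMeasurable, M, h⟩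

lemma integrable (hf : ExpDecay f) : Integrable f ν := by
  obtain ⟨hm, M, hM⟩ := hf
  refine (integrable_exp_neg.const_mul M).mono' hm ?_
  filter_upwards [ae_pos] with x hx using hM x hx

lemma mul (hf : ExpDecay f) (hg : ExpDecay g) : ExpDecay (fun x => f x * g x) := by
  obtain ⟨hm, M, hM⟩ := hf
  obtain ⟨hn, N, hN⟩ := hg
  exact ⟨hm.mul hn, M * N, fun x hx => abs_mul_le_exp hx (hM x hx) (hN x hx)⟩

lemma add (hf : ExpDecay f) (hg : ExpDecay g) : ExpDecay (fun x => f x + g x) := by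
  obtain ⟨hm, M, hM⟩ := hf
  obtain ⟨hn, N, hN⟩ := hg
  exact ⟨hm.add hn, M + N, fun x hx =>
    (abs_add_le _ _).trans (by rw [add_mul]; exact add_le_add (hM x hx) (hN x hx))⟩

lemma const_mul (hf : ExpDecay f) (c : ℝ) : ExpDecay (fun x => c * f x) := by
  obtain ⟨hm, M, hM⟩ := hf
  exact ⟨hm.const_mul c, |c| * M, fun x hx => by
    rw [abs_mul, mul_assoc]; exact mul_le_mul_of_nonneg_left (hM x hx) (abs_nonneg c)⟩

lemma sub (hf : ExpDecay f) (hg : ExpDecay g) : ExpDecay (fun x => f x - g x) := by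
  simpa [sub_eq_add_neg] using hf.add (hg.const_mul (-1))

lemma integral_deriv_mul_add {f' g' : ℝ → ℝ} (hf : ExpDecay f) (hf' : ExpDecay f')
    (hg : ExpDecay g) (hg' : ExpDecay g') (hdf : ∀ x, HasDerivAt f (f' x) x)
    (hdg : ∀ x, HasDerivAt g (g' x) x) :
    ∫ x in Ioi (0 : ℝ), (f' x * g x + f x * g' x) = -(f 0 * g 0) := by
  have hlim : Filter.Tendsto (fun x => f x * g x) Filter.atTop (nhds 0) := by
    obtain ⟨M, hM⟩ := (hf.mul hg).2
    refine squeeze_zero_norm' (a := fun x => M * exp (-x)) ?_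
      (by simpa using tendsto_exp_neg_atTop_nhds_zero.const_mul M)
    filter_upwards [Filter.eventually_gt_atTop 0] with x hx using hM x hx
  rw [integral_Ioi_of_hasDerivAt_of_tendsto' (a := (0 : ℝ)) (f := fun x => f x * g x)
    (fun x _ => (hdf x).mul (hdg x)) ((hf'.mul hg).add (hf.mul hg')).integrable hlim, zero_sub]

end ExpDecay

namespace ExpDecayKernel

variable {k : ℝ → ℝ → ℝ} {f g : ℝ → ℝ}

lemma swap (hk : ExpDecayKernel k) : ExpDecayKernel (fun x y => k y x) := by
  obtain ⟨hm, M, hM⟩ := hk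
  refine ⟨hm.prod_swap, M, fun x hx y hy => ?_⟩
  convert hM y hy x hx using 3; ring

lemma aestronglyMeasurable_mul_mul (hk : ExpDecayKernel k) (hf : ExpDecay f) (hg : ExpDecay g) :
    AEStronglyMeasurable (fun p : ℝ × ℝ => k p.1 p.2 * f p.1 * g p.2) (Measure.prod ν ν) :=
  (hk.1.mul hf.1.comp_fst).mul hg.1.comp_snd

lemma integrable (hk : ExpDecayKernel k) (hf : ExpDecay f) (hg : ExpDecay g) :
    Integrable (fun p : ℝ × ℝ => k p.1 p.2 * f p.1 * g p.2) (Measure.prod ν ν) := by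
  have hm := hk.aestronglyMeasurable_mul_mul hf hg
  obtain ⟨-, K, hK⟩ := hk
  obtain ⟨-, M, hM⟩ := hf
  obtain ⟨-, N, hN⟩ := hg
  refine (integrable_exp_neg_prod.const_mul (K * M * N)).mono' hm ?_
  filter_upwards [ae_prod_pos] with p hp
  exact abs_mul_mul_le_exp hp.1 hp.2 (hK _ hp.1 _ hp.2) (hM _ hp.1) (hN _ hp.2)

lemma integral_integral (hk : ExpDecayKernel k) (hf : ExpDecay f) (hg : ExpDecay g) :
    ∫ x in Ioi (0 : ℝ), ∫ y in Ioi (0 : ℝ), k x y * f x * g y =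
      ∫ p, k p.1 p.2 * f p.1 * g p.2 ∂(Measure.prod ν ν) :=
  (integral_prod _ (hk.integrable hf hg)).symm

lemma integral_integral_swap (hk : ExpDecayKernel k) (hf : ExpDecay f) (hg : ExpDecay g) :
    ∫ x in Ioi (0 : ℝ), ∫ y in Ioi (0 : ℝ), k x y * f x * g y =
      ∫ y in Ioi (0 : ℝ), ∫ x in Ioi (0 : ℝ), k x y * f x * g y :=
  MeasureTheory.integral_integral_swap (f := fun x y => k x y * f x * g y) (hk.integrable hf hg)

/-- Integral operators with exponentially decaying kernel preserve exponential decay. -/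
lemma apply (hk : ExpDecayKernel k) (hg : ExpDecay g) :
    ExpDecay (fun x => ∫ y in Ioi (0 : ℝ), k x y * g y) := by
  have hm : AEStronglyMeasurable (fun p : ℝ × ℝ => k p.1 p.2 * g p.2) (Measure.prod ν ν) :=
    hk.1.mul hg.1.comp_snd
  obtain ⟨-, K, hK⟩ := hk
  obtain ⟨-, N, hN⟩ := hg
  refine ⟨hm.integral_prod_right', K * N, fun x hx => ?_⟩
  have hN0 := nonneg_of_exp_bound hN
  have h1 : ∫ y in Ioi (0 : ℝ), K * N * exp (-x) * exp (-y) = K * N * exp (-x) := by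
    rw [integral_const_mul, integral_exp_neg_Ioi]; simp
  rw [← h1, ← Real.norm_eq_abs]
  refine norm_integral_le_of_norm_le (integrable_exp_neg.const_mul _) ?_
  filter_upwards [ae_pos] with y hy
  have hb : |g y| ≤ N := (hN y hy).trans (mul_le_of_le_one_right hN0 (by simpa using hy.le))
  have hkb := hK x hx y hy
  rw [norm_mul, Real.norm_eq_abs, Real.norm_eq_abs]
  calc |k x y| * |g y| ≤ (K * exp (-x - y)) * N :=
        mul_le_mul hkb hb (abs_nonneg _) ((abs_nonneg _).trans hkb)
    _ = K * N * exp (-x) * exp (-y) := by rw [sub_eq_add_neg, exp_add]; ring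

/-- The transpose relation `⟨f, k g⟩ = ⟨kᵀ f, g⟩`. -/
lemma integral_mul_apply (hk : ExpDecayKernel k) (hf : ExpDecay f) (hg : ExpDecay g) :
    ∫ x in Ioi (0 : ℝ), f x * ∫ y in Ioi (0 : ℝ), k x y * g y =
      ∫ y in Ioi (0 : ℝ), (∫ x in Ioi (0 : ℝ), k x y * f x) * g y := by
  have h := hk.integral_integral_swap hf hg
  calc _ = ∫ x in Ioi (0 : ℝ), ∫ y in Ioi (0 : ℝ), k x y * f x * g y := by
        simp_rw [← integral_const_mul]
        congr! 4 with x y; ring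
    _ = _ := h
    _ = _ := by simp_rw [← integral_mul_const]

lemma integral_integral_eq_left (hk : ExpDecayKernel k) (hf : ExpDecay f) (hg : ExpDecay g) :
    ∫ x in Ioi (0 : ℝ), ∫ y in Ioi (0 : ℝ), k x y * f x * g y =
      ∫ x in Ioi (0 : ℝ), f x * ∫ y in Ioi (0 : ℝ), k x y * g y := by
  rw [hk.integral_mul_apply hf hg, hk.integral_integral_swap hf hg]
  simp_rw [← integral_mul_const]

/-- Integration by parts in the first variable. -/
lemma integral_deriv_fst {kx : ℝ → ℝ → ℝ} {f' : ℝ → ℝ} (hk : ExpDecayKernel k)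
    (hkx : ExpDecayKernel kx) (hf : ExpDecay f) (hf' : ExpDecay f') (hg : ExpDecay g)
    (hdk : ∀ x > 0, ∀ y > 0, HasDerivAt (fun t => k t y) (kx x y) x)
    (hk0 : ∀ y > 0, ContinuousWithinAt (fun t => k t y) (Ici 0) 0)
    (hdf : ∀ x, HasDerivAt f (f' x) x) :
    (∫ p, kx p.1 p.2 * f p.1 * g p.2 ∂(Measure.prod ν ν)) +
        ∫ p, k p.1 p.2 * f' p.1 * g p.2 ∂(Measure.prod ν ν) =
      -(f 0 * ∫ y in Ioi (0 : ℝ), k 0 y * g y) := by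
  have i1 := hkx.integrable hf hg
  have i2 := hk.integrable hf' hg
  have i3 : Integrable (fun p : ℝ × ℝ => kx p.1 p.2 * f p.1 * g p.2 + k p.1 p.2 * f' p.1 * g p.2)
      (Measure.prod ν ν) := i1.add i2
  rw [← integral_add i1 i2, integral_prod_symm _ i3, ← integral_const_mul, ← integral_neg]
  refine integral_congr_ae ?_
  filter_upwards [ae_pos, i3.prod_left_ae] with y hy hint
  obtain ⟨-, K, hK⟩ := hk
  obtain ⟨-, M, hM⟩ := hf
  have hlim : Filter.Tendsto (fun x => k x y * f x * g y) Filter.atTop (nhds 0) := by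
    have h0 : Filter.Tendsto (fun x => K * M * exp (-x) * |g y|) Filter.atTop (nhds 0) := by
      simpa using (tendsto_exp_neg_atTop_nhds_zero.const_mul (K * M)).mul_const |g y|
    refine squeeze_zero_norm' ?_ h0
    filter_upwards [Filter.eventually_gt_atTop 0] with x hx
    rw [Real.norm_eq_abs, abs_mul]
    refine mul_le_mul_of_nonneg_right (abs_mul_le_exp hx ?_ (hM x hx)) (abs_nonneg _)
    refine (hK x hx y hy).trans ?_
    have := nonneg_of_exp_bound₂ hK
    gcongr; linarith
  have := integral_Ioi_of_hasDerivAt_of_tendsto (a := (0 : ℝ))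
    (f := fun x => k x y * f x * g y)
    (f' := fun x => kx x y * f x * g y + k x y * f' x * g y)
    (((hk0 y hy).mul (hdf 0).continuousAt.continuousWithinAt).mul continuousWithinAt_const)
    (fun x hx => (((hdk x hx y hy).mul (hdf x)).mul_const (g y)).congr_deriv (by ring)) hint hlim
  simp only [this]
  ring

end ExpDecayKernel

/-- A family of functions on the half-line, differentiable in the parameter with derivative `a'`,
with exponential decay locally uniform in the parameter. -/
structure DecayFamily (a a' : ℝ → ℝ → ℝ) : Prop where
  meas : ∀ s, AEStronglyMeasurable (a s) ν
  meas' : ∀ s, AEStronglyMeasurable (a' s) ν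
  hasDerivAt : ∀ s, ∀ x > 0, HasDerivAt (fun s => a s x) (a' s x) s
  bound : ∀ s₀, ∃ M, ∀ s ∈ Metric.ball s₀ 1, ∀ x > 0,
    |a s x| ≤ M * exp (-x) ∧ |a' s x| ≤ M * exp (-x)

/-- The analogue of `DecayFamily` for kernels on the quadrant. -/
structure DecayKernelFamily (k k' : ℝ → ℝ → ℝ → ℝ) : Prop where
  meas : ∀ s, AEStronglyMeasurable (fun p : ℝ × ℝ => k s p.1 p.2) (Measure.prod ν ν)
  meas' : ∀ s, AEStronglyMeasurable (fun p : ℝ × ℝ => k' s p.1 p.2) (Measure.prod ν ν)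
  hasDerivAt : ∀ s, ∀ x > 0, ∀ y > 0, HasDerivAt (fun s => k s x y) (k' s x y) s
  bound : ∀ s₀, ∃ M, ∀ s ∈ Metric.ball s₀ 1, ∀ x > 0, ∀ y > 0,
    |k s x y| ≤ M * exp (-x - y) ∧ |k' s x y| ≤ M * exp (-x - y)

namespace DecayFamily

variable {a a' b b' : ℝ → ℝ → ℝ}

lemma expDecay (ha : DecayFamily a a') (s : ℝ) : ExpDecay (a s) :=
  ⟨ha.meas s, (ha.bound s).imp fun _ hM x hx => (hM s (by simp) x hx).1⟩

lemma expDecay' (ha : DecayFamily a a') (s : ℝ) : ExpDecay (a' s) :=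
  ⟨ha.meas' s, (ha.bound s).imp fun _ hM x hx => (hM s (by simp) x hx).2⟩

lemma hasDerivAt_integral_mul (ha : DecayFamily a a') (hb : DecayFamily b b') (s : ℝ) :
    HasDerivAt (fun s => ∫ x in Ioi (0 : ℝ), a s x * b s x)
      (∫ x in Ioi (0 : ℝ), (a' s x * b s x + a s x * b' s x)) s := by
  obtain ⟨M, hM⟩ := ha.bound s
  obtain ⟨N, hN⟩ := hb.bound s
  refine (hasDerivAt_integral_of_dominated_loc_of_deriv_le
    (F' := fun s x => a' s x * b s x + a s x * b' s x)
    (bound := fun x => (M * N + M * N) * exp (-x)) (Metric.ball_mem_nhds s one_pos)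
    (Filter.Eventually.of_forall fun t => (ha.meas t).mul (hb.meas t))
    ((ha.expDecay s).mul (hb.expDecay s)).integrable
    (((ha.meas' s).mul (hb.meas s)).add ((ha.meas s).mul (hb.meas' s)))
    ?_ (integrable_exp_neg.const_mul _) ?_).2
  · filter_upwards [ae_pos] with x hx t ht
    have h1 := hM t ht x hx
    have h2 := hN t ht x hx
    rw [add_mul]
    exact (abs_add_le _ _).trans
      (add_le_add (abs_mul_le_exp hx h1.2 h2.1) (abs_mul_le_exp hx h1.1 h2.2))
  · filter_upwards [ae_pos] with x hx t _
    exact (ha.hasDerivAt t x hx).mul (hb.hasDerivAt t x hx)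

end DecayFamily

namespace DecayKernelFamily

variable {k k' : ℝ → ℝ → ℝ → ℝ} {a a' b b' : ℝ → ℝ → ℝ}

lemma expDecayKernel (hk : DecayKernelFamily k k') (s : ℝ) : ExpDecayKernel (k s) :=
  ⟨hk.meas s, (hk.bound s).imp fun _ hM x hx y hy => (hM s (by simp) x hx y hy).1⟩

lemma expDecayKernel' (hk : DecayKernelFamily k k') (s : ℝ) : ExpDecayKernel (k' s) :=
  ⟨hk.meas' s, (hk.bound s).imp fun _ hM x hx y hy => (hM s (by simp) x hx y hy).2⟩

lemma hasDerivAt_integral (hk : DecayKernelFamily k k') (ha : DecayFamily a a')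
    (hb : DecayFamily b b') (s : ℝ) :
    HasDerivAt (fun s => ∫ x in Ioi (0 : ℝ), ∫ y in Ioi (0 : ℝ), k s x y * a s x * b s y)
      ((∫ p, k' s p.1 p.2 * a s p.1 * b s p.2 ∂(Measure.prod ν ν)) +
        (∫ p, k s p.1 p.2 * a' s p.1 * b s p.2 ∂(Measure.prod ν ν)) +
        ∫ p, k s p.1 p.2 * a s p.1 * b' s p.2 ∂(Measure.prod ν ν)) s := by
  simp_rw [fun s => (hk.expDecayKernel s).integral_integral (ha.expDecay s) (hb.expDecay s)]
  have i1 := (hk.expDecayKernel' s).integrable (ha.expDecay s) (hb.expDecay s)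
  have i2 := (hk.expDecayKernel s).integrable (ha.expDecay' s) (hb.expDecay s)
  have i3 := (hk.expDecayKernel s).integrable (ha.expDecay s) (hb.expDecay' s)
  have i12 : Integrable (fun p : ℝ × ℝ => k' s p.1 p.2 * a s p.1 * b s p.2 +
    k s p.1 p.2 * a' s p.1 * b s p.2) (Measure.prod ν ν) := i1.add i2
  rw [← integral_add i1 i2, ← integral_add i12 i3]
  obtain ⟨K, hK⟩ := hk.bound s
  obtain ⟨M, hM⟩ := ha.bound s
  obtain ⟨N, hN⟩ := hb.bound s
  refine (hasDerivAt_integral_of_dominated_loc_of_deriv_le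
    (F' := fun s p => k' s p.1 p.2 * a s p.1 * b s p.2 +
      k s p.1 p.2 * a' s p.1 * b s p.2 + k s p.1 p.2 * a s p.1 * b' s p.2)
    (bound := fun p : ℝ × ℝ => (K * M * N + K * M * N + K * M * N) * exp (-p.1 - p.2))
    (Metric.ball_mem_nhds s one_pos)
    (Filter.Eventually.of_forall fun t => (hk.expDecayKernel t).aestronglyMeasurable_mul_mul
      (ha.expDecay t) (hb.expDecay t))
    ((hk.expDecayKernel s).integrable (ha.expDecay s) (hb.expDecay s))
    (i12.add i3).1 ?_ (integrable_exp_neg_prod.const_mul _) ?_).2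
  · filter_upwards [ae_prod_pos] with p hp t ht
    have h0 := hK t ht p.1 hp.1 p.2 hp.2
    have h1 := hM t ht p.1 hp.1
    have h2 := hN t ht p.2 hp.2
    rw [add_mul, add_mul]
    exact (abs_add_le _ _).trans (add_le_add ((abs_add_le _ _).trans
      (add_le_add (abs_mul_mul_le_exp hp.1 hp.2 h0.2 h1.1 h2.1)
        (abs_mul_mul_le_exp hp.1 hp.2 h0.1 h1.2 h2.1)))
        (abs_mul_mul_le_exp hp.1 hp.2 h0.1 h1.1 h2.2))
  · filter_upwards [ae_prod_pos] with p hp t _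
    exact (((hk.hasDerivAt t p.1 hp.1 p.2 hp.2).mul (ha.hasDerivAt t p.1 hp.1)).mul
      (hb.hasDerivAt t p.2 hp.2)).congr_deriv (by simp only [Pi.mul_apply]; ring)

end DecayKernelFamily

/-- `C¹` functions which, with their derivative, are `O(e^{-x})` on every right half-line. -/
def RightExpDecay (g : ℝ → ℝ) : Prop :=
  ContDiff ℝ 1 g ∧ ∀ T, ∃ M, ∀ x ≥ T, |g x| ≤ M * exp (-x) ∧ |deriv g x| ≤ M * exp (-x)

namespace RightExpDecay

variable {f g : ℝ → ℝ}

lemma hasDerivAt (hf : RightExpDecay f) (x : ℝ) : HasDerivAt f (deriv f x) x :=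
  (hf.1.differentiable one_ne_zero x).hasDerivAt

lemma continuous_deriv (hf : RightExpDecay f) : Continuous (deriv f) :=
  hf.1.continuous_deriv le_rfl

lemma bound (hf : RightExpDecay f) (T : ℝ) : ∃ M, 0 ≤ M ∧ ∀ w ≥ T, ∀ x ≥ 0,
    |f (x + w)| ≤ M * exp (-x) ∧ |deriv f (x + w)| ≤ M * exp (-x) := by
  obtain ⟨M, hM⟩ := hf.2 T
  have hM0 : 0 ≤ M :=
    nonneg_of_mul_nonneg_left ((abs_nonneg _).trans (hM T le_rfl).1) (exp_pos _)
  have key : ∀ w ≥ T, ∀ x, M * exp (-(x + w)) ≤ M * exp (-T) * exp (-x) := fun w hw x => by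
    rw [mul_assoc, ← exp_add]
    gcongr; linarith
  refine ⟨M * exp (-T), by positivity, fun w hw x hx => ?_⟩
  have h := hM (x + w) (by linarith)
  exact ⟨h.1.trans (key w hw x), h.2.trans (key w hw x)⟩

lemma expDecay (hf : RightExpDecay f) (w : ℝ) : ExpDecay (fun x => f (x + w)) := by
  obtain ⟨M, -, hM⟩ := hf.bound w
  have := hf.1.continuous
  exact .mk' (by fun_prop) fun x hx => (hM w le_rfl x hx.le).1

lemma expDecay_deriv (hf : RightExpDecay f) (w : ℝ) :
    ExpDecay (fun x => deriv f (x + w)) := by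
  obtain ⟨M, -, hM⟩ := hf.bound w
  have := hf.continuous_deriv
  exact .mk' (by fun_prop) fun x hx => (hM w le_rfl x hx.le).2

lemma expDecayKernel (hf : RightExpDecay f) (w : ℝ) :
    ExpDecayKernel (fun x y => f (x + y + w)) := by
  obtain ⟨M, -, hM⟩ := hf.bound w
  have := hf.1.continuous
  refine ⟨Continuous.aestronglyMeasurable (by fun_prop), M, fun x hx y hy => ?_⟩
  convert (hM w le_rfl (x + y) (by linarith)).1 using 3
  ring

lemma family (hf : RightExpDecay f) (a c : ℝ) :
    DecayFamily (fun s y => f (y + (a + c * s))) (fun s y => c * deriv f (y + (a + c * s))) where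
  meas s := (hf.expDecay _).1
  meas' s := (hf.expDecay_deriv _).1.const_mul c
  hasDerivAt s x _ := by
    have h1 : HasDerivAt (fun s => x + (a + c * s)) c s := by
      simpa using (((hasDerivAt_id s).const_mul c).const_add a).const_add x
    rw [mul_comm c]
    exact (hf.hasDerivAt _).comp s h1
  bound s₀ := by
    obtain ⟨M, hM0, hM⟩ := hf.bound (a + c * s₀ - |c|)
    refine ⟨(1 + |c|) * M, fun s hs x hx => ?_⟩
    have hs' : |s - s₀| < 1 := by simpa [Real.dist_eq] using hs
    have h1 : |c * (s - s₀)| ≤ |c| := by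
      rw [abs_mul]; exact mul_le_of_le_one_right (abs_nonneg c) hs'.le
    have h2 := hM (a + c * s) (by linarith [neg_abs_le (c * (s - s₀))]) x hx.le
    have h3 : 0 ≤ M * exp (-x) := by positivity
    rw [abs_mul]
    constructor
    · nlinarith [abs_nonneg c]
    · nlinarith [abs_nonneg c]

lemma integral_deriv_mul_add (hf : RightExpDecay f) (hg : RightExpDecay g) (p q : ℝ) :
    ∫ y in Ioi (0 : ℝ), (deriv f (y + p) * g (y + q) + f (y + p) * deriv g (y + q)) =
      -(f p * g q) := by
  simpa using (hf.expDecay p).integral_deriv_mul_add (hf.expDecay_deriv p) (hg.expDecay q)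
    (hg.expDecay_deriv q) (fun x => (hf.hasDerivAt (x + p)).comp_add_const x p)
    (fun x => (hg.hasDerivAt (x + q)).comp_add_const x q)

end RightExpDecay

/-- `∫₀^∞ f(y+p) g(y+q) dy`. -/
def halfCorr (f g : ℝ → ℝ) (p q : ℝ) : ℝ := ∫ y in Ioi (0 : ℝ), f (y + p) * g (y + q)

lemma abs_halfCorr_le {f g : ℝ → ℝ} {M N p x q : ℝ} (hx : 0 ≤ x)
    (hf : ∀ y ≥ 0, |f (y + p)| ≤ M * exp (-y)) (hg : ∀ y ≥ 0, |g (y + q)| ≤ N * exp (-y)) :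
    |halfCorr f g (x + p) q| ≤ M * N * exp (-x) := by
  have h1 : ∫ y in Ioi (0 : ℝ), M * N * exp (-x) * exp (-y) = M * N * exp (-x) := by
    rw [integral_const_mul, integral_exp_neg_Ioi]; simp
  rw [← h1, ← Real.norm_eq_abs]
  refine norm_integral_le_of_norm_le (integrable_exp_neg.const_mul _) ?_
  filter_upwards [ae_pos] with y hy
  have hfy : |f (y + (x + p))| ≤ M * exp (-x) * exp (-y) := by
    have := hf (y + x) (by linarith [hy.le])
    rwa [add_assoc, neg_add, add_comm (-y), exp_add, ← mul_assoc] at this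
  have := abs_mul_le_exp hy hfy (hg y hy.le)
  rw [Real.norm_eq_abs]
  linarith

namespace RightExpDecay

variable {f g : ℝ → ℝ}

lemma hasDerivAt_halfCorr_left (hf : RightExpDecay f) (hg : RightExpDecay g) (q w x : ℝ) :
    HasDerivAt (fun x => halfCorr f g (x + w) q) (halfCorr (deriv f) g (x + w) q) x := by
  have h := (hf.family w 1).hasDerivAt_integral_mul (hg.family q 0) x
  simpa [halfCorr, add_comm] using h

lemma hasDerivAt_halfCorr (hf : RightExpDecay f) (hg : RightExpDecay g) (β x s : ℝ) :
    HasDerivAt (fun s => halfCorr f g (x + s) (β * s))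
      ((1 - β) * halfCorr (deriv f) g (x + s) (β * s) - β * (f (x + s) * g (β * s))) s := by
  have h := (hf.family x 1).hasDerivAt_integral_mul (hg.family 0 β) s
  have hi := hf.integral_deriv_mul_add hg (x + s) (β * s)
  have i1 := ((hf.expDecay_deriv (x + s)).mul (hg.expDecay (β * s))).integrable
  have i2 := ((hf.expDecay (x + s)).mul (hg.expDecay_deriv (β * s))).integrable
  rw [integral_add i1 i2] at hi
  simp only [one_mul, zero_add] at h
  have i3 : Integrable (fun y => f (y + (x + s)) * (β * deriv g (y + β * s))) ν := by
    simpa only [mul_left_comm] using i2.const_mul β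
  rw [integral_add i1 i3] at h
  simp only [mul_left_comm _ β, integral_const_mul] at h
  unfold halfCorr
  convert h using 1
  linear_combination -β * hi

end RightExpDecay

/-- `h(x+αs) - μ ∫₀^∞ f(x+y+s) k(y+βs) dy`. -/
def airyComb (f h k : ℝ → ℝ) (μ α β s x : ℝ) : ℝ :=
  h (x + α * s) - μ * halfCorr f k (x + s) (β * s)

section airyComb

variable {f h k : ℝ → ℝ} {μ α β : ℝ}

lemma hasDerivAt_airyComb (hf : RightExpDecay f) (hh : RightExpDecay h) (hk : RightExpDecay k)
    (s x : ℝ) :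
    HasDerivAt (airyComb f h k μ α β s) (airyComb (deriv f) (deriv h) k μ α β s x) x :=
  ((hh.hasDerivAt _).comp_add_const x _).sub
    ((hf.hasDerivAt_halfCorr_left hk (β * s) s x).const_mul μ)

lemma hasDerivAt_airyComb_param (hf : RightExpDecay f) (hh : RightExpDecay h)
    (hk : RightExpDecay k) (hαβ : α + β = 1) (s x : ℝ) :
    HasDerivAt (fun s => airyComb f h k μ α β s x)
      (α * airyComb (deriv f) (deriv h) k μ α β s x + μ * β * k (β * s) * f (x + s)) s := by
  have h1 : HasDerivAt (fun s => x + α * s) α s := by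
    simpa using ((hasDerivAt_id s).const_mul α).const_add x
  refine (((hh.hasDerivAt _).comp s h1).sub
    ((hf.hasDerivAt_halfCorr hk β x s).const_mul μ)).congr_deriv ?_
  obtain rfl : α = 1 - β := by linarith
  simp only [airyComb]
  ring

lemma exists_bound_airyComb (hf : RightExpDecay f) (hh : RightExpDecay h)
    (hk : RightExpDecay k) (hα : 0 ≤ α) (hβ : 0 ≤ β) (s₀ : ℝ) :
    ∃ M, ∀ s ∈ Metric.ball s₀ 1, ∀ x > 0, |airyComb f h k μ α β s x| ≤ M * exp (-x) ∧
      |airyComb (deriv f) (deriv h) k μ α β s x| ≤ M * exp (-x) := by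
  obtain ⟨F, hF0, hF⟩ := hf.bound (s₀ - 1)
  obtain ⟨H, hH0, hH⟩ := hh.bound (α * (s₀ - 1))
  obtain ⟨K, hK0, hK⟩ := hk.bound (β * (s₀ - 1))
  refine ⟨H + |μ| * (F * K), fun s hs x hx => ?_⟩
  have hs' : s₀ - 1 ≤ s := by
    have := (abs_lt.1 (by simpa [Real.dist_eq] using hs : |s - s₀| < 1)).1
    linarith
  have h1 := hH (α * s) (by gcongr) x hx.le
  have hk' : ∀ y ≥ 0, |k (y + β * s)| ≤ K * exp (-y) := fun y hy =>
    (hK (β * s) (by gcongr) y hy).1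
  have key : ∀ a b, |a| ≤ H * exp (-x) → |b| ≤ F * K * exp (-x) →
      |a - μ * b| ≤ (H + |μ| * (F * K)) * exp (-x) := fun a b ha hb => by
    refine (abs_sub _ _).trans ?_
    rw [abs_mul, add_mul, mul_assoc |μ|]
    gcongr
  exact ⟨key _ _ h1.1 (abs_halfCorr_le hx.le (fun y hy => (hF s hs' y hy).1) hk'),
    key _ _ h1.2 (abs_halfCorr_le hx.le (fun y hy => (hF s hs' y hy).2) hk')⟩

lemma expDecay_airyComb_deriv (hf : RightExpDecay f) (hh : RightExpDecay h)
    (hk : RightExpDecay k) (hα : 0 ≤ α) (hβ : 0 ≤ β) (s : ℝ) :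
    ExpDecay (airyComb (deriv f) (deriv h) k μ α β s) := by
  refine ⟨?_, (exists_bound_airyComb hf hh hk hα hβ s).imp fun M hM x hx =>
    (hM s (by simp) x hx).2⟩
  have : deriv (airyComb f h k μ α β s) = airyComb (deriv f) (deriv h) k μ α β s :=
    funext fun x => (hasDerivAt_airyComb hf hh hk s x).deriv
  rw [← this]
  exact (measurable_deriv _).aestronglyMeasurable

lemma decayFamily_airyComb (hf : RightExpDecay f) (hh : RightExpDecay h)
    (hk : RightExpDecay k) (hα : 0 ≤ α) (hβ : 0 ≤ β) (hαβ : α + β = 1) :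
    DecayFamily (airyComb f h k μ α β) (fun s x =>
      α * airyComb (deriv f) (deriv h) k μ α β s x + μ * β * k (β * s) * f (x + s)) where
  meas s := (continuous_iff_continuousAt.2 fun x =>
    (hasDerivAt_airyComb hf hh hk s x).continuousAt).aestronglyMeasurable
  meas' s := (((expDecay_airyComb_deriv hf hh hk hα hβ s).const_mul α).add
    ((hf.expDecay s).const_mul (μ * β * k (β * s)))).1
  hasDerivAt s x _ := hasDerivAt_airyComb_param hf hh hk hαβ s x
  bound s₀ := by
    obtain ⟨M, hM⟩ := exists_bound_airyComb (μ := μ) hf hh hk hα hβ s₀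
    obtain ⟨F, hF0, hF⟩ := hf.bound (s₀ - 1)
    obtain ⟨K, hK0, hK⟩ := hk.bound (β * (s₀ - 1))
    have hM0 : 0 ≤ M := nonneg_of_exp_bound fun x hx => (hM s₀ (by simp) x hx).1
    refine ⟨M + α * M + |μ| * β * K * F, fun s hs x hx => ?_⟩
    have hs' : s₀ - 1 ≤ s := by
      have := (abs_lt.1 (by simpa [Real.dist_eq] using hs : |s - s₀| < 1)).1
      linarith
    have h1 := hM s hs x hx
    have h2 := (hF s hs' x hx.le).1
    have h3 : |k (β * s)| ≤ K := by simpa using (hK (β * s) (by gcongr) 0 le_rfl).1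
    constructor
    · refine h1.1.trans ?_
      gcongr
      have : 0 ≤ α * M + |μ| * β * K * F := by positivity
      linarith
    · refine (abs_add_le _ _).trans ?_
      rw [abs_mul, abs_mul, abs_mul, abs_mul, abs_of_nonneg hα, abs_of_nonneg hβ]
      calc _ ≤ α * (M * exp (-x)) + |μ| * β * K * (F * exp (-x)) := by gcongr; exact h1.2
        _ ≤ M * exp (-x) + (α * (M * exp (-x)) + |μ| * β * K * (F * exp (-x))) :=
          le_add_of_nonneg_left (by positivity)
        _ = _ := by ring

end airyComb

namespace ExpDecayKernel

variable {k : ℝ → ℝ → ℝ} {f g : ℝ → ℝ}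

/-- Integration by parts in the second variable. -/
lemma integral_deriv_snd {ky : ℝ → ℝ → ℝ} {g' : ℝ → ℝ} (hk : ExpDecayKernel k)
    (hky : ExpDecayKernel ky) (hf : ExpDecay f) (hg : ExpDecay g) (hg' : ExpDecay g')
    (hdk : ∀ x > 0, ∀ y > 0, HasDerivAt (fun t => k x t) (ky x y) y)
    (hk0 : ∀ x > 0, ContinuousWithinAt (fun t => k x t) (Ici 0) 0)
    (hdg : ∀ x, HasDerivAt g (g' x) x) :
    (∫ p, ky p.1 p.2 * f p.1 * g p.2 ∂(Measure.prod ν ν)) +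
        ∫ p, k p.1 p.2 * f p.1 * g' p.2 ∂(Measure.prod ν ν) =
      -(g 0 * ∫ x in Ioi (0 : ℝ), k x 0 * f x) := by
  rw [← hk.swap.integral_deriv_fst hky.swap hg hg' hf (fun x hx y hy => hdk y hy x hx) hk0 hdg]
  congr 1
  · rw [← integral_prod_swap]
    simp only [Prod.fst_swap, Prod.snd_swap, mul_right_comm]
  · rw [← integral_prod_swap]
    simp only [Prod.fst_swap, Prod.snd_swap, mul_right_comm]

end ExpDecayKernel

lemma ExpDecay.mul_kernel {u w : ℝ → ℝ} (hu : ExpDecay u) (hw : ExpDecay w) :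
    ExpDecayKernel (fun x y => u x * w y) := by
  obtain ⟨hm, M, hM⟩ := hu
  obtain ⟨hn, N, hN⟩ := hw
  refine ⟨hm.comp_fst.mul hn.comp_snd, M * N, fun x hx y hy => ?_⟩
  have h1 := hM x hx
  rw [abs_mul]
  calc |u x| * |w y| ≤ (M * exp (-x)) * (N * exp (-y)) :=
        mul_le_mul h1 (hN y hy) (abs_nonneg _) ((abs_nonneg _).trans h1)
    _ = _ := by rw [sub_eq_add_neg, exp_add]; ring

lemma integral_rank_one (u w f g : ℝ → ℝ) :
    ∫ p, u p.1 * w p.2 * f p.1 * g p.2 ∂(Measure.prod ν ν) =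
      (∫ x in Ioi (0 : ℝ), u x * f x) * ∫ y in Ioi (0 : ℝ), w y * g y := by
  rw [← integral_prod_mul]
  congr! 2 with p
  ring

/-- `R` is the resolvent kernel of the shifted Airy kernels of `Ai`, together with the
Tracy–Widom differential identities. -/
structure AiryResolvent (Ai : ℝ → ℝ) (R : ℝ → ℝ → ℝ → ℝ) : Prop where
  decay : RightExpDecay Ai
  symm : ∀ σ x y, 0 ≤ x → 0 ≤ y → R σ x y = R σ y x
  contDiffOn : ContDiffOn ℝ 1 (fun q : ℝ × ℝ × ℝ => R q.2.2 q.1 q.2.1)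
    (Ici 0 ×ˢ Ici 0 ×ˢ univ)
  resolvent : ∀ σ x y, 0 ≤ x → 0 ≤ y →
    R σ x y = KAi Ai σ x y + ∫ t in Ioi (0 : ℝ), KAi Ai σ x t * R σ t y
  comm : ∀ σ x y, 0 ≤ x → 0 ≤ y →
    (∫ t in Ioi (0 : ℝ), Ai (x + t + σ) * R σ t y)
      = ∫ t in Ioi (0 : ℝ), R σ x t * Ai (t + y + σ)
  diag : ∀ σ x y, 0 ≤ x → 0 ≤ y →
    HasDerivAt (fun t => R σ (x + t) (y + t))
      (R σ x 0 * R σ 0 y - Qf Ai R σ x * Qf Ai R σ y) 0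
  param : ∀ σ x y, 0 ≤ x → 0 ≤ y →
    HasDerivAt (fun σ' => R σ' x y) (-(Qf Ai R σ x * Qf Ai R σ y)) σ
  bound : ∀ J : Set ℝ, IsCompact J → ∃ CJ > (0 : ℝ), ∀ σ ∈ J, ∀ x ≥ (0 : ℝ), ∀ y ≥ (0 : ℝ),
    |R σ x y| ≤ CJ * Real.exp (-x - y)
    ∧ |deriv (fun x' => R σ x' y) x| ≤ CJ * Real.exp (-x - y)
    ∧ |deriv (fun y' => R σ x y') y| ≤ CJ * Real.exp (-x - y)
    ∧ |deriv (fun σ' => R σ' x y) σ| ≤ CJ * Real.exp (-x - y)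

namespace AiryResolvent

variable {Ai : ℝ → ℝ} {R : ℝ → ℝ → ℝ → ℝ}

lemma contDiffOn_quadrant (hR : AiryResolvent Ai R) (σ : ℝ) :
    ContDiffOn ℝ 1 (fun p : ℝ × ℝ => R σ p.1 p.2) (Ici 0 ×ˢ Ici 0) :=
  hR.contDiffOn.comp (g := fun q : ℝ × ℝ × ℝ => R q.2.2 q.1 q.2.1)
    (f := fun p : ℝ × ℝ => (p.1, p.2, σ))
    (by fun_prop) (fun p hp => ⟨hp.1, hp.2, mem_univ _⟩)

lemma expDecayKernel (hR : AiryResolvent Ai R) (σ : ℝ) : ExpDecayKernel (R σ) := by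
  obtain ⟨M, -, hM⟩ := hR.bound {σ} isCompact_singleton
  refine ⟨?_, M, fun x hx y hy => (hM σ rfl x hx.le y hy.le).1⟩
  rw [prod_half]
  exact ((hR.contDiffOn_quadrant σ).continuousOn.mono
    (prod_mono Ioi_subset_Ici_self Ioi_subset_Ici_self)).aestronglyMeasurable
    (measurableSet_Ioi.prod measurableSet_Ioi)

lemma expDecay_boundary (hR : AiryResolvent Ai R) (σ : ℝ) : ExpDecay (fun x => R σ x 0) := by
  obtain ⟨M, -, hM⟩ := hR.bound {σ} isCompact_singleton
  refine ⟨?_, M, fun x hx => by simpa using (hM σ rfl x hx.le 0 le_rfl).1⟩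
  refine ContinuousOn.aestronglyMeasurable ?_ measurableSet_Ioi
  exact (hR.contDiffOn_quadrant σ).continuousOn.comp (f := fun x : ℝ => (x, (0 : ℝ)))
    (by fun_prop) (fun x (hx : 0 < x) => ⟨hx.le, le_refl (0 : ℝ)⟩)

lemma expDecay_Qf (hR : AiryResolvent Ai R) (σ : ℝ) : ExpDecay (Qf Ai R σ) :=
  (hR.decay.expDecay σ).add ((hR.expDecayKernel σ).apply (hR.decay.expDecay σ))

lemma decayKernelFamily (hR : AiryResolvent Ai R) :
    DecayKernelFamily R (fun σ x y => -(Qf Ai R σ x * Qf Ai R σ y)) where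
  meas s := (hR.expDecayKernel s).1
  meas' s := ((hR.expDecay_Qf s).mul_kernel (hR.expDecay_Qf s)).1.neg
  hasDerivAt s x hx y hy := hR.param s x y hx.le hy.le
  bound s₀ := by
    obtain ⟨M, -, hM⟩ := hR.bound _ (isCompact_closedBall s₀ 1)
    refine ⟨M, fun s hs x hx y hy => ?_⟩
    have h := hM s (Metric.ball_subset_closedBall hs) x hx.le y hy.le
    rw [(hR.param s x y hx.le hy.le).deriv] at h
    exact ⟨h.1, h.2.2.2⟩

lemma exists_partials (hR : AiryResolvent Ai R) (σ : ℝ) :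
    ∃ kx ky : ℝ → ℝ → ℝ, ExpDecayKernel kx ∧ ExpDecayKernel ky ∧
      (∀ x > 0, ∀ y > 0, HasDerivAt (fun t => R σ t y) (kx x y) x) ∧
      (∀ x > 0, ∀ y > 0, HasDerivAt (fun t => R σ x t) (ky x y) y) ∧
      ∀ x > 0, ∀ y > 0,
        kx x y + ky x y = R σ x 0 * R σ 0 y - Qf Ai R σ x * Qf Ai R σ y := by
  set k : ℝ × ℝ → ℝ := fun p => R σ p.1 p.2
  have hopen : IsOpen (Ioi (0 : ℝ) ×ˢ Ioi (0 : ℝ)) := isOpen_Ioi.prod isOpen_Ioi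
  have hC : ContDiffOn ℝ 1 k (Ioi 0 ×ˢ Ioi 0) :=
    (hR.contDiffOn_quadrant σ).mono (prod_mono Ioi_subset_Ici_self Ioi_subset_Ici_self)
  have hF : ∀ x > 0, ∀ y > 0, HasFDerivAt k (fderiv ℝ k (x, y)) (x, y) := fun x hx y hy =>
    ((hC.differentiableOn one_ne_zero).differentiableAt
      (hopen.mem_nhds (show ((x, y) : ℝ × ℝ) ∈ Ioi (0 : ℝ) ×ˢ Ioi (0 : ℝ) from ⟨hx, hy⟩))).hasFDerivAt
  have hx' : ∀ x > 0, ∀ y > 0,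
      HasDerivAt (fun t => R σ t y) (fderiv ℝ k (x, y) (1, 0)) x := fun x hx y hy =>
    HasFDerivAt.comp_hasDerivAt (l := k) (f := fun t => (t, y)) x (hF x hx y hy)
      ((hasDerivAt_id x).prodMk (hasDerivAt_const x y))
  have hy' : ∀ x > 0, ∀ y > 0,
      HasDerivAt (fun t => R σ x t) (fderiv ℝ k (x, y) (0, 1)) y := fun x hx y hy =>
    HasFDerivAt.comp_hasDerivAt (l := k) (f := fun t => (x, t)) y (hF x hx y hy)
      ((hasDerivAt_const y x).prodMk (hasDerivAt_id y))
  have hm : ∀ w : ℝ × ℝ, AEStronglyMeasurable (fun p : ℝ × ℝ => fderiv ℝ k (p.1, p.2) w)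
      (Measure.prod ν ν) := fun w => by
    rw [prod_half]
    exact ((hC.continuousOn_fderiv_of_isOpen hopen le_rfl).clm_apply
      continuousOn_const).aestronglyMeasurable (measurableSet_Ioi.prod measurableSet_Ioi)
  obtain ⟨M, -, hM⟩ := hR.bound {σ} isCompact_singleton
  refine ⟨fun x y => fderiv ℝ k (x, y) (1, 0), fun x y => fderiv ℝ k (x, y) (0, 1),
    ⟨hm _, M, fun x hx y hy => ?_⟩, ⟨hm _, M, fun x hx y hy => ?_⟩, hx', hy',
    fun x hx y hy => ?_⟩
  · beta_reduce
    rw [← (hx' x hx y hy).deriv]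
    exact (hM σ rfl x hx.le y hy.le).2.1
  · beta_reduce
    rw [← (hy' x hx y hy).deriv]
    exact (hM σ rfl x hx.le y hy.le).2.2.1
  · rw [← map_add]
    have hl : HasDerivAt (fun t : ℝ => (x + t, y + t)) ((1, 1) : ℝ × ℝ) 0 :=
      ((hasDerivAt_id (0 : ℝ)).const_add x).prodMk ((hasDerivAt_id (0 : ℝ)).const_add y)
    have hd := HasFDerivAt.comp_hasDerivAt (0 : ℝ) (l := k) (f := fun t : ℝ => (x + t, y + t))
      (by simpa using hF x hx y hy) hl
    simpa using hd.unique (hR.diag σ x y hx.le hy.le)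

/-- The infinitesimal translation of both arguments of `R_σ` along the diagonal, in weak form. -/
lemma integral_deriv_add (hR : AiryResolvent Ai R) (σ : ℝ) {f f' g g' : ℝ → ℝ}
    (hf : ExpDecay f) (hf' : ExpDecay f') (hg : ExpDecay g) (hg' : ExpDecay g')
    (hdf : ∀ x, HasDerivAt f (f' x) x) (hdg : ∀ x, HasDerivAt g (g' x) x) :
    (∫ p, R σ p.1 p.2 * f' p.1 * g p.2 ∂(Measure.prod ν ν)) +
        ∫ p, R σ p.1 p.2 * f p.1 * g' p.2 ∂(Measure.prod ν ν) =
      f 0 * g 0 - (f 0 + ∫ x in Ioi (0 : ℝ), R σ x 0 * f x) *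
          (g 0 + ∫ x in Ioi (0 : ℝ), R σ x 0 * g x) +
        (∫ x in Ioi (0 : ℝ), Qf Ai R σ x * f x) * ∫ x in Ioi (0 : ℝ), Qf Ai R σ x * g x := by
  obtain ⟨kx, ky, hkx, hky, hdx, hdy, hsum⟩ := hR.exists_partials σ
  have hk := hR.expDecayKernel σ
  have hcont := (hR.contDiffOn_quadrant σ).continuousOn
  have e1 := hk.integral_deriv_fst hkx hf hf' hg hdx
    (fun y hy => (hcont.comp (f := fun t : ℝ => (t, y)) (s := Ici 0) (by fun_prop)
      fun t ht => ⟨ht, le_of_lt hy⟩) 0 self_mem_Ici) hdf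
  have e2 := hk.integral_deriv_snd hky hf hg hg' hdy
    (fun x hx => (hcont.comp (f := fun t : ℝ => (x, t)) (s := Ici 0) (by fun_prop)
      fun t ht => ⟨le_of_lt hx, ht⟩) 0 self_mem_Ici) hdg
  have e3 : (∫ p, kx p.1 p.2 * f p.1 * g p.2 ∂(Measure.prod ν ν)) +
      ∫ p, ky p.1 p.2 * f p.1 * g p.2 ∂(Measure.prod ν ν) =
      (∫ x in Ioi (0 : ℝ), R σ x 0 * f x) * (∫ x in Ioi (0 : ℝ), R σ x 0 * g x) -
        (∫ x in Ioi (0 : ℝ), Qf Ai R σ x * f x) * ∫ x in Ioi (0 : ℝ), Qf Ai R σ x * g x := by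
    have hb := hR.expDecay_boundary σ
    have hq := hR.expDecay_Qf σ
    rw [← integral_rank_one, ← integral_rank_one,
      ← integral_add (hkx.integrable hf hg) (hky.integrable hf hg),
      ← integral_sub ((hb.mul_kernel hb).integrable hf hg) ((hq.mul_kernel hq).integrable hf hg)]
    refine integral_congr_ae ?_
    filter_upwards [ae_prod_pos] with p hp
    have := hsum p.1 hp.1 p.2 hp.2
    rw [hR.symm σ 0 p.2 le_rfl hp.2.le] at this
    linear_combination f p.1 * g p.2 * this
  have e4 : ∫ y in Ioi (0 : ℝ), R σ 0 y * g y = ∫ y in Ioi (0 : ℝ), R σ y 0 * g y :=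
    setIntegral_congr_fun measurableSet_Ioi fun y hy => by
      simp only [hR.symm σ 0 y le_rfl (le_of_lt hy)]
  rw [e4] at e1
  linear_combination e1 + e2 - e3

lemma airy_apply_boundary (hR : AiryResolvent Ai R) (σ : ℝ) {x : ℝ} (hx : 0 ≤ x) :
    ∫ t in Ioi (0 : ℝ), Ai (x + t + σ) * R σ t 0 = Qf Ai R σ x - Ai (x + σ) := by
  rw [hR.comm σ x 0 hx le_rfl]
  simp [Qf]

lemma airy_apply_Qf (hR : AiryResolvent Ai R) (σ : ℝ) {x : ℝ} (hx : 0 ≤ x) :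
    ∫ t in Ioi (0 : ℝ), Ai (x + t + σ) * Qf Ai R σ t = R σ x 0 := by
  have hax : ExpDecay (fun t => Ai (x + t + σ)) := by
    simpa [add_comm, add_left_comm, add_assoc] using hR.decay.expDecay (x + σ)
  have h := (hR.decay.expDecayKernel σ).integral_mul_apply (hR.expDecay_boundary σ) hax
  have e1 : ∫ t in Ioi (0 : ℝ), KAi Ai σ x t * R σ t 0 =
      ∫ t in Ioi (0 : ℝ), (Qf Ai R σ t - Ai (t + σ)) * Ai (x + t + σ) := by
    calc _ = ∫ t in Ioi (0 : ℝ), R σ t 0 * ∫ y in Ioi (0 : ℝ), Ai (t + y + σ) * Ai (x + y + σ) := by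
          simp only [KAi, mul_comm]
      _ = _ := h
      _ = _ := setIntegral_congr_fun measurableSet_Ioi fun y hy => by
          simp only [add_comm _ y, hR.airy_apply_boundary σ (le_of_lt hy)]
  rw [hR.resolvent σ x 0 hx le_rfl, e1, KAi, ← integral_add]
  · congr! 2 with t
    rw [zero_add]; ring
  · simpa using (hax.mul (hR.decay.expDecay σ)).integrable
  · exact (((hR.expDecay_Qf σ).sub (hR.decay.expDecay σ)).mul hax).integrable

lemma integral_airy_right (hR : AiryResolvent Ai R) (σ : ℝ) {f : ℝ → ℝ} (hf : ExpDecay f) :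
    ∫ p, R σ p.1 p.2 * f p.1 * Ai (p.2 + σ) ∂(Measure.prod ν ν) =
      (∫ x in Ioi (0 : ℝ), Qf Ai R σ x * f x) - ∫ x in Ioi (0 : ℝ), Ai (x + σ) * f x := by
  have ha := hR.decay.expDecay σ
  rw [← (hR.expDecayKernel σ).integral_integral hf ha,
    (hR.expDecayKernel σ).integral_integral_eq_left hf ha,
    ← integral_sub ((hR.expDecay_Qf σ).mul hf).integrable (ha.mul hf).integrable]
  congr! 2 with x
  rw [Qf]; ring

lemma integral_airy_left (hR : AiryResolvent Ai R) (σ : ℝ) {g : ℝ → ℝ} (hg : ExpDecay g) :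
    ∫ p, R σ p.1 p.2 * Ai (p.1 + σ) * g p.2 ∂(Measure.prod ν ν) =
      (∫ x in Ioi (0 : ℝ), Qf Ai R σ x * g x) - ∫ x in Ioi (0 : ℝ), Ai (x + σ) * g x := by
  rw [← hR.integral_airy_right σ hg, ← integral_prod_swap]
  refine integral_congr_ae ?_
  filter_upwards [ae_prod_pos] with p hp
  simp only [Prod.fst_swap, Prod.snd_swap, hR.symm σ p.2 p.1 hp.2.le hp.1.le]
  ring

/-- The function `p̂₁` expressed through `Q_σ`. -/
lemma boundary_value_eq (hR : AiryResolvent Ai R) (σ : ℝ) {μ : ℝ} (hμ : μ ≠ 0) {B Bt : ℝ → ℝ}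
    (hB : ExpDecay B) (hBt : ExpDecay Bt) :
    (Bt 0 - μ⁻¹ * ∫ y in Ioi (0 : ℝ), Ai (0 + y + σ) * B y) +
        ∫ x in Ioi (0 : ℝ), R σ x 0 * (Bt x - μ⁻¹ * ∫ y in Ioi (0 : ℝ), Ai (x + y + σ) * B y) =
      Bt 0 - μ⁻¹ * ∫ x in Ioi (0 : ℝ),
        Qf Ai R σ x * (B x - μ * ∫ y in Ioi (0 : ℝ), Ai (x + y + σ) * Bt y) := by
  have hb := hR.expDecay_boundary σ
  have hq := hR.expDecay_Qf σ
  have ha := hR.decay.expDecay σ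
  have hA := hR.decay.expDecayKernel σ
  have e1 := hA.integral_mul_apply hb hB
  have e2 := hA.integral_mul_apply hq hBt
  have e3 : ∫ y in Ioi (0 : ℝ), (∫ x in Ioi (0 : ℝ), Ai (x + y + σ) * R σ x 0) * B y =
      (∫ y in Ioi (0 : ℝ), Qf Ai R σ y * B y) - ∫ y in Ioi (0 : ℝ), Ai (y + σ) * B y := by
    rw [← integral_sub (hq.mul hB).integrable (ha.mul hB).integrable]
    refine setIntegral_congr_fun measurableSet_Ioi fun y hy => ?_
    simp only [add_comm _ y, hR.airy_apply_boundary σ (le_of_lt hy)]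
    ring
  have e4 : ∫ y in Ioi (0 : ℝ), (∫ x in Ioi (0 : ℝ), Ai (x + y + σ) * Qf Ai R σ x) * Bt y =
      ∫ y in Ioi (0 : ℝ), R σ y 0 * Bt y := by
    refine setIntegral_congr_fun measurableSet_Ioi fun y hy => ?_
    simp only [add_comm _ y, hR.airy_apply_Qf σ (le_of_lt hy)]
  have e5 : ∫ x in Ioi (0 : ℝ), R σ x 0 *
      (Bt x - μ⁻¹ * ∫ y in Ioi (0 : ℝ), Ai (x + y + σ) * B y) =
      (∫ x in Ioi (0 : ℝ), R σ x 0 * Bt x) - μ⁻¹ *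
        ∫ x in Ioi (0 : ℝ), R σ x 0 * ∫ y in Ioi (0 : ℝ), Ai (x + y + σ) * B y := by
    rw [← integral_const_mul, ← integral_sub (hb.mul hBt).integrable
      ((hb.mul (hA.apply hB)).const_mul _).integrable]
    congr! 2 with x; ring
  have e6 : ∫ x in Ioi (0 : ℝ), Qf Ai R σ x *
      (B x - μ * ∫ y in Ioi (0 : ℝ), Ai (x + y + σ) * Bt y) =
      (∫ x in Ioi (0 : ℝ), Qf Ai R σ x * B x) - μ *
        ∫ x in Ioi (0 : ℝ), Qf Ai R σ x * ∫ y in Ioi (0 : ℝ), Ai (x + y + σ) * Bt y := by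
    rw [← integral_const_mul, ← integral_sub (hq.mul hB).integrable
      ((hq.mul (hA.apply hBt)).const_mul _).integrable]
    congr! 2 with x; ring
  rw [e5, e6, e1, e2, e3, e4]
  simp only [zero_add]
  field_simp
  ring

/-- Derivative of the part of the tacnode kernel depending on `σ`, in terms of the shifts. -/
lemma hasDerivAt_tacnode (hR : AiryResolvent Ai R) {h₁ h₂ k₁ k₂ : ℝ → ℝ} {μ α β : ℝ}
    (hh₁ : RightExpDecay h₁) (hh₂ : RightExpDecay h₂) (hk₁ : RightExpDecay k₁)
    (hk₂ : RightExpDecay k₂) (hα : 0 ≤ α) (hβ : 0 ≤ β) (hαβ : α + β = 1) (s : ℝ) :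
    HasDerivAt (fun s =>
        μ ^ 2 * (∫ x in Ioi (0 : ℝ), k₁ (x + β * s) * k₂ (x + β * s)) +
        (∫ x in Ioi (0 : ℝ), airyComb Ai h₁ k₁ μ α β s x * airyComb Ai h₂ k₂ μ α β s x) +
        ∫ x in Ioi (0 : ℝ), ∫ y in Ioi (0 : ℝ),
          R s x y * airyComb Ai h₁ k₁ μ α β s x * airyComb Ai h₂ k₂ μ α β s y)
      (-β * (μ * k₁ (β * s) - ∫ x in Ioi (0 : ℝ), Qf Ai R s x * airyComb Ai h₁ k₁ μ α β s x) *
          (μ * k₂ (β * s) - ∫ x in Ioi (0 : ℝ), Qf Ai R s x * airyComb Ai h₂ k₂ μ α β s x) -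
        α * (airyComb Ai h₁ k₁ μ α β s 0 +
            ∫ x in Ioi (0 : ℝ), R s x 0 * airyComb Ai h₁ k₁ μ α β s x) *
          (airyComb Ai h₂ k₂ μ α β s 0 +
            ∫ x in Ioi (0 : ℝ), R s x 0 * airyComb Ai h₂ k₂ μ α β s x)) s := by
  have hAi := hR.decay
  have F₁ := decayFamily_airyComb (μ := μ) hAi hh₁ hk₁ hα hβ hαβ
  have F₂ := decayFamily_airyComb (μ := μ) hAi hh₂ hk₂ hα hβ hαβ
  have d1 := (hk₁.family 0 β).hasDerivAt_integral_mul (hk₂.family 0 β) s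
  have d2 := F₁.hasDerivAt_integral_mul F₂ s
  have d3 := hR.decayKernelFamily.hasDerivAt_integral F₁ F₂ s
  simp only [zero_add] at d1
  refine (((d1.const_mul (μ ^ 2)).add d2).add d3).congr_deriv ?_
  have hK := hR.expDecayKernel s
  have hQ := hR.expDecay_Qf s
  have ha := hAi.expDecay s
  set A₁ := airyComb Ai h₁ k₁ μ α β s
  set A₂ := airyComb Ai h₂ k₂ μ α β s
  set D₁ := airyComb (deriv Ai) (deriv h₁) k₁ μ α β s
  set D₂ := airyComb (deriv Ai) (deriv h₂) k₂ μ α β s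
  have gA₁ : ExpDecay A₁ := F₁.expDecay s
  have gA₂ : ExpDecay A₂ := F₂.expDecay s
  have gD₁ : ExpDecay D₁ := expDecay_airyComb_deriv hAi hh₁ hk₁ hα hβ s
  have gD₂ : ExpDecay D₂ := expDecay_airyComb_deriv hAi hh₂ hk₂ hα hβ s
  have dA₁ : ∀ x, HasDerivAt A₁ (D₁ x) x := hasDerivAt_airyComb hAi hh₁ hk₁ s
  have dA₂ : ∀ x, HasDerivAt A₂ (D₂ x) x := hasDerivAt_airyComb hAi hh₂ hk₂ s
  have E1 : ∫ x in Ioi (0 : ℝ), (β * deriv k₁ (x + β * s) * k₂ (x + β * s) +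
      k₁ (x + β * s) * (β * deriv k₂ (x + β * s))) = -β * (k₁ (β * s) * k₂ (β * s)) := by
    rw [neg_mul, ← mul_neg, ← hk₁.integral_deriv_mul_add hk₂, ← integral_const_mul]
    congr! 2 with x; ring
  have E2 := gA₁.integral_deriv_mul_add gD₁ gA₂ gD₂ dA₁ dA₂
  have E3 : ∫ x in Ioi (0 : ℝ), ((α * D₁ x + μ * β * k₁ (β * s) * Ai (x + s)) * A₂ x +
      A₁ x * (α * D₂ x + μ * β * k₂ (β * s) * Ai (x + s))) =
      -α * (A₁ 0 * A₂ 0) + μ * β * k₁ (β * s) * (∫ x in Ioi (0 : ℝ), Ai (x + s) * A₂ x) +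
        μ * β * k₂ (β * s) * (∫ x in Ioi (0 : ℝ), Ai (x + s) * A₁ x) := by
    have i1 := (((gD₁.mul gA₂).add (gA₁.mul gD₂)).const_mul α)
    have i2 := (ha.mul gA₂).const_mul (μ * β * k₁ (β * s))
    have i3 := (ha.mul gA₁).const_mul (μ * β * k₂ (β * s))
    rw [neg_mul, ← mul_neg, ← E2, ← integral_const_mul, ← integral_const_mul,
      ← integral_const_mul, ← integral_add i1.integrable i2.integrable,
      ← integral_add (i1.add i2).integrable i3.integrable]
    congr! 2 with x; ring
  have E4 := hR.integral_deriv_add s gA₁ gD₁ gA₂ gD₂ dA₁ dA₂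
  have E5 : ∫ p, -(Qf Ai R s p.1 * Qf Ai R s p.2) * A₁ p.1 * A₂ p.2 ∂(Measure.prod ν ν) =
      -((∫ x in Ioi (0 : ℝ), Qf Ai R s x * A₁ x) * ∫ x in Ioi (0 : ℝ), Qf Ai R s x * A₂ x) := by
    rw [← integral_rank_one, ← integral_neg]
    simp only [neg_mul]
  have E6 : ∫ p, R s p.1 p.2 * (α * D₁ p.1 + μ * β * k₁ (β * s) * Ai (p.1 + s)) * A₂ p.2
        ∂(Measure.prod ν ν) =
      α * (∫ p, R s p.1 p.2 * D₁ p.1 * A₂ p.2 ∂(Measure.prod ν ν)) + μ * β * k₁ (β * s) *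
        ((∫ x in Ioi (0 : ℝ), Qf Ai R s x * A₂ x) - ∫ x in Ioi (0 : ℝ), Ai (x + s) * A₂ x) := by
    rw [← hR.integral_airy_left s gA₂, ← integral_const_mul, ← integral_const_mul,
      ← integral_add ((hK.integrable gD₁ gA₂).const_mul _) ((hK.integrable ha gA₂).const_mul _)]
    congr! 2 with p; ring
  have E7 : ∫ p, R s p.1 p.2 * A₁ p.1 * (α * D₂ p.2 + μ * β * k₂ (β * s) * Ai (p.2 + s))
        ∂(Measure.prod ν ν) =
      α * (∫ p, R s p.1 p.2 * A₁ p.1 * D₂ p.2 ∂(Measure.prod ν ν)) + μ * β * k₂ (β * s) *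
        ((∫ x in Ioi (0 : ℝ), Qf Ai R s x * A₁ x) - ∫ x in Ioi (0 : ℝ), Ai (x + s) * A₁ x) := by
    rw [← hR.integral_airy_right s gA₁, ← integral_const_mul, ← integral_const_mul,
      ← integral_add ((hK.integrable gA₁ gD₂).const_mul _) ((hK.integrable gA₁ ha).const_mul _)]
    congr! 2 with p; ring
  rw [E1, E3, E5, E6, E7]
  obtain rfl : α = 1 - β := by linarith
  linear_combination (1 - β) * E4

end AiryResolvent

lemma exists_superexp_bound {f : ℝ → ℝ} (hf : ContDiff ℝ 1 f)
    (hdecay : ∀ a > (0 : ℝ), ∃ Ca > (0 : ℝ), ∀ x ≥ (0 : ℝ),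
      |f x| + |deriv f x| ≤ Ca * exp (-a * x)) (a T : ℝ) :
    ∃ M, ∀ x ≥ T, |f x| + |deriv f x| ≤ M * exp (-a * x) := by
  obtain ⟨N, hN0, hN⟩ := hdecay (max a 1) (by positivity)
  have hc : Continuous fun x => (|f x| + |deriv f x|) * exp (a * x) := by
    have := hf.continuous
    have := hf.continuous_deriv le_rfl
    fun_prop
  obtain ⟨B, hB⟩ := (isCompact_Icc (a := T) (b := 0)).exists_bound_of_continuousOn hc.continuousOn
  refine ⟨max N B, fun x hx => ?_⟩
  rcases le_total 0 x with h0 | h0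
  · refine (hN x h0).trans ?_
    gcongr
    · exact le_max_left _ _
    · exact le_max_left _ _
  · have h := (le_abs_self _).trans (hB x ⟨hx, h0⟩)
    calc |f x| + |deriv f x| = (|f x| + |deriv f x|) * exp (a * x) * exp (-a * x) := by
          rw [mul_assoc, ← exp_add]; simp
      _ ≤ max N B * exp (-a * x) := by gcongr; exact h.trans (le_max_right _ _)

lemma rightExpDecay_exp_mul_comp {f : ℝ → ℝ} (hf : ContDiff ℝ 1 f)
    (hdecay : ∀ a > (0 : ℝ), ∃ Ca > (0 : ℝ), ∀ x ≥ (0 : ℝ),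
      |f x| + |deriv f x| ≤ Ca * exp (-a * x)) {r : ℝ} (hr : 0 < r) (p q w : ℝ) :
    RightExpDecay (fun t => exp (p * t + q) * f (r * t + w)) := by
  refine ⟨by fun_prop, fun T => ?_⟩
  obtain ⟨M, hM⟩ := exists_superexp_bound hf hdecay ((p + 1) / r) (r * T + w)
  refine ⟨(1 + |p| + r) * (M * exp (q - (p + 1) / r * w)), fun t ht => ?_⟩
  have h := hM (r * t + w) (by gcongr)
  have hd : HasDerivAt (fun t => exp (p * t + q) * f (r * t + w))
      (exp (p * t + q) * p * f (r * t + w) + exp (p * t + q) * (deriv f (r * t + w) * r)) t := by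
    have h1 : HasDerivAt (fun t => p * t + q) p t := by
      simpa using ((hasDerivAt_id t).const_mul p).add_const q
    have h2 : HasDerivAt (fun t => r * t + w) r t := by
      simpa using ((hasDerivAt_id t).const_mul r).add_const w
    exact h1.exp.mul ((hf.differentiable one_ne_zero _).hasDerivAt.comp t h2)
  have key : exp (p * t + q) * (|f (r * t + w)| + |deriv f (r * t + w)|) ≤
      M * exp (q - (p + 1) / r * w) * exp (-t) := by
    calc _ ≤ exp (p * t + q) * (M * exp (-((p + 1) / r) * (r * t + w))) := by gcongr
      _ = M * (exp (p * t + q) * exp (-((p + 1) / r) * (r * t + w))) := by ring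
      _ = _ := by
        rw [mul_assoc, ← exp_add, ← exp_add]
        congr 2
        field_simp
        ring
  set E := exp (p * t + q)
  set K := M * exp (q - (p + 1) / r * w) * exp (-t)
  have hE : 0 ≤ E := (exp_pos _).le
  have h1 : E * |f (r * t + w)| ≤ K :=
    le_trans (by gcongr; exact le_add_of_nonneg_right (abs_nonneg _)) key
  have h2 : E * |deriv f (r * t + w)| ≤ K :=
    le_trans (by gcongr; exact le_add_of_nonneg_left (abs_nonneg _)) key
  have hK : 0 ≤ K := le_trans (by positivity) h1
  rw [mul_assoc]
  change _ ≤ (1 + |p| + r) * K ∧ _ ≤ (1 + |p| + r) * K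
  rw [hd.deriv]
  constructor
  · rw [abs_mul, abs_of_nonneg hE]
    nlinarith [abs_nonneg p]
  · refine (abs_add_le _ _).trans ?_
    rw [abs_mul, abs_mul, abs_mul, abs_mul, abs_of_nonneg hE, abs_of_pos hr]
    nlinarith [mul_le_mul_of_nonneg_left h1 (abs_nonneg p), mul_le_mul_of_nonneg_left h2 hr.le]

section parameters

variable {lam : ℝ}

lemma Cc_pos (hlam : 0 < lam) : 0 < Cc lam := by
  unfold Cc; positivity

/-- `α = s/(1+s)`, with `s = λ^{-1/2}`. -/
def shiftA (lam : ℝ) : ℝ := lam ^ (-(1 : ℝ) / 2) / (1 + lam ^ (-(1 : ℝ) / 2))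

/-- `β = 1/(1+s)`, with `s = λ^{-1/2}`. -/
def shiftB (lam : ℝ) : ℝ := 1 / (1 + lam ^ (-(1 : ℝ) / 2))

lemma shiftA_nonneg (hlam : 0 < lam) : 0 ≤ shiftA lam := by unfold shiftA; positivity

lemma shiftB_nonneg (hlam : 0 < lam) : 0 ≤ shiftB lam := by unfold shiftB; positivity

lemma shiftA_add_shiftB (hlam : 0 < lam) : shiftA lam + shiftB lam = 1 := by
  have : 0 < 1 + lam ^ (-(1 : ℝ) / 2) := by positivity
  unfold shiftA shiftB
  field_simp
  ring

lemma Cc_pow_three (hlam : 0 < lam) : Cc lam ^ 3 = 1 + lam ^ (-(1 : ℝ) / 2) := by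
  rw [Cc, ← rpow_natCast, ← rpow_mul (by positivity)]
  norm_num

lemma Cc_mul_shiftB (hlam : 0 < lam) : Cc lam * shiftB lam = (Cc lam ^ 2)⁻¹ := by
  have := (Cc_pos hlam).ne'
  rw [shiftB, ← Cc_pow_three hlam]
  field_simp

lemma Cc_mul_shiftA (hlam : 0 < lam) :
    Cc lam * shiftA lam = lam ^ (-(1 : ℝ) / 2) * (Cc lam ^ 2)⁻¹ := by
  rw [← Cc_mul_shiftB hlam, shiftA, shiftB]
  ring

lemma sqrt_mul_rpow_neg_half (hlam : 0 < lam) : sqrt lam * lam ^ (-(1 : ℝ) / 2) = 1 := by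
  rw [sqrt_eq_rpow, ← rpow_add hlam]
  norm_num

lemma Sig_eq (hlam : 0 < lam) (σ : ℝ) : Sig lam σ = Cc lam * (shiftA lam * σ) := by
  have h : (1 + lam ^ (-(1 : ℝ) / 2)) ^ (-(2 : ℝ) / 3) = (Cc lam ^ 2)⁻¹ := by
    rw [Cc, ← rpow_natCast, ← rpow_mul (by positivity), ← rpow_neg (by positivity)]
    norm_num
  rw [Sig, h, ← mul_assoc, Cc_mul_shiftA hlam]

lemma sqrt_mul_Sig (hlam : 0 < lam) (σ : ℝ) :
    sqrt lam * Sig lam σ = Cc lam * (shiftB lam * σ) := by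
  rw [Sig_eq hlam, ← mul_assoc (Cc lam), Cc_mul_shiftA hlam, ← mul_assoc (Cc lam),
    Cc_mul_shiftB hlam]
  linear_combination (Cc lam ^ 2)⁻¹ * σ * sqrt_mul_rpow_neg_half hlam

/-- The profile of which `b_{τ,z}` is a translate. -/
def bbProfile (Ai : ℝ → ℝ) (lam τ z t : ℝ) : ℝ :=
  exp (-τ * Cc lam * t + (-τ * (z + τ ^ 2) + τ ^ 3 / 3)) * Ai (Cc lam * t + (z + τ ^ 2))

/-- The profile of which `b̃_{τ,z}` is a translate. -/
def btProfile (Ai : ℝ → ℝ) (lam τ z t : ℝ) : ℝ :=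
  exp (-sqrt lam * τ * Cc lam * t +
      (-sqrt lam * τ * (-z + sqrt lam * τ ^ 2) + lam * τ ^ 3 / 3)) *
    Ai (lam ^ ((1 : ℝ) / 6) * Cc lam * t + lam ^ ((1 : ℝ) / 6) * (-z + sqrt lam * τ ^ 2))

variable (Ai : ℝ → ℝ)

lemma bb_eq (hlam : 0 < lam) (σ τ z x : ℝ) :
    bb Ai lam σ τ z x = bbProfile Ai lam τ z (x + shiftA lam * σ) := by
  rw [bb, bbProfile, Sig_eq hlam]
  congr 2 <;> ring

lemma bt_eq (hlam : 0 < lam) (σ τ z x : ℝ) :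
    bt Ai lam σ τ z x = btProfile Ai lam τ z (x + shiftB lam * σ) := by
  rw [bt, btProfile, mul_add (sqrt lam) (Sig lam σ), sqrt_mul_Sig hlam]
  congr 2 <;> ring

lemma AA_eq (hlam : 0 < lam) (σ τ z x : ℝ) :
    AA Ai lam σ τ z x = airyComb Ai (bbProfile Ai lam τ z) (btProfile Ai lam τ z)
      (lam ^ ((1 : ℝ) / 6)) (shiftA lam) (shiftB lam) σ x := by
  rw [AA, airyComb, bb_eq Ai hlam, halfCorr]
  congr! 5 with y
  · rw [add_comm x, add_assoc]
  · exact bt_eq Ai hlam ..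

end parameters

lemma p1hat_eq {Ai : ℝ → ℝ} {R : ℝ → ℝ → ℝ → ℝ} (hR : AiryResolvent Ai R) {lam : ℝ}
    (hlam : 0 < lam) {z σ τ : ℝ} (hB : ExpDecay (bb Ai lam σ τ z))
    (hBt : ExpDecay (bt Ai lam σ τ z)) :
    lam ^ ((1 : ℝ) / 6) * p1hat Ai lam R z σ τ = lam ^ ((1 : ℝ) / 6) * bt Ai lam σ τ z 0 -
      ∫ x in Ioi (0 : ℝ), Qf Ai R σ x * AA Ai lam σ τ z x := by
  have hμ : lam ^ ((1 : ℝ) / 6) ≠ 0 := by positivity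
  have hinv : lam ^ (-(1 : ℝ) / 6) = (lam ^ ((1 : ℝ) / 6))⁻¹ := by
    rw [← rpow_neg hlam.le]; norm_num
  have h := hR.boundary_value_eq σ hμ hB hBt
  simp only [p1hat, AAt, hinv, h, AA]
  field_simp

/-- **Rank-2 formula for the `σ`-derivative of the multi-time extended Ferrari–Vető tacnode
kernel**: `∂ℒ/∂σ = -C⁻²(λ^{1/3} p̂₁(u;σ,τ₁) p̂₁(v;σ,-τ₂) + λ^{-1/2} p̂₂(u;σ,τ₁) p̂₂(v;σ,-τ₂))`. -/
theorem extended_tacnode_kernel_sigma_derivative_rank_two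
    (Ai : ℝ → ℝ) (hAi : ContDiff ℝ 1 Ai)
    (hAidecay : ∀ a > (0 : ℝ), ∃ Ca > (0 : ℝ), ∀ x ≥ (0 : ℝ),
      |Ai x| + |deriv Ai x| ≤ Ca * Real.exp (-a * x))
    (lam : ℝ) (hlam : 0 < lam)
    (R : ℝ → ℝ → ℝ → ℝ)
    (hRsym : ∀ σ x y, 0 ≤ x → 0 ≤ y → R σ x y = R σ y x)
    (hRC1 : ContDiffOn ℝ 1 (fun q : ℝ × ℝ × ℝ => R q.2.2 q.1 q.2.1)
      (Ici 0 ×ˢ Ici 0 ×ˢ univ))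
    (hRres : ∀ σ x y, 0 ≤ x → 0 ≤ y →
      R σ x y = KAi Ai σ x y + ∫ t in Ioi (0 : ℝ), KAi Ai σ x t * R σ t y)
    (hRcomm : ∀ σ x y, 0 ≤ x → 0 ≤ y →
      (∫ t in Ioi (0 : ℝ), Ai (x + t + σ) * R σ t y)
        = ∫ t in Ioi (0 : ℝ), R σ x t * Ai (t + y + σ))
    (hTWxy : ∀ σ x y, 0 ≤ x → 0 ≤ y →
      HasDerivAt (fun t => R σ (x + t) (y + t))
        (R σ x 0 * R σ 0 y - Qf Ai R σ x * Qf Ai R σ y) 0)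
    (hTWσ : ∀ σ x y, 0 ≤ x → 0 ≤ y →
      HasDerivAt (fun σ' => R σ' x y) (-(Qf Ai R σ x * Qf Ai R σ y)) σ)
    (hRbd : ∀ J : Set ℝ, IsCompact J → ∃ CJ > (0 : ℝ), ∀ σ ∈ J, ∀ x ≥ (0 : ℝ), ∀ y ≥ (0 : ℝ),
      |R σ x y| ≤ CJ * Real.exp (-x - y)
      ∧ |deriv (fun x' => R σ x' y) x| ≤ CJ * Real.exp (-x - y)
      ∧ |deriv (fun y' => R σ x y') y| ≤ CJ * Real.exp (-x - y)
      ∧ |deriv (fun σ' => R σ' x y) σ| ≤ CJ * Real.exp (-x - y)) :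
    ∀ u v τ₁ τ₂ σ : ℝ,
      HasDerivAt (fun σ' => LtacExt Ai lam R u v σ' τ₁ τ₂)
        (-((Cc lam) ^ 2)⁻¹ *
          (lam ^ ((1 : ℝ) / 3) * p1hat Ai lam R u σ τ₁ * p1hat Ai lam R v σ (-τ₂)
          + lam ^ (-(1 : ℝ) / 2) * p2hat Ai lam R u σ τ₁ * p2hat Ai lam R v σ (-τ₂))) σ := by
  intro u v τ₁ τ₂ σ
  have hC := Cc_pos hlam
  have hAi' : RightExpDecay Ai := by
    simpa using rightExpDecay_exp_mul_comp hAi hAidecay one_pos 0 0 0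
  have hR : AiryResolvent Ai R := ⟨hAi', hRsym, hRC1, hRres, hRcomm, hTWxy, hTWσ, hRbd⟩
  have hb : ∀ τ z, RightExpDecay (bbProfile Ai lam τ z) := fun τ z =>
    rightExpDecay_exp_mul_comp hAi hAidecay hC _ _ _
  have hbt : ∀ τ z, RightExpDecay (btProfile Ai lam τ z) := fun τ z =>
    rightExpDecay_exp_mul_comp hAi hAidecay (by positivity) _ _ _
  have hp1 : ∀ τ z, lam ^ ((1 : ℝ) / 6) * p1hat Ai lam R z σ τ =
      lam ^ ((1 : ℝ) / 6) * bt Ai lam σ τ z 0 -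
        ∫ x in Ioi (0 : ℝ), Qf Ai R σ x * AA Ai lam σ τ z x := fun τ z => by
    refine p1hat_eq hR hlam ?_ ?_
    · rw [funext (bb_eq Ai hlam σ τ z)]; exact (hb τ z).expDecay _
    · rw [funext (bt_eq Ai hlam σ τ z)]; exact (hbt τ z).expDecay _
  have hcube : lam ^ ((1 : ℝ) / 3) = (lam ^ ((1 : ℝ) / 6)) ^ 2 := by
    rw [← rpow_natCast, ← rpow_mul hlam.le]; norm_num
  have h := hR.hasDerivAt_tacnode (μ := lam ^ ((1 : ℝ) / 6)) (hb τ₁ u) (hb (-τ₂) v)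
    (hbt τ₁ u) (hbt (-τ₂) v) (shiftA_nonneg hlam) (shiftB_nonneg hlam)
    (shiftA_add_shiftB hlam) σ
  have hbt0 : ∀ τ z, btProfile Ai lam τ z (shiftB lam * σ) = bt Ai lam σ τ z 0 := fun τ z => by
    rw [bt_eq Ai hlam, zero_add]
  simp only [← AA_eq Ai hlam, ← bt_eq Ai hlam, hbt0, ← hp1] at h
  have h' := (h.const_mul (Cc lam)).const_add
    (-(if τ₁ < τ₂ then (1 : ℝ) else 0) * (4 * π * (τ₂ - τ₁)) ^ (-(1 : ℝ) / 2) *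
      Real.exp (-(v - u) ^ 2 / (4 * (τ₂ - τ₁))))
  refine (h'.congr_deriv ?_).congr_of_eventuallyEq (Filter.Eventually.of_forall fun σ' => ?_)
  · simp only [p2hat]
    rw [hcube]
    linear_combination -((lam ^ ((1 : ℝ) / 6)) ^ 2 * p1hat Ai lam R u σ τ₁ *
      p1hat Ai lam R v σ (-τ₂) * Cc_mul_shiftB hlam) -
      (AA Ai lam σ τ₁ u 0 + ∫ x in Ioi (0 : ℝ), R σ x 0 * AA Ai lam σ τ₁ u x) *
      (AA Ai lam σ (-τ₂) v 0 + ∫ x in Ioi (0 : ℝ), R σ x 0 * AA Ai lam σ (-τ₂) v x) *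
      Cc_mul_shiftA hlam
  · simp only [LtacExt, hcube]
    ring

end
end

section
/- With the notations of the context, define for z ∈ ℝ: p₁(z) = b̃_z(0) − D^{−1}·∫₀^∞ Q(x)·𝒜_z(x) dx and p₂(z) = 𝒜_z(0) + ∫₀^∞ R₀(x)·𝒜_z(x) dx. Then p₁ and p₂ are twice differentiable and satisfy, for all z ∈ ℝ: r₁^{−2}·p₁''(z) = 2τ·p₁'(z) + C²·D^{−1}·q·p₂'(z) + (C·q² − z + 2s₁/r₁ − r₁²·τ²)·p₁(z) − C·D^{−1}·q̇·p₂(z). -/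
open Real MeasureTheory Set Filter Topology

/-- A continuous function on `ℝ` decaying at `+∞` faster than every exponential. -/
structure RapidDecay (f : ℝ → ℝ) : Prop where
  continuous : Continuous f
  bound : ∀ a M : ℝ, ∃ K, ∀ t ≥ M, |f t| ≤ K * exp (-a * t)

/-- A continuous function on `[0, ∞)` of at most exponential growth. -/
structure ExpGrowth (w : ℝ → ℝ) : Prop where
  continuousOn : ContinuousOn w (Ici 0)
  bound : ∃ K a : ℝ, ∀ x ≥ 0, |w x| ≤ K * exp (a * x)

namespace RapidDecay

variable {f g : ℝ → ℝ}

lemma of_nonneg (hf : Continuous f)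
    (h : ∀ a > 0, ∃ K, ∀ t ≥ 0, |f t| ≤ K * exp (-a * t)) : RapidDecay f := by
  refine ⟨hf, fun a M => ?_⟩
  obtain ⟨K, hK⟩ := h (max a 1) (lt_max_of_lt_right one_pos)
  obtain ⟨B, hB⟩ := (isCompact_Icc (a := M) (b := 0)).exists_bound_of_continuousOn
    (f := fun t => f t * exp (a * t)) (by fun_prop)
  have hK0 : 0 ≤ K := by simpa using (abs_nonneg _).trans (hK 0 le_rfl)
  refine ⟨max K B, fun t ht => ?_⟩
  rcases le_total 0 t with h0 | h0
  · refine (hK t h0).trans ?_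
    gcongr
    · exact le_max_left _ _
    · nlinarith [le_max_left a 1]
  · have h1 := (hB t ⟨ht, h0⟩).trans (le_max_right K B)
    rw [norm_eq_abs, abs_mul, abs_of_pos (exp_pos _)] at h1
    rw [neg_mul, exp_neg, ← div_eq_mul_inv, le_div_iff₀ (exp_pos _)]
    exact h1

lemma const_mul (hf : RapidDecay f) (c : ℝ) : RapidDecay fun t => c * f t := by
  refine ⟨continuous_const.mul hf.continuous, fun a M => ?_⟩
  obtain ⟨K, hK⟩ := hf.bound a M
  refine ⟨|c| * K, fun t ht => ?_⟩
  rw [abs_mul, mul_assoc]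
  gcongr
  exact hK t ht

lemma add (hf : RapidDecay f) (hg : RapidDecay g) : RapidDecay fun t => f t + g t := by
  refine ⟨hf.continuous.add hg.continuous, fun a M => ?_⟩
  obtain ⟨K, hK⟩ := hf.bound a M
  obtain ⟨L, hL⟩ := hg.bound a M
  refine ⟨K + L, fun t ht => (abs_add_le _ _).trans ?_⟩
  rw [add_mul]
  exact add_le_add (hK t ht) (hL t ht)

lemma exp_mul (hf : RapidDecay f) (c : ℝ) : RapidDecay fun t => exp (c * t) * f t := by
  refine ⟨by have := hf.continuous; fun_prop, fun a M => ?_⟩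
  obtain ⟨K, hK⟩ := hf.bound (a + c) M
  refine ⟨K, fun t ht => ?_⟩
  rw [abs_mul, abs_of_pos (exp_pos _)]
  calc exp (c * t) * |f t| ≤ exp (c * t) * (K * exp (-(a + c) * t)) := by
        gcongr; exact hK t ht
    _ = K * exp (-a * t) := by
        rw [mul_left_comm, ← Real.exp_add]; ring_nf

lemma id_mul (hf : RapidDecay f) : RapidDecay fun t => t * f t := by
  refine ⟨continuous_id.mul hf.continuous, fun a M => ?_⟩
  obtain ⟨K, hK⟩ := (hf.exp_mul 1).bound a M
  obtain ⟨L, hL⟩ := (hf.exp_mul (-1)).bound a M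
  refine ⟨K + L, fun t ht => ?_⟩
  have h1 := hK t ht
  have h2 := hL t ht
  rw [abs_mul, abs_of_pos (exp_pos _)] at h1 h2
  have h3 : |t| ≤ exp (1 * t) + exp (-1 * t) := by
    rw [abs_le]
    constructor <;> linarith [add_one_le_exp (1 * t), add_one_le_exp (-1 * t),
      exp_pos (1 * t), exp_pos (-1 * t)]
  calc |t * f t| = |t| * |f t| := abs_mul _ _
    _ ≤ (exp (1 * t) + exp (-1 * t)) * |f t| := by gcongr
    _ ≤ (K + L) * exp (-a * t) := by linarith

lemma comp_affine (hf : RapidDecay f) {k : ℝ} (hk : 0 < k) (m : ℝ) :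
    RapidDecay fun t => f (k * t + m) := by
  refine ⟨by have := hf.continuous; fun_prop, fun a M => ?_⟩
  obtain ⟨K, hK⟩ := hf.bound (a / k) (k * M + m)
  refine ⟨K * exp (-(a / k) * m), fun t ht => (hK _ (by gcongr)).trans_eq ?_⟩
  rw [mul_assoc, ← Real.exp_add]
  congr 2
  field_simp
  ring

end RapidDecay

namespace ExpGrowth

variable {v w : ℝ → ℝ}

lemma of_abs_le {K : ℝ} (hw : ContinuousOn w (Ici 0)) (h : ∀ x ≥ 0, |w x| ≤ K) :
    ExpGrowth w :=
  ⟨hw, K, 0, by simpa using h⟩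

lemma const (c : ℝ) : ExpGrowth fun _ => c :=
  of_abs_le continuousOn_const fun _ _ => le_rfl

lemma id : ExpGrowth fun x => x := by
  refine ⟨continuousOn_id, 1, 1, fun x hx => ?_⟩
  rw [abs_of_nonneg hx, one_mul, one_mul]
  linarith [add_one_le_exp x]

lemma mul (hv : ExpGrowth v) (hw : ExpGrowth w) : ExpGrowth fun x => v x * w x := by
  obtain ⟨K, a, hK⟩ := hv.bound
  obtain ⟨L, b, hL⟩ := hw.bound
  refine ⟨hv.continuousOn.mul hw.continuousOn, K * L, a + b, fun x hx => ?_⟩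
  rw [abs_mul, add_mul, Real.exp_add, mul_mul_mul_comm]
  exact mul_le_mul (hK x hx) (hL x hx) (abs_nonneg _) ((abs_nonneg _).trans (hK x hx))

lemma add (hv : ExpGrowth v) (hw : ExpGrowth w) : ExpGrowth fun x => v x + w x := by
  obtain ⟨K, a, hK⟩ := hv.bound
  obtain ⟨L, b, hL⟩ := hw.bound
  have hK0 : 0 ≤ K := by simpa using (abs_nonneg _).trans (hK 0 le_rfl)
  have hL0 : 0 ≤ L := by simpa using (abs_nonneg _).trans (hL 0 le_rfl)
  refine ⟨hv.continuousOn.add hw.continuousOn, K + L, max a b, fun x hx => ?_⟩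
  rw [add_mul]
  refine (abs_add_le _ _).trans (add_le_add ((hK x hx).trans ?_) ((hL x hx).trans ?_))
  · gcongr; exact le_max_left _ _
  · gcongr; exact le_max_right _ _

end ExpGrowth

lemma RapidDecay.expGrowth {f : ℝ → ℝ} (hf : RapidDecay f) : ExpGrowth f := by
  obtain ⟨K, hK⟩ := hf.bound 0 0
  exact ⟨hf.continuous.continuousOn, K, -0, hK⟩

variable {w w' f f' : ℝ → ℝ} {c : ℝ}

lemma exists_abs_mul_le (hw : ExpGrowth w) (hf : RapidDecay f) (hc : 0 < c) (M : ℝ) :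
    ∃ K, ∀ t ≥ M, ∀ x ≥ 0, |w x * f (c * x + t)| ≤ K * exp (-x) := by
  obtain ⟨K, a, hK⟩ := hw.bound
  have hK0 : 0 ≤ K := by simpa using (abs_nonneg _).trans (hK 0 le_rfl)
  obtain ⟨A, hA, hA0⟩ : ∃ A, a + 1 ≤ A * c ∧ 0 ≤ A :=
    ⟨max (a + 1) 0 / c, by rw [div_mul_cancel₀ _ hc.ne']; exact le_max_left _ _, by positivity⟩
  obtain ⟨L, hL⟩ := hf.bound A M
  have hL0 : 0 ≤ L :=
    nonneg_of_mul_nonneg_left ((abs_nonneg _).trans (hL M le_rfl)) (exp_pos _)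
  refine ⟨K * L * exp (-A * M), fun t ht x hx => ?_⟩
  have hcx : 0 ≤ c * x := by positivity
  rw [abs_mul]
  calc |w x| * |f (c * x + t)|
      ≤ (K * exp (a * x)) * (L * exp (-A * (c * x + t))) := by
        gcongr
        · exact hK x hx
        · exact hL _ (by linarith)
    _ = K * L * exp (a * x + -A * (c * x + t)) := by rw [Real.exp_add]; ring
    _ ≤ K * L * exp (-A * M + -x) := by
        refine mul_le_mul_of_nonneg_left (exp_le_exp.2 ?_) (by positivity)
        nlinarith [mul_le_mul_of_nonneg_right hA hx, mul_le_mul_of_nonneg_left ht hA0]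
    _ = _ := by rw [Real.exp_add]; ring

lemma integrableOn_exp_neg_Ioi_zero : IntegrableOn (fun x : ℝ => exp (-x)) (Ioi 0) := by
  simpa using exp_neg_integrableOn_Ioi 0 one_pos

lemma aestronglyMeasurable_mul_comp_affine (hw : ExpGrowth w) (hf : RapidDecay f) (c t : ℝ) :
    AEStronglyMeasurable (fun x => w x * f (c * x + t)) (volume.restrict (Ioi 0)) := by
  refine ContinuousOn.aestronglyMeasurable ?_ measurableSet_Ioi
  have := hf.continuous
  exact (hw.continuousOn.mono Ioi_subset_Ici_self).mul (by fun_prop)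

lemma integrableOn_mul_comp_affine (hw : ExpGrowth w) (hf : RapidDecay f) (hc : 0 < c) (t : ℝ) :
    IntegrableOn (fun x => w x * f (c * x + t)) (Ioi 0) := by
  obtain ⟨K, hK⟩ := exists_abs_mul_le hw hf hc t
  refine Integrable.mono' (integrableOn_exp_neg_Ioi_zero.const_mul K)
    (aestronglyMeasurable_mul_comp_affine hw hf c t) ?_
  filter_upwards [ae_restrict_mem measurableSet_Ioi] with x hx
  exact hK t le_rfl x (le_of_lt hx)

lemma integrableOn_mul (hw : ExpGrowth w) (hf : RapidDecay f) :
    IntegrableOn (fun x => w x * f x) (Ioi 0) := by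
  simpa using integrableOn_mul_comp_affine hw hf one_pos 0

/-- The half-line pairing `t ↦ ∫₀^∞ w(x) f(c x + t) dx`. -/
noncomputable def halfLinePairing (w f : ℝ → ℝ) (c t : ℝ) : ℝ :=
  ∫ x in Ioi (0 : ℝ), w x * f (c * x + t)

lemma hasDerivAt_halfLinePairing (hw : ExpGrowth w) (hf : RapidDecay f) (hf' : RapidDecay f')
    (hd : ∀ t, HasDerivAt f (f' t) t) (hc : 0 < c) (t : ℝ) :
    HasDerivAt (halfLinePairing w f c) (halfLinePairing w f' c t) t := by
  obtain ⟨K, hK⟩ := exists_abs_mul_le hw hf' hc (t - 1)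
  refine (hasDerivAt_integral_of_dominated_loc_of_deriv_le (s := Ioi (t - 1))
    (F := fun s x => w x * f (c * x + s)) (F' := fun s x => w x * f' (c * x + s))
    (bound := fun x => K * exp (-x)) (Ioi_mem_nhds (by linarith))
    (Eventually.of_forall fun s => aestronglyMeasurable_mul_comp_affine hw hf c s)
    (integrableOn_mul_comp_affine hw hf hc t)
    (aestronglyMeasurable_mul_comp_affine hw hf' c t) ?_
    (integrableOn_exp_neg_Ioi_zero.const_mul K) ?_).2
  · filter_upwards [ae_restrict_mem measurableSet_Ioi] with x hx s hs
    exact hK s (le_of_lt hs) x (le_of_lt hx)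
  · refine Eventually.of_forall fun x s _ => ?_
    exact ((hd (c * x + s)).comp_const_add (c * x) s).const_mul (w x)

lemma expGrowth_halfLinePairing (hw : ExpGrowth w) (hf : RapidDecay f) (hf' : RapidDecay f')
    (hd : ∀ t, HasDerivAt f (f' t) t) (hc : 0 < c) : ExpGrowth (halfLinePairing w f c) := by
  obtain ⟨K, hK⟩ := exists_abs_mul_le hw hf hc 0
  refine ExpGrowth.of_abs_le (K := K) (fun t _ =>
    (hasDerivAt_halfLinePairing hw hf hf' hd hc t).continuousAt.continuousWithinAt) fun t ht => ?_
  have h := norm_integral_le_of_norm_le (integrableOn_exp_neg_Ioi_zero.const_mul K)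
    (f := fun x => w x * f (c * x + t)) ?_
  · rwa [integral_const_mul, integral_exp_neg_Ioi_zero, mul_one] at h
  · filter_upwards [ae_restrict_mem measurableSet_Ioi] with x hx
    exact hK t ht x (le_of_lt hx)

/-- Integrability on the quarter plane of the kernel `h(x + y)` against two half-line weights. -/
lemma integrable_prod_kernel {h : ℝ → ℝ} (hw : ExpGrowth w) (hh : RapidDecay h)
    (hf : RapidDecay f) (hc : 0 < c) (t : ℝ) :
    Integrable (fun z : ℝ × ℝ => w z.1 * (h (z.1 + z.2) * f (c * z.2 + t)))
      ((volume.restrict (Ioi 0)).prod (volume.restrict (Ioi 0))) := by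
  obtain ⟨K, hK⟩ := exists_abs_mul_le hw hh one_pos 0
  obtain ⟨L, hL⟩ := exists_abs_mul_le (ExpGrowth.const 1) hf hc t
  refine Integrable.mono' ((integrableOn_exp_neg_Ioi_zero.const_mul K).mul_prod
    (integrableOn_exp_neg_Ioi_zero.const_mul L)) ?_ ?_
  · rw [Measure.prod_restrict]
    refine ContinuousOn.aestronglyMeasurable ?_ (measurableSet_Ioi.prod measurableSet_Ioi)
    have h1 := hh.continuous
    have h2 := hf.continuous
    have h3 : ContinuousOn (fun z : ℝ × ℝ => w z.1) (Ioi 0 ×ˢ Ioi 0) :=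
      hw.continuousOn.comp continuousOn_fst fun z hz => Ioi_subset_Ici_self hz.1
    exact h3.mul (by fun_prop)
  · rw [Measure.prod_restrict]
    filter_upwards [ae_restrict_mem (measurableSet_Ioi.prod measurableSet_Ioi)] with z hz
    have h1 := hK z.2 (le_of_lt hz.2) z.1 (le_of_lt hz.1)
    have h2 := hL t le_rfl z.2 (le_of_lt hz.2)
    rw [one_mul] at h1 h2
    rw [norm_eq_abs, ← mul_assoc, abs_mul]
    exact mul_le_mul h1 h2 (abs_nonneg _) ((abs_nonneg _).trans h1)

/-- Fubini for the kernel `h(x + y)` on the quarter plane. -/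
lemma integral_mul_kernel {h : ℝ → ℝ} (hw : ExpGrowth w) (hh : RapidDecay h)
    (hf : RapidDecay f) (hc : 0 < c) (t : ℝ) :
    ∫ x in Ioi (0 : ℝ), w x * ∫ y in Ioi (0 : ℝ), h (x + y) * f (c * y + t)
      = halfLinePairing (halfLinePairing w h 1) f c t := by
  simp only [halfLinePairing, ← integral_const_mul, ← integral_mul_const]
  rw [integral_integral_swap (integrable_prod_kernel hw hh hf hc t)]
  simp only [one_mul, mul_assoc]

lemma integrableOn_mul_kernel {h : ℝ → ℝ} (hw : ExpGrowth w) (hh : RapidDecay h)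
    (hf : RapidDecay f) (hc : 0 < c) (t : ℝ) :
    IntegrableOn (fun x => w x * ∫ y in Ioi (0 : ℝ), h (x + y) * f (c * y + t)) (Ioi 0) := by
  have h := (integrable_prod_kernel hw hh hf hc t).integral_prod_left
  simp only [integral_const_mul] at h
  exact h

/-- Integration by parts on the half line. -/
lemma integral_mul_deriv_eq (hw : ∀ x ≥ 0, HasDerivAt w (w' x) x) (hwg : ExpGrowth w)
    (hwg' : ExpGrowth w') (hf : RapidDecay f) (hf' : RapidDecay f')
    (hd : ∀ t, HasDerivAt f (f' t) t) :
    ∫ x in Ioi (0 : ℝ), w x * f' x = -(w 0 * f 0) - ∫ x in Ioi (0 : ℝ), w' x * f x := by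
  have h := integral_Ioi_mul_deriv_eq_deriv_mul (a := 0) (u := w) (u' := w') (v := f) (v' := f')
    (a' := w 0 * f 0) (b' := 0) (fun x hx => hw x (le_of_lt hx)) (fun x _ => hd x)
    (integrableOn_mul hwg hf') (integrableOn_mul hwg' hf) ?_ ?_
  · rw [h]; ring
  · exact ((hw 0 le_rfl).continuousAt.mul (hd 0).continuousAt).tendsto.mono_left
      nhdsWithin_le_nhds
  · obtain ⟨K, hK⟩ := exists_abs_mul_le hwg hf one_pos 0
    refine squeeze_zero_norm' (a := fun x => K * exp (-x)) ?_ ?_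
    · filter_upwards [eventually_ge_atTop 0] with x hx
      simpa using hK 0 le_rfl x hx
    · simpa using (tendsto_exp_neg_atTop_nhds_zero.const_mul K)

lemma halfLinePairing_linear {w₁ w₂ w₃ w₄ : ℝ → ℝ} (h₁ : ExpGrowth w₁) (h₂ : ExpGrowth w₂)
    (h₃ : ExpGrowth w₃) (h₄ : ExpGrowth w₄) (hf : RapidDecay f) (hc : 0 < c) (t a₁ a₂ a₃ a₄ : ℝ) :
    halfLinePairing (fun x => a₁ * w₁ x + a₂ * w₂ x + a₃ * w₃ x + a₄ * w₄ x) f c t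
      = a₁ * halfLinePairing w₁ f c t + a₂ * halfLinePairing w₂ f c t
        + a₃ * halfLinePairing w₃ f c t + a₄ * halfLinePairing w₄ f c t := by
  have i₁ := (integrableOn_mul_comp_affine h₁ hf hc t).const_mul a₁
  have i₂ := (integrableOn_mul_comp_affine h₂ hf hc t).const_mul a₂
  have i₃ := (integrableOn_mul_comp_affine h₃ hf hc t).const_mul a₃
  have i₄ := (integrableOn_mul_comp_affine h₄ hf hc t).const_mul a₄
  simp only [halfLinePairing, ← integral_const_mul]
  rw [← integral_add i₁ i₂, ← integral_add (i₁.fun_add i₂) i₃,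
    ← integral_add ((i₁.fun_add i₂).fun_add i₃) i₄]
  congr 1 with x
  ring

lemma halfLinePairing_of_linear_ode {f'' : ℝ → ℝ} (hw : ExpGrowth w) (hf : RapidDecay f)
    (hf' : RapidDecay f') {α β γ : ℝ} (hode : ∀ t, f'' t = α * f' t + (β * t + γ) * f t)
    (hc : 0 < c) (t : ℝ) :
    halfLinePairing w f'' c t = α * halfLinePairing w f' c t
      + (β * t + γ) * halfLinePairing w f c t
      + β * c * halfLinePairing (fun x => x * w x) f c t := by
  have i₁ := (integrableOn_mul_comp_affine hw hf' hc t).const_mul α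
  have i₂ := (integrableOn_mul_comp_affine hw hf hc t).const_mul (β * t + γ)
  have i₃ := (integrableOn_mul_comp_affine (ExpGrowth.id.mul hw) hf hc t).const_mul (β * c)
  simp only [halfLinePairing, ← integral_const_mul]
  rw [← integral_add i₁ i₂, ← integral_add (i₁.fun_add i₂) i₃]
  congr 1 with x
  simp only [hode]
  ring

lemma halfLinePairing_deriv (hw : ∀ x ≥ 0, HasDerivAt w (w' x) x) (hwg : ExpGrowth w)
    (hwg' : ExpGrowth w') (hf : RapidDecay f) (hf' : RapidDecay f')
    (hd : ∀ t, HasDerivAt f (f' t) t) (hc : 0 < c) (t : ℝ) :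
    c * halfLinePairing w f' c t = -(w 0 * f t) - halfLinePairing w' f c t := by
  have h := integral_mul_deriv_eq hw hwg hwg' (hf.comp_affine hc t)
    ((hf'.comp_affine hc t).const_mul c) (fun s =>
      ((hd (c * s + t)).comp s (((hasDerivAt_id s).const_mul c).add_const t)).congr_deriv
        (by ring))
  simp only [mul_zero, zero_add] at h
  rw [halfLinePairing, halfLinePairing, ← h, ← integral_const_mul]
  congr 1 with x
  ring

/-- The second-order pairing identity for functions solving the Tracy–Widom system. -/
lemma tracyWidom_halfLinePairing {Q P R f'' : ℝ → ℝ} {q p u v σ : ℝ}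
    (hv : 2 * v = u ^ 2 - q ^ 2) (hQ0 : Q 0 = q) (hP0 : P 0 = p)
    (hQ' : ∀ x ≥ 0, HasDerivAt Q (P x + q * R x - u * Q x) x)
    (hP' : ∀ x ≥ 0, HasDerivAt P ((x + σ - 2 * v) * Q x + p * R x + u * P x) x)
    (hQ : ExpGrowth Q) (hP : ExpGrowth P) (hR : ExpGrowth R)
    (hf : RapidDecay f) (hf' : RapidDecay f') (hf'' : RapidDecay f'')
    (hd : ∀ t, HasDerivAt f (f' t) t) (hd' : ∀ t, HasDerivAt f' (f'' t) t)
    (hc : 0 < c) (t : ℝ) :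
    c ^ 2 * halfLinePairing Q f'' c t
      = halfLinePairing (fun x => x * Q x) f c t + (σ + q ^ 2) * halfLinePairing Q f c t
        - c * q * (f' t + halfLinePairing R f' c t)
        + (p - q * u) * (f t + halfLinePairing R f c t) := by
  have eQ : (fun x => P x + q * R x - u * Q x)
      = fun x => 1 * P x + q * R x + (-u) * Q x + 0 * Q x := by ext x; ring
  have eP : (fun x => (x + σ - 2 * v) * Q x + p * R x + u * P x)
      = fun x => 1 * (x * Q x) + (σ - 2 * v) * Q x + p * R x + u * P x := by ext x; ring
  have hxQ := ExpGrowth.id.mul hQ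
  have gQ : ExpGrowth fun x => P x + q * R x - u * Q x := by
    rw [eQ]
    exact ((((ExpGrowth.const _).mul hP).add ((ExpGrowth.const _).mul hR)).add
      ((ExpGrowth.const _).mul hQ)).add ((ExpGrowth.const _).mul hQ)
  have gP : ExpGrowth fun x => (x + σ - 2 * v) * Q x + p * R x + u * P x := by
    rw [eP]
    exact ((((ExpGrowth.const _).mul hxQ).add ((ExpGrowth.const _).mul hQ)).add
      ((ExpGrowth.const _).mul hR)).add ((ExpGrowth.const _).mul hP)
  have h₁ := halfLinePairing_deriv hQ' hQ gQ hf' hf'' hd' hc t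
  have h₂ := halfLinePairing_deriv hQ' hQ gQ hf hf' hd hc t
  have h₃ := halfLinePairing_deriv hP' hP gP hf hf' hd hc t
  rw [eQ, halfLinePairing_linear hP hR hQ hQ hf' hc, hQ0] at h₁
  rw [eQ, halfLinePairing_linear hP hR hQ hQ hf hc, hQ0] at h₂
  rw [eP, halfLinePairing_linear hxQ hQ hR hP hf hc, hP0] at h₃
  linear_combination c * h₁ - h₃ + u * h₂ - halfLinePairing Q f c t * hv

lemma exists_derivs_exp_mul_airy {Ai Ai' : ℝ → ℝ} (hAi : RapidDecay Ai) (hAi' : RapidDecay Ai')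
    (hd : ∀ t, HasDerivAt Ai (Ai' t) t) (hd' : ∀ t, HasDerivAt Ai' (t * Ai t) t)
    {F : ℝ → ℝ} {a k : ℝ} (hk : 0 < k) (c m : ℝ)
    (hF : ∀ t, F t = c * exp (-a * t) * Ai (k * (t + m))) :
    ∃ F' F'' : ℝ → ℝ, RapidDecay F ∧ RapidDecay F' ∧ RapidDecay F''
      ∧ (∀ t, HasDerivAt F (F' t) t) ∧ (∀ t, HasDerivAt F' (F'' t) t)
      ∧ ∀ t, F'' t = -2 * a * F' t + (k ^ 3 * t + (k ^ 3 * m - a ^ 2)) * F t := by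
  have eF : F = fun t => c * (exp (-a * t) * Ai (k * t + k * m)) := by
    ext t; rw [hF]; ring_nf
  have rA := ((hAi.comp_affine hk (k * m)).exp_mul (-a)).const_mul c
  have rA' := ((hAi'.comp_affine hk (k * m)).exp_mul (-a)).const_mul c
  have dl : ∀ t, HasDerivAt (fun t => k * t + k * m) k t := fun t => by
    simpa using ((hasDerivAt_id t).const_mul k).add_const (k * m)
  have de : ∀ t, HasDerivAt (fun t => exp (-a * t)) (exp (-a * t) * -a) t := fun t => by
    simpa using ((hasDerivAt_id t).const_mul (-a)).exp
  have dA : ∀ t, HasDerivAt (fun t => c * (exp (-a * t) * Ai (k * t + k * m)))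
      (-a * (c * (exp (-a * t) * Ai (k * t + k * m)))
        + k * (c * (exp (-a * t) * Ai' (k * t + k * m)))) t := fun t =>
    (((de t).mul ((hd (k * t + k * m)).comp t (dl t))).const_mul c).congr_deriv (by
      simp only [Function.comp]; ring)
  have dA' : ∀ t, HasDerivAt (fun t => c * (exp (-a * t) * Ai' (k * t + k * m)))
      (-a * (c * (exp (-a * t) * Ai' (k * t + k * m)))
        + k * ((k * t + k * m) * (c * (exp (-a * t) * Ai (k * t + k * m))))) t := fun t =>
    (((de t).mul ((hd' (k * t + k * m)).comp t (dl t))).const_mul c).congr_deriv (by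
      simp only [Function.comp]; ring)
  subst eF
  set f := fun t => c * (exp (-a * t) * Ai (k * t + k * m))
  set g := fun t => c * (exp (-a * t) * Ai' (k * t + k * m))
  have r1 : RapidDecay fun t => -a * f t + k * g t := (rA.const_mul _).add (rA'.const_mul _)
  refine ⟨fun t => -a * f t + k * g t,
    fun t => -2 * a * (-a * f t + k * g t) + (k ^ 3 * t + (k ^ 3 * m - a ^ 2)) * f t,
    rA, r1, ?_, dA, fun t => ?_, fun t => rfl⟩
  · convert! (r1.const_mul (-2 * a)).add ((rA.id_mul.const_mul (k ^ 3)).add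
      (rA.const_mul (k ^ 3 * m - a ^ 2))) using 2
    ring
  · exact (((dA t).const_mul (-a)).add ((dA' t).const_mul k)).congr_deriv (by
      simp only [f, g]; ring)

/-- **The Airy-resolvent expressions `p₁`, `p₂` satisfy the first second-order equation of
the Lax-pair system for the tacnode Riemann–Hilbert matrix**:
`r₁⁻² p₁'' = 2τ p₁' + C² D⁻¹ q p₂' + (C q² - z + 2s₁/r₁ - r₁²τ²) p₁ - C D⁻¹ q̇ p₂`. -/
theorem p1_p2_satisfy_second_order_Lax_equation
    (Ai : ℝ → ℝ) (hAi : ContDiff ℝ 2 Ai)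
    (hAieq : ∀ x : ℝ, deriv (deriv Ai) x = x * Ai x)
    (hAidecay : ∀ a > (0 : ℝ), ∃ Ca > (0 : ℝ), ∀ x ≥ (0 : ℝ),
      |Ai x| + |deriv Ai x| ≤ Ca * Real.exp (-a * x))
    (r₁ r₂ : ℝ) (hr₁ : 0 < r₁) (hr₂ : 0 < r₂) (s₁ s₂ τ : ℝ)
    (C D σ : ℝ)
    (hC : C = ((r₁ ^ 2)⁻¹ + (r₂ ^ 2)⁻¹) ^ ((1 : ℝ) / 3))
    (hD : D = Real.sqrt (r₁ / r₂) *
      Real.exp ((r₁ ^ 4 - r₂ ^ 4) * τ ^ 3 / 3 + 2 * (r₂ * s₂ - r₁ * s₁) * τ))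
    (hσ : σ = C⁻¹ * (2 * (s₁ / r₁ + s₂ / r₂) - (r₁ ^ 2 + r₂ ^ 2) * τ ^ 2))
    (b bt : ℝ → ℝ → ℝ)
    (hb : ∀ z x, b z x = Real.sqrt (2 * π) * r₂ ^ ((1 : ℝ) / 6) *
      Real.exp (-(r₂ ^ 2) * τ * (z + C * x)) *
      Ai (r₂ ^ ((2 : ℝ) / 3) * (z + C * x + 2 * s₂ / r₂)))
    (hbt : ∀ z x, bt z x = Real.sqrt (2 * π) * r₁ ^ ((1 : ℝ) / 6) *
      Real.exp (r₁ ^ 2 * τ * (z - C * x)) *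
      Ai (r₁ ^ ((2 : ℝ) / 3) * (-z + C * x + 2 * s₁ / r₁)))
    (A : ℝ → ℝ → ℝ)
    (hA : ∀ z x, A z x = b z x - D * ∫ y in Ioi (0 : ℝ), Ai (x + y + σ) * bt z y)
    -- Tracy–Widom scalars and functions
    (q p u v qd : ℝ) (hqd : qd = p - q * u) (hv : 2 * v = u ^ 2 - q ^ 2)
    (Q P R₀ : ℝ → ℝ)
    (hQ0 : Q 0 = q) (hP0 : P 0 = p)
    (hQ' : ∀ x ≥ (0 : ℝ), HasDerivAt Q (P x + q * R₀ x - u * Q x) x)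
    (hP' : ∀ x ≥ (0 : ℝ), HasDerivAt P ((x + σ - 2 * v) * Q x + p * R₀ x + u * P x) x)
    (hR₀ : ContDiffOn ℝ 1 R₀ (Ici 0))
    (hu : (∫ x in Ioi (0 : ℝ), Q x * Ai (x + σ)) = u)
    (hvQ : (∫ x in Ioi (0 : ℝ), Q x * deriv Ai (x + σ)) = v)
    (hvP : (∫ x in Ioi (0 : ℝ), P x * Ai (x + σ)) = v)
    (hdecay : ∃ C₀ > (0 : ℝ), ∀ x ≥ (0 : ℝ),
      |Q x| + |P x| + |R₀ x| ≤ C₀ * Real.exp (-x))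
    (p₁ p₂ : ℝ → ℝ)
    (hp₁ : ∀ z, p₁ z = bt z 0 - D⁻¹ * ∫ x in Ioi (0 : ℝ), Q x * A z x)
    (hp₂ : ∀ z, p₂ z = A z 0 + ∫ x in Ioi (0 : ℝ), R₀ x * A z x) :
    Differentiable ℝ p₁ ∧ Differentiable ℝ (deriv p₁)
    ∧ Differentiable ℝ p₂ ∧ Differentiable ℝ (deriv p₂)
    ∧ ∀ z : ℝ,
      (r₁ ^ 2)⁻¹ * deriv (deriv p₁) z
        = 2 * τ * deriv p₁ z + C ^ 2 * D⁻¹ * q * deriv p₂ z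
          + (C * q ^ 2 - z + 2 * s₁ / r₁ - r₁ ^ 2 * τ ^ 2) * p₁ z
          - C * D⁻¹ * qd * p₂ z := by
  -- regularity of the Airy function
  have dAi : ∀ t, HasDerivAt Ai (deriv Ai t) t := fun t =>
    (hAi.differentiable two_ne_zero t).hasDerivAt
  have hAi1 : ContDiff ℝ 1 (deriv Ai) := ((contDiff_succ_iff_deriv (n := 1)).1 hAi).2.2
  have dAi' : ∀ t, HasDerivAt (deriv Ai) (t * Ai t) t := fun t => by
    rw [← hAieq]; exact (hAi1.differentiable one_ne_zero t).hasDerivAt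
  have rAi : RapidDecay Ai := RapidDecay.of_nonneg hAi.continuous fun a ha => by
    obtain ⟨K, -, hK⟩ := hAidecay a ha
    exact ⟨K, fun t ht => by linarith [hK t ht, abs_nonneg (deriv Ai t)]⟩
  have rAi' : RapidDecay (deriv Ai) := RapidDecay.of_nonneg hAi1.continuous fun a ha => by
    obtain ⟨K, -, hK⟩ := hAidecay a ha
    exact ⟨K, fun t ht => by linarith [hK t ht, abs_nonneg (Ai t)]⟩
  -- the constants
  have hC0 : 0 < C := by rw [hC]; positivity
  have hC3 : C ^ 3 = (r₁ ^ 2)⁻¹ + (r₂ ^ 2)⁻¹ := by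
    rw [hC, ← rpow_natCast, ← rpow_mul (by positivity)]; norm_num
  have hD0 : D ≠ 0 := by rw [hD]; positivity
  have hCσ : C * σ = 2 * s₁ / r₁ + 2 * s₂ / r₂ - (r₁ ^ 2 + r₂ ^ 2) * τ ^ 2 := by
    rw [hσ, mul_inv_cancel_left₀ hC0.ne']
    ring
  have hcube : ∀ r : ℝ, 0 < r → (r ^ ((2 : ℝ) / 3)) ^ 3 = r ^ 2 := fun r hr => by
    rw [← rpow_natCast, ← rpow_mul hr.le]; norm_num
  -- the profiles of `b` and `bt`
  obtain ⟨F, hF⟩ : ∃ F : ℝ → ℝ, ∀ t, F t = Real.sqrt (2 * π) * r₁ ^ ((1 : ℝ) / 6)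
    * Real.exp (-(r₁ ^ 2 * τ) * t) * Ai (r₁ ^ ((2 : ℝ) / 3) * (t + 2 * s₁ / r₁)) := ⟨_, fun _ => rfl⟩
  obtain ⟨G, hG⟩ : ∃ G : ℝ → ℝ, ∀ t, G t = Real.sqrt (2 * π) * r₂ ^ ((1 : ℝ) / 6)
    * Real.exp (-(r₂ ^ 2 * τ) * t) * Ai (r₂ ^ ((2 : ℝ) / 3) * (t + 2 * s₂ / r₂)) := ⟨_, fun _ => rfl⟩
  have hbF : ∀ z x, bt z x = F (C * x + -z) := fun z x => by rw [hbt, hF]; ring_nf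
  have hbG : ∀ z x, b z x = G (C * x + z) := fun z x => by rw [hb, hG]; ring_nf
  obtain ⟨F', F'', rF, rF', rF'', dF, dF', oF⟩ :=
    exists_derivs_exp_mul_airy rAi rAi' dAi dAi' (by positivity) _ _ hF
  obtain ⟨G', G'', rG, rG', rG'', dG, dG', oG⟩ :=
    exists_derivs_exp_mul_airy rAi rAi' dAi dAi' (by positivity) _ _ hG
  rw [hcube r₁ hr₁] at oF
  rw [hcube r₂ hr₂] at oG
  -- the shifted Airy function
  obtain ⟨H, hH⟩ : ∃ H : ℝ → ℝ, ∀ t, H t = Ai (t + σ) := ⟨_, fun _ => rfl⟩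
  obtain ⟨H', hH'⟩ : ∃ H' : ℝ → ℝ, ∀ t, H' t = deriv Ai (t + σ) := ⟨_, fun _ => rfl⟩
  have rH : RapidDecay H := by
    rw [funext hH]; simpa using rAi.comp_affine one_pos σ
  have rH' : RapidDecay H' := by
    rw [funext hH']; simpa using rAi'.comp_affine one_pos σ
  have rH'' : RapidDecay fun t => (t + σ) * H t := by
    simpa only [add_mul] using rH.id_mul.add (rH.const_mul σ)
  have dH : ∀ t, HasDerivAt H (H' t) t := fun t => by
    rw [hH', funext hH]; exact (dAi (t + σ)).comp_add_const t σ
  have dH' : ∀ t, HasDerivAt H' ((t + σ) * H t) t := fun t => by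
    rw [hH, funext hH']; exact (dAi' (t + σ)).comp_add_const t σ
  -- the Tracy–Widom functions
  obtain ⟨C₀, hC₀, hdec⟩ := hdecay
  have hle : ∀ x ≥ (0 : ℝ), |Q x| + |P x| + |R₀ x| ≤ C₀ := fun x hx =>
    (hdec x hx).trans (mul_le_of_le_one_right hC₀.le (exp_le_one_iff.2 (by linarith)))
  have gQ : ExpGrowth Q := ExpGrowth.of_abs_le
    (fun x hx => (hQ' x hx).continuousAt.continuousWithinAt) (K := C₀)
    fun x hx => by linarith [hle x hx, abs_nonneg (P x), abs_nonneg (R₀ x)]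
  have gP : ExpGrowth P := ExpGrowth.of_abs_le
    (fun x hx => (hP' x hx).continuousAt.continuousWithinAt) (K := C₀)
    fun x hx => by linarith [hle x hx, abs_nonneg (Q x), abs_nonneg (R₀ x)]
  have gR : ExpGrowth R₀ := ExpGrowth.of_abs_le hR₀.continuousOn (K := C₀)
    fun x hx => by linarith [hle x hx, abs_nonneg (Q x), abs_nonneg (P x)]
  -- pairings of `Q` and `R₀` with the shifted Airy function
  set hQ := halfLinePairing Q H 1 with hQ_def
  set hR := halfLinePairing R₀ H 1 with hR_def
  set hR' := halfLinePairing R₀ H' 1 with hR'_def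
  have ghQ : ExpGrowth hQ := expGrowth_halfLinePairing gQ rH rH' dH one_pos
  have ghR : ExpGrowth hR := expGrowth_halfLinePairing gR rH rH' dH one_pos
  have ghR' : ExpGrowth hR' := expGrowth_halfLinePairing gR rH' rH'' dH' one_pos
  set k : ℝ → ℝ := fun y => H y + hR y with hk_def
  set k' : ℝ → ℝ := fun y => H' y + hR' y with hk'_def
  have gk : ExpGrowth k := rH.expGrowth.add ghR
  have gk' : ExpGrowth k' := rH'.expGrowth.add ghR'
  have dk : ∀ y, HasDerivAt k (k' y) y := fun y =>
    (dH y).add (hasDerivAt_halfLinePairing gR rH rH' dH one_pos y)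
  have hk0 : q * k 0 = q ^ 2 := by
    have gQ' : ExpGrowth fun x => 1 * P x + q * R₀ x + (-u) * Q x + 0 * Q x :=
      ((((ExpGrowth.const _).mul gP).add ((ExpGrowth.const _).mul gR)).add
        ((ExpGrowth.const _).mul gQ)).add ((ExpGrowth.const _).mul gQ)
    have h := halfLinePairing_deriv (w' := fun x => 1 * P x + q * R₀ x + (-u) * Q x + 0 * Q x)
      (fun x hx => (hQ' x hx).congr_deriv (by ring)) gQ gQ' rH rH' dH one_pos 0
    rw [halfLinePairing_linear gP gR gQ gQ rH one_pos, hQ0] at h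
    have e1 : halfLinePairing Q H 1 0 = u := by simpa [halfLinePairing, hH] using hu
    have e2 : halfLinePairing Q H' 1 0 = v := by simpa [halfLinePairing, hH'] using hvQ
    have e3 : halfLinePairing P H 1 0 = v := by simpa [halfLinePairing, hH] using hvP
    rw [e1, e2, e3] at h
    simp only [hk_def, hR_def]
    linear_combination h - hv
  have hyQ : (fun y => y * hQ y)
      = fun y => (-q) * k' y + qd * k y + q ^ 2 * hQ y + 0 * hQ y := by
    ext y
    have h1 := tracyWidom_halfLinePairing hv hQ0 hP0 hQ' hP' gQ gP gR rH rH' rH'' dH dH' one_pos y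
    have h2 := halfLinePairing_of_linear_ode (f'' := fun t => (t + σ) * H t) (α := 0) (β := 1)
      (γ := σ) gQ rH rH' (fun t => by ring) one_pos y
    simp only [hk_def, hk'_def, hQ_def, hR_def, hR'_def, hqd]
    linear_combination h1 - h2
  -- reduction of `p₁` and `p₂` to single integrals
  have hA' : ∀ z x, A z x = G (C * x + z) - D * ∫ y in Ioi (0 : ℝ), H (x + y) * F (C * y + -z) :=
    fun z x => by simp only [hA, hbG, hbF, hH]
  have hwA : ∀ w, ExpGrowth w → ∀ z, ∫ x in Ioi (0 : ℝ), w x * A z x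
      = halfLinePairing w G C z - D * halfLinePairing (halfLinePairing w H 1) F C (-z) := by
    intro w hw z
    rw [← integral_mul_kernel hw rH rF hC0, halfLinePairing, ← integral_const_mul, ← integral_sub
      (integrableOn_mul_comp_affine hw rG hC0 z)
      ((integrableOn_mul_kernel hw rH rF hC0 (-z)).const_mul D)]
    congr 1 with x
    rw [hA']
    ring
  have ep₁ : p₁ = fun z => F (-z) - D⁻¹ * halfLinePairing Q G C z
      + halfLinePairing hQ F C (-z) := by
    ext z
    rw [hp₁, hwA Q gQ, hbF]
    simp only [mul_zero, zero_add, ← hQ_def]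
    field_simp
    ring
  have ep₂ : p₂ = fun z => G z + halfLinePairing R₀ G C z - D * halfLinePairing k F C (-z) := by
    ext z
    have h := halfLinePairing_linear rH.expGrowth ghR ghR ghR rF hC0 (-z) 1 1 0 0
    have ek : (fun x => 1 * H x + 1 * hR x + 0 * hR x + 0 * hR x) = k := by
      ext x; simp only [hk_def]; ring
    rw [ek] at h
    have eH : halfLinePairing H F C (-z)
        = ∫ y in Ioi (0 : ℝ), H y * F (C * y + -z) := rfl
    rw [hp₂, hwA R₀ gR, ← hR_def, hA', h, eH]
    simp only [mul_zero, zero_add]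
    ring
  -- derivatives
  have d₁ : ∀ z, HasDerivAt p₁ (-F' (-z) - D⁻¹ * halfLinePairing Q G' C z
      - halfLinePairing hQ F' C (-z)) z := fun z => by
    rw [ep₁]
    exact ((((dF (-z)).comp z (hasDerivAt_neg z)).sub
      ((hasDerivAt_halfLinePairing gQ rG rG' dG hC0 z).const_mul D⁻¹)).add
      ((hasDerivAt_halfLinePairing ghQ rF rF' dF hC0 (-z)).comp z (hasDerivAt_neg z))).congr_deriv
      (by ring)
  have d₂ : ∀ z, HasDerivAt p₂ (G' z + halfLinePairing R₀ G' C z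
      + D * halfLinePairing k F' C (-z)) z := fun z => by
    rw [ep₂]
    exact (((dG z).add (hasDerivAt_halfLinePairing gR rG rG' dG hC0 z)).sub
      (((hasDerivAt_halfLinePairing gk rF rF' dF hC0 (-z)).comp z
        (hasDerivAt_neg z)).const_mul D)).congr_deriv (by ring)
  have e₁ := funext fun z => (d₁ z).deriv
  have e₂ := funext fun z => (d₂ z).deriv
  have dd₁ : ∀ z, HasDerivAt (deriv p₁) (F'' (-z) - D⁻¹ * halfLinePairing Q G'' C z
      + halfLinePairing hQ F'' C (-z)) z := fun z => by
    rw [e₁]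
    exact ((((dF' (-z)).comp z (hasDerivAt_neg z)).neg.sub
      ((hasDerivAt_halfLinePairing gQ rG' rG'' dG' hC0 z).const_mul D⁻¹)).sub
      ((hasDerivAt_halfLinePairing ghQ rF' rF'' dF' hC0 (-z)).comp z
        (hasDerivAt_neg z))).congr_deriv (by ring)
  have dd₂ : ∀ z, HasDerivAt (deriv p₂) (G'' z + halfLinePairing R₀ G'' C z
      - D * halfLinePairing k F'' C (-z)) z := fun z => by
    rw [e₂]
    exact (((dG' z).add (hasDerivAt_halfLinePairing gR rG' rG'' dG' hC0 z)).add
      (((hasDerivAt_halfLinePairing gk rF' rF'' dF' hC0 (-z)).comp z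
        (hasDerivAt_neg z)).const_mul D)).congr_deriv (by ring)
  refine ⟨fun z => (d₁ z).differentiableAt, fun z => (dd₁ z).differentiableAt,
    fun z => (d₂ z).differentiableAt, fun z => (dd₂ z).differentiableAt, fun z => ?_⟩
  have h1 := oF (-z)
  have h2 := halfLinePairing_of_linear_ode ghQ rF rF' oF hC0 (-z)
  have h3 := halfLinePairing_of_linear_ode gQ rG rG' oG hC0 z
  have h4 := tracyWidom_halfLinePairing hv hQ0 hP0 hQ' hP' gQ gP gR rG rG' rG'' dG dG' hC0 z
  have h5 := halfLinePairing_deriv (fun y _ => dk y) gk gk' rF rF' dF hC0 (-z)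
  rw [hyQ, halfLinePairing_linear gk' gk ghQ ghQ rF hC0] at h2
  rw [(dd₁ z).deriv, (d₁ z).deriv, (d₂ z).deriv, ep₁, ep₂]
  simp only
  have hX : (r₁ ^ 2)⁻¹ * r₁ ^ 2 = 1 := inv_mul_cancel₀ (by positivity)
  have hY : (r₂ ^ 2)⁻¹ * r₂ ^ 2 = 1 := inv_mul_cancel₀ (by positivity)
  have hDD : D⁻¹ * D = 1 := inv_mul_cancel₀ hD0
  rw [← hqd] at h4
  generalize 2 * s₁ / r₁ = m₁ at h1 h2 hCσ ⊢
  generalize 2 * s₂ / r₂ = m₂ at h3 hCσ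
  generalize (r₁ ^ 2)⁻¹ = X at hX hC3 ⊢
  generalize (r₂ ^ 2)⁻¹ = Y at hY hC3
  generalize D⁻¹ = E at hDD ⊢
  have t1 : X * F'' (-z) = -2 * τ * F' (-z) + (-z + m₁ - r₁ ^ 2 * τ ^ 2) * F (-z) := by
    linear_combination X * h1 + (-2 * τ * F' (-z) + (-z + m₁ - r₁ ^ 2 * τ ^ 2) * F (-z)) * hX
  have t2 : X * halfLinePairing hQ F'' C (-z) = -2 * τ * halfLinePairing hQ F' C (-z)
      + (-z + m₁ - r₁ ^ 2 * τ ^ 2) * halfLinePairing hQ F C (-z)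
      + C * (-q * halfLinePairing k' F C (-z) + qd * halfLinePairing k F C (-z)
        + q ^ 2 * halfLinePairing hQ F C (-z)) := by
    linear_combination X * h2 + (-2 * τ * halfLinePairing hQ F' C (-z)
      + (-z + m₁ - r₁ ^ 2 * τ ^ 2) * halfLinePairing hQ F C (-z)
      + C * (-q * halfLinePairing k' F C (-z) + qd * halfLinePairing k F C (-z)
        + q ^ 2 * halfLinePairing hQ F C (-z))) * hX
  have t3 : Y * halfLinePairing Q G'' C z = -2 * τ * halfLinePairing Q G' C z
      + (z + m₂ - r₂ ^ 2 * τ ^ 2) * halfLinePairing Q G C z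
      + C * halfLinePairing (fun x => x * Q x) G C z := by
    linear_combination Y * h3 + (-2 * τ * halfLinePairing Q G' C z
      + (z + m₂ - r₂ ^ 2 * τ ^ 2) * halfLinePairing Q G C z
      + C * halfLinePairing (fun x => x * Q x) G C z) * hY
  linear_combination t1 + t2 + E * t3 + E * halfLinePairing Q G'' C z * hC3 - E * C * h4
    - E * halfLinePairing Q G C z * hCσ - C * q * h5 + C * F (-z) * hk0
    - (C ^ 2 * q * halfLinePairing k F' C (-z) + C * qd * halfLinePairing k F C (-z)) * hDD
end
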